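/- Let f ∈ Diff^∞_+([0,1]) have vanishing asymptotic variation: Var(log Dfⁿ)/n → 0 as n → ∞. Then for every r ∈ ℕ and every ε > 0 there exists φ ∈ Diff^∞_+([0,1]) with d_r(φ∘f∘φ⁻¹, id) < ε. Moreover: if f is ITI at both 0 and 1, then φ can be chosen to be ITI at 0 and at 1; if f is ITI at none of its fixed points, then φ can be chosen so that, for some λ > 0, φ(x) = λx on a neighborhood of 0 and φ(x) = 1 − λ(1−x) on a neighborhood of 1. -/

import Mathlib

open Filter Set

noncomputable section

/-- An element of `Diff^n_+([0,1])`: a `C^n` diffeomorphism of `[0,1]` fixing `0` and `1`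
with everywhere positive derivative. -/
structure DiffIcc (n : ℕ∞) where
  toFun : ℝ → ℝ
  invFun : ℝ → ℝ
  smooth : ContDiffOn ℝ n toFun (Set.Icc 0 1)
  smooth_inv : ContDiffOn ℝ n invFun (Set.Icc 0 1)
  maps : Set.MapsTo toFun (Set.Icc 0 1) (Set.Icc 0 1)
  maps_inv : Set.MapsTo invFun (Set.Icc 0 1) (Set.Icc 0 1)
  left_inv : ∀ x ∈ Set.Icc (0:ℝ) 1, invFun (toFun x) = x
  right_inv : ∀ x ∈ Set.Icc (0:ℝ) 1, toFun (invFun x) = x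
  fix0 : toFun 0 = 0
  fix1 : toFun 1 = 1
  deriv_pos : ∀ x ∈ Set.Icc (0:ℝ) 1, 0 < derivWithin toFun (Set.Icc 0 1) x

/-- `d_r(f, g) < ε` for maps of `[0,1]`. -/
def IDistLt (r : ℕ) (ε : ℝ) (f g : ℝ → ℝ) : Prop :=
  ∀ k ≤ r, ∀ x ∈ Set.Icc (0:ℝ) 1,
    |iteratedDerivWithin k f (Set.Icc 0 1) x - iteratedDerivWithin k g (Set.Icc 0 1) x| < ε

/-- `f` is infinitely tangent to the identity (ITI) at `a`:
`Df(a) = 1` and `D^k f(a) = 0` for all `k ≥ 2`. -/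
def ITIat (f : ℝ → ℝ) (a : ℝ) : Prop :=
  derivWithin f (Set.Icc 0 1) a = 1 ∧
    ∀ k : ℕ, 2 ≤ k → iteratedDerivWithin k f (Set.Icc 0 1) a = 0

/-- The asymptotic variation of `f` vanishes: `Var(log Dfⁿ)/n → 0`. -/
def IAsympVarVanishes (f : ℝ → ℝ) : Prop :=
  Tendsto (fun n : ℕ =>
      (eVariationOn (fun x => Real.log (derivWithin f^[n] (Set.Icc 0 1) x))
          (Set.Icc 0 1)).toReal / n)
    atTop (nhds 0)

open scoped ContDiff Topology

theorem norm_iteratedFDerivWithin_eq_abs {f : ℝ → ℝ} {s : Set ℝ} (hs : IsOpen s) {x : ℝ}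
    (hx : x ∈ s) (n : ℕ) : ‖iteratedFDerivWithin ℝ n f s x‖ = |iteratedDeriv n f x| := by
  rw [norm_iteratedFDerivWithin_eq_norm_iteratedDerivWithin, iteratedDerivWithin_of_isOpen hs hx,
    Real.norm_eq_abs]

theorem ContDiffAt.exists_open_contDiffOn {f : ℝ → ℝ} {x : ℝ} {n : ℕ} (hf : ContDiffAt ℝ n f x) :
    ∃ s, IsOpen s ∧ x ∈ s ∧ ContDiffOn ℝ n f s := by
  obtain ⟨u, hu, hfu⟩ := hf.contDiffOn le_rfl (by simp)
  obtain ⟨s, hsu, hs, hx⟩ := mem_nhds_iff.1 (by simpa using hu)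
  exact ⟨s, hs, hx, hfu.mono hsu⟩

/-- Bound on the iterated derivatives of a composition, at a point. -/
theorem abs_iteratedDeriv_comp_le {g f : ℝ → ℝ} {x : ℝ} {n : ℕ} (hg : ContDiffAt ℝ n g (f x))
    (hf : ContDiffAt ℝ n f x) {C D : ℝ} (hC : ∀ i ≤ n, |iteratedDeriv i g (f x)| ≤ C)
    (hD : ∀ i, 1 ≤ i → i ≤ n → |iteratedDeriv i f x| ≤ D ^ i) :
    |iteratedDeriv n (g ∘ f) x| ≤ n.factorial * C * D ^ n := by
  obtain ⟨t, ht, hxt, hgt⟩ := hg.exists_open_contDiffOn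
  obtain ⟨s, hs, hxs, hfs⟩ := hf.exists_open_contDiffOn
  have ho : IsOpen (s ∩ f ⁻¹' t) := hfs.continuousOn.isOpen_inter_preimage hs ht
  have hx : x ∈ s ∩ f ⁻¹' t := ⟨hxs, hxt⟩
  rw [← norm_iteratedFDerivWithin_eq_abs ho hx]
  refine norm_iteratedFDerivWithin_comp_le hgt (hfs.mono inter_subset_left) le_rfl
    ht.uniqueDiffOn ho.uniqueDiffOn (fun y hy => hy.2) hx ?_ ?_
  · intro i hi; rw [norm_iteratedFDerivWithin_eq_abs ht hxt]; exact hC i hi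
  · intro i h1 hi; rw [norm_iteratedFDerivWithin_eq_abs ho hx]; exact hD i h1 hi

theorem abs_iteratedDeriv_mul_le {f g : ℝ → ℝ} {x : ℝ} {n : ℕ} (hf : ContDiffAt ℝ n f x)
    (hg : ContDiffAt ℝ n g x) {A B : ℝ} (hA : ∀ i ≤ n, |iteratedDeriv i f x| ≤ A)
    (hB : ∀ i ≤ n, |iteratedDeriv i g x| ≤ B) :
    |iteratedDeriv n (fun y => f y * g y) x| ≤ 2 ^ n * (A * B) := by
  have hA0 : 0 ≤ A := (abs_nonneg _).trans (hA 0 (Nat.zero_le _))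
  have h : iteratedDeriv n (fun y => f y * g y) x = _ := iteratedDeriv_mul hf hg
  rw [h]
  refine (Finset.abs_sum_le_sum_abs _ _).trans ?_
  have : ∀ i ∈ Finset.range (n + 1), |(n.choose i : ℝ) * iteratedDeriv i f x *
      iteratedDeriv (n - i) g x| ≤ n.choose i * (A * B) := by
    intro i hi
    rw [abs_mul, abs_mul, Nat.abs_cast, mul_assoc]
    have := hA i (by simp at hi; omega)
    have := hB (n - i) (by omega)
    gcongr
  refine (Finset.sum_le_sum this).trans ?_
  rw [← Finset.sum_mul]
  have := Nat.sum_range_choose n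
  rw [← Nat.cast_sum, this]; push_cast; exact le_rfl

theorem ContDiffAt.of_comp {E F φ : ℝ → ℝ} {y : ℝ} (hE : ContDiffAt ℝ ∞ E y)
    (hE' : deriv E y ≠ 0) (hF : ContDiffAt ℝ ∞ F y) (h : φ ∘ E =ᶠ[𝓝 y] F) :
    ContDiffAt ℝ ∞ φ (E y) := by
  have hd : HasDerivAt E (deriv E y) y := (hE.differentiableAt (by simp)).hasDerivAt
  have hfd := hd.hasFDerivAt_equiv hE'
  have hn : (∞ : WithTop ℕ∞) ≠ 0 := by simp
  have hinv := hE.to_localInverse hfd hn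
  have h0 := hE.localInverse_apply_image hfd hn
  have hst := hE.hasStrictFDerivAt' hfd hn
  have hr := hst.eventually_right_inverse
  have ht : Tendsto (hE.localInverse hfd hn) (𝓝 (E y)) (𝓝 y) := by
    have := hinv.continuousAt.tendsto
    rwa [h0] at this
  have hc : ContDiffAt ℝ ∞ (F ∘ hE.localInverse hfd hn) (E y) :=
    ContDiffAt.comp _ (by rw [h0]; exact hF) hinv
  refine hc.congr_of_eventuallyEq ?_
  filter_upwards [hr, ht.eventually h] with z hz1 hz2
  simp only [Function.comp_apply] at hz2 ⊢
  rw [← hz2]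
  congr 1
  exact hz1.symm


theorem ContDiffAt.deriv_infty {f : ℝ → ℝ} {x : ℝ} (hf : ContDiffAt ℝ ∞ f x) :
    ContDiffAt ℝ ∞ (deriv f) x := hf.derivWithin (by simp)

theorem ContDiffAt.iteratedDeriv_infty {f : ℝ → ℝ} {x : ℝ} (hf : ContDiffAt ℝ ∞ f x) (n : ℕ) :
    ContDiffAt ℝ ∞ (iteratedDeriv n f) x := by
  induction n with
  | zero => simpa using hf
  | succ n ih => rw [iteratedDeriv_succ]; exact ih.deriv_infty

theorem ContDiffAt.hasDerivAt_iteratedDeriv {f : ℝ → ℝ} {x : ℝ} (hf : ContDiffAt ℝ ∞ f x)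
    (n : ℕ) : HasDerivAt (iteratedDeriv n f) (iteratedDeriv (n + 1) f x) x := by
  rw [iteratedDeriv_succ]
  exact ((hf.iteratedDeriv_infty n).differentiableAt (by simp)).hasDerivAt

theorem ContDiffAt.of_infty {f : ℝ → ℝ} {x : ℝ} (hf : ContDiffAt ℝ ∞ f x) (n : ℕ) :
    ContDiffAt ℝ n f x := hf.of_le (by exact_mod_cast le_top)

theorem ContDiffAt.eventually_differentiableAt {f : ℝ → ℝ} {x : ℝ} (hf : ContDiffAt ℝ ∞ f x) :
    ∀ᶠ y in 𝓝 x, DifferentiableAt ℝ f y := by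
  filter_upwards [(hf.of_infty 1).eventually (by simp)] with y hy
  exact hy.differentiableAt (by simp)

theorem iteratedDeriv_comp_bound (n : ℕ) (B : ℝ) : ∃ C ≥ (1:ℝ), ∀ (g f : ℝ → ℝ) (x κ : ℝ),
    ContDiffAt ℝ ∞ g (f x) → ContDiffAt ℝ ∞ f x → (∀ i ≤ n, |iteratedDeriv i g (f x)| ≤ κ) →
    (∀ i, 1 ≤ i → i ≤ n → |iteratedDeriv i f x| ≤ B) →
    ∀ i ≤ n, |iteratedDeriv i (g ∘ f) x| ≤ C * κ := by
  refine ⟨n.factorial * (max 1 B) ^ n, ?_, ?_⟩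
  · have h1 : (1:ℝ) ≤ n.factorial := by exact_mod_cast Nat.one_le_iff_ne_zero.2 n.factorial_ne_zero
    exact one_le_mul_of_one_le_of_one_le h1 (one_le_pow₀ (le_max_left _ _))
  intro g f x κ hg hf hk hB i hi
  have hk0 : 0 ≤ κ := (abs_nonneg _).trans (hk 0 (Nat.zero_le _))
  have h := abs_iteratedDeriv_comp_le (n := i) (hg.of_infty i) (hf.of_infty i) (C := κ)
    (D := max 1 B) (fun j hj => hk j (hj.trans hi)) (fun j h1 hj =>
      (hB j h1 (hj.trans hi)).trans ((le_max_right 1 B).trans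
        (le_self_pow₀ (le_max_left _ _) (by omega))))
  refine h.trans ?_
  have h1 : (i.factorial : ℝ) ≤ n.factorial := by exact_mod_cast Nat.factorial_le hi
  have h2 : (max 1 B) ^ i ≤ (max 1 B) ^ n := pow_le_pow_right₀ (le_max_left _ _) hi
  calc i.factorial * κ * max 1 B ^ i ≤ n.factorial * κ * max 1 B ^ n := by gcongr
    _ = _ := by ring

theorem iteratedDeriv_mul_bound {f g : ℝ → ℝ} {x : ℝ} {n : ℕ} (hf : ContDiffAt ℝ ∞ f x)
    (hg : ContDiffAt ℝ ∞ g x) {A B : ℝ} (hA : ∀ i ≤ n, |iteratedDeriv i f x| ≤ A)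
    (hB : ∀ i ≤ n, |iteratedDeriv i g x| ≤ B) :
    ∀ i ≤ n, |iteratedDeriv i (fun y => f y * g y) x| ≤ 2 ^ n * (A * B) := by
  intro i hi
  have hA0 : 0 ≤ A := (abs_nonneg _).trans (hA 0 (Nat.zero_le _))
  have hB0 : 0 ≤ B := (abs_nonneg _).trans (hB 0 (Nat.zero_le _))
  refine (abs_iteratedDeriv_mul_le (hf.of_infty i) (hg.of_infty i)
    (fun j hj => hA j (hj.trans hi)) (fun j hj => hB j (hj.trans hi))).trans ?_
  gcongr
  norm_num

theorem iteratedDeriv_inv_bound (n : ℕ) (m B : ℝ) (hm : 0 < m) : ∃ C ≥ (1:ℝ),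
    ∀ (f : ℝ → ℝ) (x : ℝ), ContDiffAt ℝ ∞ f x → m ≤ f x →
    (∀ i, 1 ≤ i → i ≤ n → |iteratedDeriv i f x| ≤ B) →
    ∀ i ≤ n, |iteratedDeriv i (fun y => (f y)⁻¹) x| ≤ C := by
  obtain ⟨C, hC1, hC⟩ := iteratedDeriv_comp_bound n B
  set M : ℝ := n.factorial * (max 1 m⁻¹) ^ (n + 1) with hM
  refine ⟨C * M, ?_, ?_⟩
  · have h1 : (1:ℝ) ≤ n.factorial := by exact_mod_cast Nat.one_le_iff_ne_zero.2 n.factorial_ne_zero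
    exact one_le_mul_of_one_le_of_one_le hC1
      (one_le_mul_of_one_le_of_one_le h1 (one_le_pow₀ (le_max_left _ _)))
  intro f x hf hfx hB i hi
  have hpos : 0 < f x := hm.trans_le hfx
  refine hC Inv.inv f x M (contDiffAt_inv ℝ hpos.ne') hf ?_ hB i hi
  intro j hj
  rw [iteratedDeriv_eq_iterate, iter_deriv_inv, abs_mul, abs_mul, abs_pow, abs_neg, abs_one,
    one_pow, one_mul, Nat.abs_cast]
  have h1 : (j.factorial : ℝ) ≤ n.factorial := by exact_mod_cast Nat.factorial_le hj
  have h2 : |f x ^ (-1 - j : ℤ)| ≤ (max 1 m⁻¹) ^ (n + 1) := by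
    have : f x ^ (-1 - j : ℤ) = ((f x)⁻¹) ^ (j + 1) := by
      rw [show (-1 - j : ℤ) = -((j + 1 : ℕ) : ℤ) by push_cast; ring, zpow_neg, zpow_natCast, inv_pow]
    rw [this, abs_of_pos (by positivity)]
    calc ((f x)⁻¹) ^ (j + 1) ≤ (max 1 m⁻¹) ^ (j + 1) := by
          gcongr; exact (inv_anti₀ hm hfx).trans (le_max_right _ _)
      _ ≤ _ := pow_le_pow_right₀ (le_max_left _ _) (by omega)
  rw [hM]; gcongr

theorem iteratedDeriv_exp_bound (n : ℕ) (B : ℝ) : ∃ C ≥ (1:ℝ), ∀ (L : ℝ → ℝ) (x : ℝ),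
    ContDiffAt ℝ ∞ L x → (∀ i, 1 ≤ i → i ≤ n → |iteratedDeriv i L x| ≤ B) →
    ∀ i ≤ n, |iteratedDeriv i (fun y => Real.exp (L y)) x| ≤ C * Real.exp (L x) := by
  obtain ⟨C, hC1, hC⟩ := iteratedDeriv_comp_bound n B
  refine ⟨C, hC1, fun L x hL hB i hi => ?_⟩
  refine hC Real.exp L x (Real.exp (L x)) Real.contDiff_exp.contDiffAt hL ?_ hB i hi
  intro j _
  rw [iteratedDeriv_eq_iterate, Real.iter_deriv_exp, abs_of_pos (Real.exp_pos _)]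

theorem iteratedDeriv_div_bound (n : ℕ) (m B : ℝ) (hm : 0 < m) : ∃ C ≥ (1:ℝ),
    ∀ (u f : ℝ → ℝ) (x κ : ℝ), ContDiffAt ℝ ∞ u x → ContDiffAt ℝ ∞ f x → m ≤ f x →
    (∀ i ≤ n, |iteratedDeriv i u x| ≤ κ) →
    (∀ i, 1 ≤ i → i ≤ n → |iteratedDeriv i f x| ≤ B) →
    ∀ i ≤ n, |iteratedDeriv i (fun y => u y / f y) x| ≤ C * κ := by
  obtain ⟨C, hC1, hC⟩ := iteratedDeriv_inv_bound n m B hm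
  refine ⟨2 ^ n * C, one_le_mul_of_one_le_of_one_le (one_le_pow₀ (by norm_num)) hC1, ?_⟩
  intro u f x κ hu hf hfx hk hB i hi
  have := iteratedDeriv_mul_bound hu (hf.inv (hm.trans_le hfx).ne') hk (hC f x hf hfx hB) i hi
  simp only [div_eq_mul_inv]
  refine this.trans (le_of_eq (by ring))

theorem iteratedDeriv_log_bound (n : ℕ) (m B : ℝ) (hm : 0 < m) : ∃ C ≥ (1:ℝ),
    ∀ (g : ℝ → ℝ) (x κ : ℝ), ContDiffAt ℝ ∞ g x → m ≤ g x →
    (∀ i, 1 ≤ i → i ≤ n → |iteratedDeriv i g x| ≤ κ) → κ ≤ B →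
    ∀ i, 1 ≤ i → i ≤ n → |iteratedDeriv i (fun y => Real.log (g y)) x| ≤ C * κ := by
  obtain ⟨C, hC1, hC⟩ := iteratedDeriv_div_bound (n - 1) m B hm
  refine ⟨C, hC1, ?_⟩
  intro g x κ hg hgx hk hkB i h1 hi
  obtain ⟨i, rfl⟩ : ∃ j, i = j + 1 := ⟨i - 1, by omega⟩
  rw [iteratedDeriv_succ']
  have hgx0 : 0 < g x := hm.trans_le hgx
  have : deriv (fun y => Real.log (g y)) =ᶠ[𝓝 x] fun y => deriv g y / g y := by
    filter_upwards [hg.eventually_differentiableAt, hg.continuousAt.eventually_ne hgx0.ne'] with y h1 h2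
    exact (h1.hasDerivAt.log h2).deriv
  rw [this.iteratedDeriv_eq]
  refine hC (deriv g) g x κ hg.deriv_infty hg hgx ?_ ?_ i (by omega)
  · intro j hj; rw [← iteratedDeriv_succ']; exact hk _ (by omega) (by omega)
  · intro j h1 hj; exact (hk j h1 (by omega)).trans hkB

/-- If `H ∘ F = u` near `s` and `F' ≥ m`, bounds on the derivatives of `u` give bounds on those of
`H`. -/
theorem iteratedDeriv_of_comp_bound (n : ℕ) (m B : ℝ) (hm : 0 < m) : ∃ C ≥ (1:ℝ),
    ∀ (H F u : ℝ → ℝ) (s κ : ℝ), ContDiffAt ℝ ∞ H (F s) → ContDiffAt ℝ ∞ F s → ContDiffAt ℝ ∞ u s →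
    H ∘ F =ᶠ[𝓝 s] u → m ≤ deriv F s → (∀ i ≤ n, |iteratedDeriv i u s| ≤ κ) →
    (∀ i, 1 ≤ i → i ≤ n → |iteratedDeriv i F s| ≤ B) →
    ∀ i ≤ n, |iteratedDeriv i H (F s)| ≤ C * κ := by
  induction n with
  | zero =>
    refine ⟨1, le_rfl, fun H F u s κ _ _ _ h _ hk _ i hi => ?_⟩
    obtain rfl : i = 0 := by omega
    have := h.eq_of_nhds
    have h0 := hk 0 le_rfl
    simp only [iteratedDeriv_zero, Function.comp_apply] at this h0 ⊢
    rw [this, one_mul]; exact h0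
  | succ n ih =>
    obtain ⟨C, hC1, hC⟩ := ih
    obtain ⟨C', hC1', hC'⟩ := iteratedDeriv_div_bound n m B hm
    refine ⟨C * C', one_le_mul_of_one_le_of_one_le hC1 hC1', ?_⟩
    intro H F u s κ hH hF hu h hFm hk hB i hi
    have hk0 : 0 ≤ κ := (abs_nonneg _).trans (hk 0 (Nat.zero_le _))
    rcases Nat.eq_zero_or_pos i with rfl | hi0
    · have := h.eq_of_nhds
      have h0 := hk 0 (Nat.zero_le _)
      simp only [iteratedDeriv_zero, Function.comp_apply] at this h0 ⊢
      rw [this]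
      refine h0.trans (le_mul_of_one_le_left hk0 (one_le_mul_of_one_le_of_one_le hC1 hC1'))
    obtain ⟨i, rfl⟩ : ∃ j, i = j + 1 := ⟨i - 1, by omega⟩
    have hF' : ContDiffAt ℝ ∞ (deriv F) s := hF.deriv_infty
    have hpos : 0 < deriv F s := hm.trans_le hFm
    rw [iteratedDeriv_succ', mul_assoc]
    have hu' : ContDiffAt ℝ ∞ (fun y => deriv u y / deriv F y) s := hu.deriv_infty.div hF' hpos.ne'
    refine hC (deriv H) F (fun y => deriv u y / deriv F y) s (C' * κ) hH.deriv_infty hF hu' ?_ hFm ?_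
      (fun j h1 hj => hB j h1 (by omega)) i (by omega)
    · have h' := h.eventually_nhds
      filter_upwards [h', hF.eventually_differentiableAt,
        hF.continuousAt.tendsto.eventually hH.eventually_differentiableAt,
        hF'.continuousAt.eventually_ne hpos.ne'] with y h1 h2 h3 h4
      have := (show H ∘ F =ᶠ[𝓝 y] u from h1).deriv_eq
      rw [deriv_comp y h3 h2] at this
      simp only [Function.comp_apply]
      rw [← this]; field_simp
    · refine hC' (deriv u) (deriv F) s κ hu.deriv_infty hF' hFm ?_ ?_
      · intro j hj; rw [← iteratedDeriv_succ']; exact hk _ (by omega)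
      · intro j h1 hj; rw [← iteratedDeriv_succ']; exact hB _ (by omega) (by omega)

theorem iteratedDeriv_comp_affine (f : ℝ → ℝ) (p q : ℝ) (n : ℕ) (x : ℝ) :
    iteratedDeriv n (fun x => f (p + q * x)) x = q ^ n * iteratedDeriv n f (p + q * x) := by
  induction n generalizing x with
  | zero => simp
  | succ n ih =>
    rw [iteratedDeriv_succ, funext ih, iteratedDeriv_succ, deriv_const_mul_field]
    have h1 := deriv_comp_mul_left q (fun z => iteratedDeriv n f (p + z)) x
    rw [deriv_comp_const_add, smul_eq_mul] at h1
    rw [h1]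
    ring

/-- Small oscillation and bounded higher derivatives force small derivatives. -/
theorem iteratedDeriv_small_of_osc_small (n : ℕ) : ∀ (M η ε : ℝ), 0 ≤ M → 0 < η → 0 < ε →
    ∃ δ > (0:ℝ), ∀ (ψ : ℝ → ℝ) (u : ℝ), ContDiff ℝ ∞ ψ →
    (∀ i, 1 ≤ i → i ≤ n + 1 → ∀ x ∈ Icc u (u + η), |iteratedDeriv i ψ x| ≤ M) →
    (∀ x ∈ Icc u (u + η), ∀ y ∈ Icc u (u + η), |ψ x - ψ y| ≤ δ) →
    ∀ i, 1 ≤ i → i ≤ n → ∀ x ∈ Icc u (u + η), |iteratedDeriv i ψ x| ≤ ε := by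
  induction n with
  | zero => intro M η ε _ _ _; exact ⟨1, one_pos, fun _ _ _ _ _ i h1 h2 => by omega⟩
  | succ n ih =>
    intro M η ε hM hη hε
    obtain ⟨δ', hδ', H⟩ := ih M η ε hM hη hε
    set e := min ε (δ' / 2) with he
    have he0 : 0 < e := by positivity
    set h := min (η / 2) (e / (2 * (M + 1))) with hh
    have hh0 : 0 < h := by positivity
    refine ⟨e * h / 2, by positivity, fun ψ u hψ hb hosc => ?_⟩
    have hψ' : ContDiff ℝ ∞ (deriv ψ) := contDiff_iff_contDiffAt.2 fun x => hψ.contDiffAt.deriv_infty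
    have key : ∀ x ∈ Icc u (u + η), |deriv ψ x| ≤ e := by
      intro x hx
      have hhη : h ≤ η / 2 := min_le_left _ _
      have hMh : M * h ≤ e / 2 := by
        have : h ≤ e / (2 * (M + 1)) := min_le_right _ _
        rw [le_div_iff₀ (by positivity)] at this
        nlinarith
      obtain ⟨a, ha1, ha2, hxa⟩ : ∃ a, u ≤ a ∧ a + h ≤ u + η ∧ x ∈ Icc a (a + h) := by
        rcases le_total x (u + η / 2) with h1 | h1
        · exact ⟨x, hx.1, by linarith, le_rfl, by linarith⟩
        · exact ⟨x - h, by linarith, by linarith [hx.2], by linarith, by linarith⟩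
      obtain ⟨ξ, hξ, hξ'⟩ := exists_deriv_eq_slope ψ (show a < a + h by linarith)
        hψ.continuous.continuousOn (hψ.differentiable (by simp)).differentiableOn
      have h1 : |deriv ψ ξ| ≤ e / 2 := by
        rw [hξ', add_sub_cancel_left, abs_div, abs_of_pos hh0, div_le_iff₀ hh0]
        refine (hosc _ ⟨by linarith, by linarith⟩ _ ⟨by linarith, by linarith⟩).trans (le_of_eq (by ring))
      have h2 : |deriv ψ x - deriv ψ ξ| ≤ M * |x - ξ| := by
        have := (convex_Icc a (a + h)).norm_image_sub_le_of_norm_deriv_le (f := deriv ψ) (C := M)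
          (fun y _ => (hψ'.differentiable (by simp)).differentiableAt)
          (fun y hy => by
            have := hb 2 (by norm_num) (by omega) y ⟨by linarith [hy.1], by linarith [hy.2]⟩
            rwa [iteratedDeriv_succ, iteratedDeriv_one] at this)
          (Ioo_subset_Icc_self hξ) hxa
        simpa [Real.norm_eq_abs] using this
      have h3 : |x - ξ| ≤ h := by
        rw [abs_le]; constructor <;> linarith [hxa.1, hxa.2, hξ.1, hξ.2]
      calc |deriv ψ x| = |deriv ψ ξ + (deriv ψ x - deriv ψ ξ)| := by ring_nf
        _ ≤ |deriv ψ ξ| + |deriv ψ x - deriv ψ ξ| := abs_add_le _ _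
        _ ≤ e / 2 + M * h := add_le_add h1 (h2.trans (by gcongr))
        _ ≤ e := by linarith
    intro i h1 hi x hx
    rcases Nat.lt_or_ge 1 i with h2 | h2
    · obtain ⟨i, rfl⟩ : ∃ j, i = j + 1 := ⟨i - 1, by omega⟩
      rw [iteratedDeriv_succ']
      refine H (deriv ψ) u hψ' ?_ ?_ i (by omega) (by omega) x hx
      · intro j h1 hj y hy; rw [← iteratedDeriv_succ']; exact hb _ (by omega) (by omega) y hy
      · intro y hy z hz
        have := key y hy; have := key z hz; have : e ≤ δ' / 2 := min_le_right _ _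
        rw [abs_le] at *; constructor <;> linarith
    · obtain rfl : i = 1 := by omega
      rw [iteratedDeriv_one]; exact (key x hx).trans (min_le_left _ _)

theorem apply_inv_perm (g : Equiv.Perm ℝ) (x : ℝ) : g (g⁻¹ x) = x := g.apply_symm_apply x

theorem inv_perm_apply (g : Equiv.Perm ℝ) (x : ℝ) : g⁻¹ (g x) = x := g.symm_apply_apply x

/-- A permutation of `ℝ` restricting to a smooth orientation-preserving diffeomorphism of
`(0, 1)`. -/
structure IooDiff (g : Equiv.Perm ℝ) : Prop where
  mem_iff : ∀ x, g x ∈ Ioo (0:ℝ) 1 ↔ x ∈ Ioo (0:ℝ) 1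
  smooth : ∀ x ∈ Ioo (0:ℝ) 1, ContDiffAt ℝ ∞ g x
  deriv_pos : ∀ x ∈ Ioo (0:ℝ) 1, 0 < deriv g x

namespace IooDiff

theorem one : IooDiff 1 where
  mem_iff x := Iff.rfl
  smooth x _ := contDiffAt_id
  deriv_pos x _ := by
    have : ((1 : Equiv.Perm ℝ) : ℝ → ℝ) = id := rfl
    rw [this]; simp

theorem mul {g h : Equiv.Perm ℝ} (hg : IooDiff g) (hh : IooDiff h) : IooDiff (g * h) where
  mem_iff x := by rw [Equiv.Perm.mul_apply, hg.mem_iff, hh.mem_iff]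
  smooth x hx := by
    rw [Equiv.Perm.coe_mul]
    exact (hg.smooth _ ((hh.mem_iff x).2 hx)).comp x (hh.smooth x hx)
  deriv_pos x hx := by
    have hx' := (hh.mem_iff x).2 hx
    rw [Equiv.Perm.coe_mul, deriv_comp x ((hg.smooth _ hx').differentiableAt (by simp))
      ((hh.smooth x hx).differentiableAt (by simp))]
    exact mul_pos (hg.deriv_pos _ hx') (hh.deriv_pos x hx)

theorem inv {g : Equiv.Perm ℝ} (hg : IooDiff g) : IooDiff g⁻¹ := by
  have hm : ∀ x, g⁻¹ x ∈ Ioo (0:ℝ) 1 ↔ x ∈ Ioo (0:ℝ) 1 := fun x => by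
    rw [← hg.mem_iff, apply_inv_perm]
  have hcomp : (g⁻¹ : Equiv.Perm ℝ) ∘ g = id := by ext x; simp
  have hs : ∀ x ∈ Ioo (0:ℝ) 1, ContDiffAt ℝ ∞ (g⁻¹ : Equiv.Perm ℝ) x := by
    intro x hx
    have hx' := (hm x).2 hx
    have := ContDiffAt.of_comp (φ := (g⁻¹ : Equiv.Perm ℝ)) (hg.smooth _ hx') (hg.deriv_pos _ hx').ne'
      contDiffAt_id (by rw [hcomp])
    rwa [apply_inv_perm] at this
  refine ⟨hm, hs, fun x hx => ?_⟩
  have hx' := (hm x).2 hx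
  have h1 : HasDerivAt ((g⁻¹ : Equiv.Perm ℝ) ∘ g) (deriv (g⁻¹ : Equiv.Perm ℝ) x * deriv g (g⁻¹ x))
      (g⁻¹ x) := by
    refine HasDerivAt.comp _ ?_ ((hg.smooth _ hx').differentiableAt (by simp)).hasDerivAt
    rw [apply_inv_perm]
    exact ((hs x hx).differentiableAt (by simp)).hasDerivAt
  rw [hcomp] at h1
  have h2 := h1.unique (hasDerivAt_id _)
  have := hg.deriv_pos _ hx'
  by_contra hneg
  nlinarith [mul_nonneg_of_nonpos_of_nonpos (not_lt.1 hneg) (neg_nonpos.2 this.le)]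

theorem zpow {g : Equiv.Perm ℝ} (hg : IooDiff g) (n : ℤ) : IooDiff (g ^ n) := by
  induction n using Int.induction_on with
  | zero => exact one
  | succ n ih => rw [zpow_add_one]; exact ih.mul hg
  | pred n ih => rw [zpow_sub_one]; exact ih.mul hg.inv

theorem strictMonoOn {g : Equiv.Perm ℝ} (hg : IooDiff g) : StrictMonoOn g (Ioo 0 1) := by
  refine strictMonoOn_of_deriv_pos (convex_Ioo 0 1)
    (fun x hx => (hg.smooth x hx).continuousAt.continuousWithinAt) ?_
  intro x hx; rw [interior_Ioo] at hx; exact hg.deriv_pos x hx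

theorem differentiableAt {g : Equiv.Perm ℝ} (hg : IooDiff g) {x : ℝ} (hx : x ∈ Ioo (0:ℝ) 1) :
    DifferentiableAt ℝ g x := (hg.smooth x hx).differentiableAt (by simp)

end IooDiff

/-- `F` parametrises `(0, 1)` in such a way that `g` becomes the translation by `η`. -/
structure IsParam (g : Equiv.Perm ℝ) (η : ℝ) (F : ℝ → ℝ) : Prop where
  smooth : ContDiff ℝ ∞ F
  deriv_pos : ∀ y, 0 < deriv F y
  mem : ∀ y, F y ∈ Ioo (0:ℝ) 1
  equi : ∀ y, F (y + η) = g (F y)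
  surj : ∀ x ∈ Ioo (0:ℝ) 1, ∃ y, F y = x

namespace IsParam
variable {g : Equiv.Perm ℝ} {η : ℝ} {F : ℝ → ℝ}

theorem strictMono (h : IsParam g η F) : StrictMono F := strictMono_of_deriv_pos h.deriv_pos

theorem equi_sub (h : IsParam g η F) (y : ℝ) : F (y - η) = g⁻¹ (F y) := by
  rw [eq_comm, Equiv.Perm.inv_eq_iff_eq, ← h.equi, sub_add_cancel]

theorem equi_zpow (h : IsParam g η F) (n : ℤ) (y : ℝ) : F (y + n * η) = (g ^ n) (F y) := by
  induction n using Int.induction_on generalizing y with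
  | zero => simp
  | succ n ih =>
    rw [zpow_add_one, Equiv.Perm.mul_apply, ← h.equi, ← ih]; congr 1; push_cast; ring
  | pred n ih =>
    rw [zpow_sub_one, Equiv.Perm.mul_apply, ← h.equi_sub, ← ih]; congr 1; push_cast; ring

theorem equi_pow (h : IsParam g η F) (n : ℕ) (y : ℝ) : F (y + n * η) = g^[n] (F y) := by
  have := h.equi_zpow n y
  rw [zpow_natCast] at this
  rw [← Equiv.Perm.coe_pow, ← this]; simp

theorem tendsto_atTop (h : IsParam g η F) : Tendsto F atTop (𝓝 1) := by
  rw [tendsto_order]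
  refine ⟨fun a ha => ?_, fun a ha => Eventually.of_forall fun y => (h.mem y).2.trans ha⟩
  obtain ⟨y, hy⟩ := h.surj ((max a 0 + 1) / 2)
    ⟨by have := le_max_right a 0; linarith, by have := max_lt ha one_pos; linarith⟩
  filter_upwards [eventually_ge_atTop y] with z hz
  have := h.strictMono.monotone hz
  have := le_max_left a 0; have := max_lt ha one_pos; linarith

theorem tendsto_atBot (h : IsParam g η F) : Tendsto F atBot (𝓝 0) := by
  rw [tendsto_order]
  refine ⟨fun a ha => Eventually.of_forall fun y => ha.trans (h.mem y).1, fun a ha => ?_⟩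
  obtain ⟨y, hy⟩ := h.surj (min a 1 / 2)
    ⟨by have := lt_min ha one_pos; linarith, by have := min_le_right a 1; linarith⟩
  filter_upwards [eventually_le_atBot y] with z hz
  have := h.strictMono.monotone hz
  have := min_le_left a 1; have := lt_min ha one_pos; linarith

end IsParam

/-- Two parametrisations agreeing on a fundamental window agree to the left of it, as long as the
two maps coincide there. -/
theorem IsParam.eq_of_le {g₁ g₂ : Equiv.Perm ℝ} {η y₀ : ℝ} {F₁ F₂ : ℝ → ℝ} (hη : 0 < η)
    (h₁ : IsParam g₁ η F₁) (h₂ : IsParam g₂ η F₂) (h : ∀ y ∈ Icc y₀ (y₀ + η), F₁ y = F₂ y)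
    (hg : ∀ y < y₀, g₁ (F₁ y) = g₂ (F₁ y)) : ∀ y ≤ y₀ + η, F₁ y = F₂ y := by
  have key : ∀ n : ℕ, ∀ y ∈ Icc (y₀ - n * η) (y₀ + η), F₁ y = F₂ y := by
    intro n
    induction n with
    | zero => simpa using h
    | succ n ih =>
      intro y hy
      push_cast at hy
      rcases lt_or_ge y (y₀ - n * η) with h1 | h1
      · have hyy : y < y₀ := h1.trans_le (by simp; positivity)
        have := ih (y + η) ⟨by linarith [hy.1], by linarith⟩
        rw [h₁.equi, h₂.equi, hg y hyy] at this
        exact g₂.injective this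
      · exact ih y ⟨h1, hy.2⟩
  intro y hy
  obtain ⟨n, hn⟩ := exists_nat_ge ((y₀ - y) / η)
  rw [div_le_iff₀ hη] at hn
  exact key n y ⟨by linarith, hy⟩

theorem IsParam.eq_of_ge {g₁ g₂ : Equiv.Perm ℝ} {η y₀ : ℝ} {F₁ F₂ : ℝ → ℝ} (hη : 0 < η)
    (h₁ : IsParam g₁ η F₁) (h₂ : IsParam g₂ η F₂) (h : ∀ y ∈ Icc y₀ (y₀ + η), F₁ y = F₂ y)
    (hg : ∀ y, y₀ ≤ y → g₁ (F₁ y) = g₂ (F₁ y)) : ∀ y, y₀ ≤ y → F₁ y = F₂ y := by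
  have key : ∀ n : ℕ, ∀ y ∈ Icc y₀ (y₀ + η + n * η), F₁ y = F₂ y := by
    intro n
    induction n with
    | zero => simpa using h
    | succ n ih =>
      intro y hy
      push_cast at hy
      rcases lt_or_ge (y₀ + η + n * η) y with h1 | h1
      · have h3 : 0 ≤ n * η := by positivity
        have := ih (y - η) ⟨by linarith, by linarith [hy.2]⟩
        have e1 := h₁.equi (y - η)
        have e2 := h₂.equi (y - η)
        rw [sub_add_cancel] at e1 e2
        rw [e1, e2, hg (y - η) (by linarith), this]
      · exact ih y ⟨hy.1, h1⟩
  intro y hy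
  obtain ⟨n, hn⟩ := exists_nat_ge ((y - y₀) / η)
  rw [div_le_iff₀ hη] at hn
  exact key n y ⟨hy, by linarith⟩

/-- Existence of parametrisations with prescribed restriction to a fundamental window. -/
theorem exists_isParam {g : Equiv.Perm ℝ} (hg : IooDiff g) (hlt : ∀ x ∈ Ioo (0:ℝ) 1, x < g x)
    {η y₀ δ : ℝ} (hη : 0 < η) (hδ : 0 < δ) {G : ℝ → ℝ} (hG : ContDiff ℝ ∞ G)
    (hG' : ∀ y, 0 < deriv G y) (hmem : ∀ y ∈ Ioo (y₀ - δ) (y₀ + η + δ), G y ∈ Ioo (0:ℝ) 1)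
    (heq : ∀ y ∈ Ioo (y₀ - δ) (y₀ + δ), G (y + η) = g (G y)) :
    ∃ F, IsParam g η F ∧ ∀ y ∈ Icc y₀ (y₀ + η), F =ᶠ[𝓝 y] G := by
  wlog hδη : δ ≤ η generalizing δ
  · exact this (δ := η) hη (fun y hy => hmem y ⟨by linarith [hy.1], by linarith [hy.2]⟩)
      (fun y hy => heq y ⟨by linarith [hy.1], by linarith [hy.2]⟩) le_rfl
  set fl : ℝ → ℤ := fun y => ⌊(y - y₀) / η⌋ with hfl
  set F : ℝ → ℝ := fun y => (g ^ fl y) (G (y - fl y * η)) with hF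
  have fl_eq : ∀ (n : ℤ) (y : ℝ), y - n * η ∈ Ico y₀ (y₀ + η) → fl y = n := by
    intro n y hy
    rw [hfl]; simp only
    rw [Int.floor_eq_iff, le_div_iff₀ hη, div_lt_iff₀ hη]
    constructor <;> linarith [hy.1, hy.2]
  have key : ∀ (n : ℤ) (y : ℝ), y - n * η ∈ Ioo (y₀ - δ) (y₀ + η + δ) →
      F y = (g ^ n) (G (y - n * η)) := by
    intro n y hy
    rcases lt_or_ge (y - n * η) y₀ with h1 | h1
    · have e := fl_eq (n - 1) y ⟨by push_cast; linarith [hy.1], by push_cast; linarith⟩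
      simp only [hF]
      rw [e, zpow_sub_one, Equiv.Perm.mul_apply]
      congr 1
      rw [Equiv.Perm.inv_eq_iff_eq, ← heq _ ⟨hy.1, by linarith⟩]
      congr 1; push_cast; ring
    rcases lt_or_ge (y - n * η) (y₀ + η) with h2 | h2
    · simp only [hF]; rw [fl_eq n y ⟨h1, h2⟩]
    · have e := fl_eq (n + 1) y ⟨by push_cast; linarith, by push_cast; linarith [hy.2]⟩
      simp only [hF]
      rw [e, zpow_add_one, Equiv.Perm.mul_apply]
      congr 1
      rw [← heq _ ⟨by push_cast; linarith, by push_cast; linarith [hy.2]⟩]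
      congr 1; push_cast; ring
  have hflmem : ∀ y, y - fl y * η ∈ Ico y₀ (y₀ + η) := by
    intro y
    have h1 := Int.floor_le ((y - y₀) / η)
    have h2 := Int.lt_floor_add_one ((y - y₀) / η)
    rw [le_div_iff₀ hη] at h1
    rw [div_lt_iff₀ hη] at h2
    constructor <;> simp only [hfl] <;> linarith
  have hloc : ∀ y, F =ᶠ[𝓝 y] fun z => (g ^ fl y) (G (z - fl y * η)) := by
    intro y
    have hc : ContinuousAt (fun z => z - fl y * η) y := by fun_prop
    have := hflmem y
    filter_upwards [hc.eventually (Ioo_mem_nhds (show y₀ - δ < y - fl y * η by linarith [this.1])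
      (show y - fl y * η < y₀ + η + δ by linarith [this.2]))] with z hz
    exact key _ z hz
  have hGm : ∀ y, G (y - fl y * η) ∈ Ioo (0:ℝ) 1 := fun y => by
    have := hflmem y
    exact hmem _ ⟨by linarith [this.1], by linarith [this.2]⟩
  have hmemF : ∀ y, F y ∈ Ioo (0:ℝ) 1 := fun y => ((hg.zpow _).mem_iff _).2 (hGm y)
  have hsm : ∀ y, ContDiffAt ℝ ∞ F y := fun y => by
    refine ContDiffAt.congr_of_eventuallyEq ?_ (hloc y)
    refine ContDiffAt.comp y ((hg.zpow (fl y)).smooth _ (hGm y)) ?_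
    exact hG.contDiffAt.comp y (by fun_prop)
  have hF' : ∀ y, 0 < deriv F y := fun y => by
    rw [(hloc y).deriv_eq]
    have h1 : HasDerivAt (fun z => G (z - fl y * η)) (deriv G (y - fl y * η)) y := by
      have := (hG.differentiable (by simp) (y - fl y * η)).hasDerivAt
      simpa using this.comp_sub_const y (fl y * η)
    have h2 := ((hg.zpow (fl y)).differentiableAt (hGm y)).hasDerivAt.comp y h1
    have h3 : HasDerivAt (fun z => (g ^ fl y) (G (z - fl y * η))) _ y := h2
    rw [h3.deriv]
    exact mul_pos ((hg.zpow _).deriv_pos _ (hGm y)) (hG' _)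
  have hequi : ∀ y, F (y + η) = g (F y) := fun y => by
    have h := hflmem y
    rw [key (fl y + 1) (y + η) ⟨by push_cast; linarith [h.1], by push_cast; linarith [h.2]⟩,
      add_comm, zpow_add, zpow_one, Equiv.Perm.mul_apply]
    simp only [hF]
    congr 3; push_cast; ring
  have hmono : StrictMono F := strictMono_of_deriv_pos hF'
  have hcont : Continuous F := (contDiff_iff_contDiffAt.2 hsm).continuous
  have hno : ∀ l ∈ Ioo (0:ℝ) 1, ∀ u : Filter ℝ, u.NeBot → Tendsto F u (𝓝 l) →
      Tendsto (fun y => F (y + η)) u (𝓝 l) → False := by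
    intro l hl u hu h1 h2
    have h3 : Tendsto (fun y => g (F y)) u (𝓝 (g l)) :=
      (hg.smooth l hl).continuousAt.tendsto.comp h1
    simp_rw [hequi] at h2
    exact (hlt l hl).ne (tendsto_nhds_unique h2 h3)
  have hup : ∀ x ∈ Ioo (0:ℝ) 1, ∃ y, x ≤ F y := by
    intro x hx
    by_contra! hcon
    have hb : BddAbove (range F) := ⟨x, by rintro _ ⟨y, rfl⟩; exact (hcon y).le⟩
    have ht := tendsto_atTop_ciSup hmono.monotone hb
    refine hno (⨆ i, F i) ⟨(hmemF 0).1.trans_le (le_ciSup hb 0),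
      (ciSup_le fun y => (hcon y).le).trans_lt hx.2⟩ atTop inferInstance ht ?_
    exact ht.comp (tendsto_atTop_add_const_right _ _ tendsto_id)
  have hdown : ∀ x ∈ Ioo (0:ℝ) 1, ∃ y, F y ≤ x := by
    intro x hx
    by_contra! hcon
    have hb : BddBelow (range F) := ⟨x, by rintro _ ⟨y, rfl⟩; exact (hcon y).le⟩
    have ht := tendsto_atBot_ciInf hmono.monotone hb
    refine hno (⨅ i, F i) ⟨hx.1.trans_le (le_ciInf fun y => (hcon y).le),
      (ciInf_le hb 0).trans_lt (hmemF 0).2⟩ atBot inferInstance ht ?_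
    exact ht.comp (tendsto_atBot_add_const_right _ _ tendsto_id)
  refine ⟨F, ⟨contDiff_iff_contDiffAt.2 hsm, hF', hmemF, hequi, fun x hx => ?_⟩, fun y hy => ?_⟩
  · obtain ⟨a, ha⟩ := hdown x hx
    obtain ⟨b, hb⟩ := hup x hx
    exact mem_range_of_exists_le_of_exists_ge hcont ⟨a, ha⟩ ⟨b, hb⟩
  · filter_upwards [Ioo_mem_nhds (show y₀ - δ < y by linarith [hy.1])
      (show y < y₀ + η + δ by linarith [hy.2])] with z hz
    simpa using key 0 z (by simpa using hz)

/-- The logarithm of the derivative. -/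
noncomputable def logD (g : ℝ → ℝ) (x : ℝ) : ℝ := Real.log (deriv g x)

theorem ContDiffAt.logD {g : ℝ → ℝ} {x : ℝ} (hg : ContDiffAt ℝ ∞ g x) (h : 0 < deriv g x) :
    ContDiffAt ℝ ∞ (logD g) x := hg.deriv_infty.log h.ne'

theorem logD_comp {g f : ℝ → ℝ} {x : ℝ} (hg : DifferentiableAt ℝ g (f x))
    (hf : DifferentiableAt ℝ f x) (h1 : 0 < deriv g (f x)) (h2 : 0 < deriv f x) :
    logD (g ∘ f) x = logD g (f x) + logD f x := by
  rw [logD, deriv_comp x hg hf, Real.log_mul h1.ne' h2.ne']; rfl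

namespace IsParam
variable {g : Equiv.Perm ℝ} {η : ℝ} {F : ℝ → ℝ}

theorem differentiableAt (h : IsParam g η F) (y : ℝ) : DifferentiableAt ℝ F y :=
  h.smooth.differentiable (by simp) y

theorem contDiff_logD (h : IsParam g η F) : ContDiff ℝ ∞ (logD F) :=
  contDiff_iff_contDiffAt.2 fun y => h.smooth.contDiffAt.logD (h.deriv_pos y)

theorem exp_logD (h : IsParam g η F) (y : ℝ) : Real.exp (logD F y) = deriv F y :=
  Real.exp_log (h.deriv_pos y)

theorem logD_add (h : IsParam g η F) (hg : IooDiff g) (y : ℝ) :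
    logD F (y + η) = logD F y + logD g (F y) := by
  have h1 : g ∘ F = fun y => F (y + η) := funext fun y => (h.equi y).symm
  have h2 := logD_comp (hg.differentiableAt (h.mem y)) (h.differentiableAt y)
    (hg.deriv_pos _ (h.mem y)) (h.deriv_pos y)
  rw [h1, logD, deriv_comp_add_const] at h2
  rw [logD, h2, add_comm]

theorem logD_add_nat (h : IsParam g η F) (hg : IooDiff g) (y : ℝ) (n : ℕ) :
    logD F (y + n * η) = logD F y + ∑ i ∈ Finset.range n, logD g (F (y + i * η)) := by
  induction n with
  | zero => simp
  | succ n ih =>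
    rw [Finset.sum_range_succ, ← add_assoc, ← ih, ← h.logD_add hg]; congr 1; push_cast; ring

theorem logD_add_int (h : IsParam g η F) (hg : IooDiff g) (n : ℤ) : ∃ (s : ℝ) (a : ℤ) (N : ℕ),
    |s| = 1 ∧ ∀ y, logD F (y + n * η) =
      logD F y + s * ∑ i ∈ Finset.range N, logD g (F (y + a * η + i * η)) := by
  rcases le_total 0 n with h0 | h0
  · obtain ⟨N, rfl⟩ := Int.eq_ofNat_of_zero_le h0
    refine ⟨1, 0, N, by simp, fun y => ?_⟩
    have := h.logD_add_nat hg y N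
    simpa using this
  · obtain ⟨N, hN⟩ := Int.eq_ofNat_of_zero_le (neg_nonneg.2 h0)
    obtain rfl : n = -N := by omega
    refine ⟨-1, -N, N, by simp, fun y => ?_⟩
    have := h.logD_add_nat hg (y + (-N) * η) N
    have e : y + -N * η + N * η = y := by ring
    rw [e] at this
    push_cast
    linarith

theorem sum_length_le (h : IsParam g η F) (u : ℝ) (N : ℕ) :
    ∑ i ∈ Finset.range N, (F (u + i * η + η) - F (u + i * η)) ≤ 1 := by
  have : ∀ i : ℕ, F (u + i * η + η) - F (u + i * η) =
      (fun i : ℕ => F (u + i * η)) (i + 1) - (fun i : ℕ => F (u + i * η)) i := fun i => by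
    simp only; congr 2; push_cast; ring
  simp_rw [this]
  rw [Finset.sum_range_sub (fun i : ℕ => F (u + i * η))]
  have h1 := (h.mem (u + N * η)).2
  have h2 := (h.mem (u + (0:ℕ) * η)).1
  linarith

theorem exists_int_window (hη : 0 < η) (y₀ y : ℝ) : ∃ (n : ℤ), y - n * η ∈ Ico y₀ (y₀ + η) := by
  refine ⟨⌊(y - y₀) / η⌋, ?_⟩
  have h1 := Int.floor_le ((y - y₀) / η)
  have h2 := Int.lt_floor_add_one ((y - y₀) / η)
  rw [le_div_iff₀ hη] at h1
  rw [div_lt_iff₀ hη] at h2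
  constructor <;> linarith

end IsParam

/-- Uniform control on a map of `(0, 1)` and on a parametrisation over one window. -/
structure ParamHyp (K : ℕ) (A B : ℝ) (g : Equiv.Perm ℝ) (η : ℝ) (F : ℝ → ℝ) (y₀ : ℝ) : Prop where
  diff : IooDiff g
  param : IsParam g η F
  pos : 0 < η
  le_one : η ≤ 1
  disp : ∀ x ∈ Ioo (0:ℝ) 1, g x - x ≤ A * η
  map_bound : ∀ j, 1 ≤ j → j ≤ K → ∀ x ∈ Ioo (0:ℝ) 1, |iteratedDeriv j (logD g) x| ≤ A * η
  window_bound : ∀ j, 1 ≤ j → j ≤ K → ∀ y ∈ Icc y₀ (y₀ + η), |iteratedDeriv j (logD F) y| ≤ B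

namespace ParamHyp
variable {K : ℕ} {A B : ℝ} {g : Equiv.Perm ℝ} {η : ℝ} {F : ℝ → ℝ} {y₀ : ℝ}

theorem logD_sub_le (h : ParamHyp K A B g η F y₀) (hK : 1 ≤ K) {x y : ℝ} (hx : x ∈ Ioo (0:ℝ) 1)
    (hy : y ∈ Ioo (0:ℝ) 1) : |logD g x - logD g y| ≤ A * η * |x - y| := by
  have := Convex.norm_image_sub_le_of_norm_deriv_le (f := logD g) (s := Ioo (0:ℝ) 1)
    (C := A * η) (x := y) (y := x)
    (fun z hz => ((h.diff.smooth z hz).logD (h.diff.deriv_pos z hz)).differentiableAt (by simp))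
    (fun z hz => by
      have := h.map_bound 1 le_rfl hK z hz
      rwa [iteratedDeriv_one] at this) (convex_Ioo 0 1) hy hx
  simpa using this

theorem logD_param_sub_le (h : ParamHyp K A B g η F y₀) (hK : 1 ≤ K) {x y : ℝ}
    (hx : x ∈ Icc y₀ (y₀ + η)) (hy : y ∈ Icc y₀ (y₀ + η)) : |logD F x - logD F y| ≤ B := by
  have := Convex.norm_image_sub_le_of_norm_deriv_le (f := logD F) (s := Icc y₀ (y₀ + η))
    (C := B) (x := y) (y := x)
    (fun z hz => h.param.contDiff_logD.differentiable (by simp) z)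
    (fun z hz => by
      have := h.window_bound 1 le_rfl hK z hz
      rwa [iteratedDeriv_one] at this) (convex_Icc _ _) hy hx
  have hB : 0 ≤ B := (abs_nonneg _).trans (h.window_bound 1 le_rfl hK y hy)
  simp only [Real.norm_eq_abs] at this
  have h1 : |x - y| ≤ 1 := by
    have := h.le_one
    rw [abs_le]; constructor <;> linarith [hx.1, hx.2, hy.1, hy.2]
  nlinarith

theorem A_nonneg (h : ParamHyp K A B g η F y₀) (hK : 1 ≤ K) : 0 ≤ A := by
  have := (abs_nonneg _).trans (h.map_bound 1 le_rfl hK (1/2) (by norm_num))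
  exact nonneg_of_mul_nonneg_left this h.pos

theorem distortion (h : ParamHyp K A B g η F y₀) (hK : 1 ≤ K) (n : ℤ) {x y : ℝ}
    (hx : x ∈ Icc y₀ (y₀ + η)) (hy : y ∈ Icc y₀ (y₀ + η)) :
    |logD F (x + n * η) - logD F (y + n * η)| ≤ A + B := by
  obtain ⟨s, a, N, hs, hN⟩ := h.param.logD_add_int h.diff n
  rw [hN, hN]
  have hA := h.A_nonneg hK
  have hAη : A * η ≤ A := mul_le_of_le_one_right hA h.le_one
  have key : |∑ i ∈ Finset.range N, (logD g (F (x + a * η + i * η)) - logD g (F (y + a * η + i * η)))|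
      ≤ A := by
    refine (Finset.abs_sum_le_sum_abs _ _).trans ?_
    calc _ ≤ ∑ i ∈ Finset.range N, A * (F (y₀ + a * η + i * η + η) - F (y₀ + a * η + i * η)) := by
          refine Finset.sum_le_sum fun i _ => ?_
          refine (h.logD_sub_le hK (h.param.mem _) (h.param.mem _)).trans ?_
          refine mul_le_mul hAη ?_ (abs_nonneg _) hA
          have m := h.param.strictMono.monotone
          have e1 := m (show y₀ + a * η + i * η ≤ x + a * η + i * η by linarith [hx.1])
          have e2 := m (show y₀ + a * η + i * η ≤ y + a * η + i * η by linarith [hy.1])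
          have e3 := m (show x + a * η + i * η ≤ y₀ + a * η + i * η + η by linarith [hx.2])
          have e4 := m (show y + a * η + i * η ≤ y₀ + a * η + i * η + η by linarith [hy.2])
          rw [abs_le]; constructor <;> linarith
      _ ≤ A * 1 := by
          rw [← Finset.mul_sum]
          exact mul_le_mul_of_nonneg_left (h.param.sum_length_le _ _) hA
      _ = A := mul_one A
  have e : logD F x + s * ∑ i ∈ Finset.range N, logD g (F (x + a * η + i * η)) -
      (logD F y + s * ∑ i ∈ Finset.range N, logD g (F (y + a * η + i * η))) =
      s * ∑ i ∈ Finset.range N, (logD g (F (x + a * η + i * η)) - logD g (F (y + a * η + i * η))) +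
      (logD F x - logD F y) := by rw [Finset.sum_sub_distrib]; ring
  rw [e]
  refine (abs_add_le _ _).trans (add_le_add ?_ (h.logD_param_sub_le hK hx hy))
  rw [abs_mul, hs, one_mul]; exact key

theorem deriv_le_length (h : ParamHyp K A B g η F y₀) (hK : 1 ≤ K) (n : ℤ) {x : ℝ}
    (hx : x ∈ Icc y₀ (y₀ + η)) : η * deriv F (x + n * η) ≤
      Real.exp (A + B) * (F (y₀ + n * η + η) - F (y₀ + n * η)) := by
  have hη := h.pos
  obtain ⟨ξ, hξ, hξe⟩ := exists_deriv_eq_slope F (show y₀ + n * η < y₀ + n * η + η by linarith)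
    h.param.smooth.continuous.continuousOn
    (fun z _ => (h.param.differentiableAt z).differentiableWithinAt)
  have h1 := h.distortion hK n hx (y := ξ - n * η)
    ⟨by linarith [hξ.1], by linarith [hξ.2]⟩
  rw [sub_add_cancel] at h1
  have h2 : deriv F (x + n * η) ≤ Real.exp (A + B) * deriv F ξ := by
    rw [← h.param.exp_logD, ← h.param.exp_logD, ← Real.exp_add, Real.exp_le_exp]
    linarith [(abs_le.1 h1).2]
  rw [add_sub_cancel_left, eq_div_iff hη.ne'] at hξe
  rw [← hξe]
  nlinarith

theorem deriv_le (h : ParamHyp K A B g η F y₀) (hK : 1 ≤ K) (y : ℝ) :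
    deriv F y ≤ A * Real.exp (A + B) := by
  obtain ⟨n, hn⟩ := IsParam.exists_int_window h.pos y₀ y
  have h1 := h.deriv_le_length hK n (Ico_subset_Icc_self hn)
  rw [sub_add_cancel, h.param.equi] at h1
  have h2 := h.disp _ (h.param.mem (y₀ + n * η))
  have h3 := Real.exp_pos (A + B)
  have h4 := h.pos
  have h5 : η * deriv F y ≤ η * (A * Real.exp (A + B)) := by nlinarith
  exact le_of_mul_le_mul_left h5 h4

end ParamHyp

theorem iteratedDeriv_logD_comp {g : Equiv.Perm ℝ} {η : ℝ} {F : ℝ → ℝ} (hg : IooDiff g)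
    (hF : IsParam g η F) (j : ℕ) (y : ℝ) : iteratedDeriv (j + 1) (fun y => logD g (F y)) y =
      iteratedDeriv j (fun y => (deriv (logD g) ∘ F) y * Real.exp (logD F y)) y := by
  rw [iteratedDeriv_succ']
  congr 1
  ext z
  have h1 := ((hg.smooth _ (hF.mem z)).logD (hg.deriv_pos _ (hF.mem z))).differentiableAt
    (by simp : (∞ : WithTop ℕ∞) ≠ 0)
  rw [hF.exp_logD]
  exact (h1.hasDerivAt.comp z (hF.differentiableAt z).hasDerivAt).deriv

/-- Bounds on one fundamental window propagate to the whole line. -/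
theorem exists_param_bound (K : ℕ) (A B : ℝ) : ∃ C, ∀ g η F y₀, ParamHyp K A B g η F y₀ →
    ∀ j, 1 ≤ j → j ≤ K → ∀ y, |iteratedDeriv j (logD F) y| ≤ C := by
  suffices H : ∀ k ≤ K, ∃ C, ∀ g η F y₀, ParamHyp K A B g η F y₀ →
      ∀ j, 1 ≤ j → j ≤ k → ∀ y, |iteratedDeriv j (logD F) y| ≤ C from H K le_rfl
  intro k
  induction k with
  | zero => exact fun _ => ⟨0, fun _ _ _ _ _ j h1 h2 => by omega⟩
  | succ k ih =>
    intro hk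
    obtain ⟨C, hC⟩ := ih (by omega)
    have hK : 1 ≤ K := by omega
    obtain ⟨C₁, hC₁1, hC₁⟩ := iteratedDeriv_exp_bound k C
    obtain ⟨C₂, hC₂1, hC₂⟩ := iteratedDeriv_comp_bound k (C₁ * (A * Real.exp (A + B)))
    refine ⟨max C (B + 2 ^ k * (C₂ * A * C₁) * Real.exp (A + B)), fun g η F y₀ h j h1 hj y => ?_⟩
    rcases Nat.lt_or_ge j (k + 1) with hlt | hge
    · exact (hC g η F y₀ h j h1 (by omega) y).trans (le_max_left _ _)
    obtain rfl : j = k + 1 := by omega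
    refine le_trans ?_ (le_max_right _ _)
    have hA := h.A_nonneg hK
    have hη := h.pos
    have hL := h.param.contDiff_logD
    have hexp : ∀ z, ∀ i ≤ k, |iteratedDeriv i (fun y => Real.exp (logD F y)) z| ≤
        C₁ * deriv F z := fun z i hi => by
      have := hC₁ (logD F) z hL.contDiffAt (fun i hi1 hi => hC g η F y₀ h i hi1 hi z) i hi
      rwa [h.param.exp_logD] at this
    have hexpF : (fun y => Real.exp (logD F y)) = deriv F := funext h.param.exp_logD
    have hFb : ∀ z, ∀ i, 1 ≤ i → i ≤ k → |iteratedDeriv i F z| ≤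
        C₁ * (A * Real.exp (A + B)) := by
      intro z i hi1 hi
      obtain ⟨i, rfl⟩ : ∃ l, i = l + 1 := ⟨i - 1, by omega⟩
      rw [iteratedDeriv_succ', ← hexpF]
      refine (hexp z i (by omega)).trans ?_
      exact mul_le_mul_of_nonneg_left (h.deriv_le hK z) (by linarith)
    have hw : ∀ x ∈ Ioo (0:ℝ) 1, ContDiffAt ℝ ∞ (logD g) x := fun x hx =>
      (h.diff.smooth _ hx).logD (h.diff.deriv_pos _ hx)
    have hterm : ∀ z, |iteratedDeriv (k + 1) (fun y => logD g (F y)) z| ≤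
        2 ^ k * (C₂ * A * C₁) * (η * deriv F z) := by
      intro z
      rw [iteratedDeriv_logD_comp h.diff h.param]
      have h2 := hC₂ (deriv (logD g)) F z (A * η) (hw _ (h.param.mem z)).deriv_infty
        h.param.smooth.contDiffAt (fun i hi => by
          rw [← iteratedDeriv_succ']
          exact h.map_bound _ (by omega) (by omega) _ (h.param.mem z)) (hFb z)
      have := iteratedDeriv_mul_bound (n := k)
        ((hw _ (h.param.mem z)).deriv_infty.comp z h.param.smooth.contDiffAt)
        (hL.contDiffAt (x := z)).exp h2 (hexp z) k le_rfl
      refine this.trans (le_of_eq ?_)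
      ring
    obtain ⟨n, hn⟩ := IsParam.exists_int_window hη y₀ y
    have hn' := Ico_subset_Icc_self hn
    set u := y - n * η with hu
    obtain ⟨s, a, N, hs, hN⟩ := h.param.logD_add_int h.diff n
    have hsh : iteratedDeriv (k + 1) (logD F) y =
        iteratedDeriv (k + 1) (fun z => logD F (z + n * η)) u := by
      rw [iteratedDeriv_comp_add_const, hu]; simp
    have hsm : ∀ i : ℕ, ContDiff ℝ ∞ fun z => logD g (F (z + a * η + i * η)) := fun i =>
      contDiff_iff_contDiffAt.2 fun z => (hw _ (h.param.mem _)).fun_comp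
        (f := fun z => F (z + a * η + i * η)) z (h.param.smooth.comp (by fun_prop)).contDiffAt
    have hder : iteratedDeriv (k + 1) (logD F) y = iteratedDeriv (k + 1) (logD F) u +
        s * ∑ i ∈ Finset.range N,
          iteratedDeriv (k + 1) (fun z => logD g (F z)) (u + a * η + i * η) := by
      rw [hsh, funext hN, iteratedDeriv_fun_add (hL.contDiffAt.of_infty _)
        ((contDiff_const.mul (ContDiff.sum fun i _ => hsm i)).contDiffAt.of_infty _),
        iteratedDeriv_const_mul_field, iteratedDeriv_fun_sum fun i _ => (hsm i).contDiffAt.of_infty _]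
      congr 2
      refine Finset.sum_congr rfl fun i _ => ?_
      have := iteratedDeriv_comp_add_const (k + 1) (fun z => logD g (F z)) (a * η + i * η)
      simp only [← add_assoc] at this
      rw [this]
    rw [hder]
    have hP : (0:ℝ) ≤ 2 ^ k * (C₂ * A * C₁) := by positivity
    refine (abs_add_le _ _).trans (add_le_add (h.window_bound _ h1 hk _ hn') ?_)
    rw [abs_mul, hs, one_mul]
    refine (Finset.abs_sum_le_sum_abs _ _).trans ?_
    calc _ ≤ ∑ i ∈ Finset.range N, 2 ^ k * (C₂ * A * C₁) * (Real.exp (A + B) *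
            (F (y₀ + a * η + i * η + η) - F (y₀ + a * η + i * η))) := by
          refine Finset.sum_le_sum fun i _ => (hterm _).trans ?_
          refine mul_le_mul_of_nonneg_left ?_ hP
          have := h.deriv_le_length hK (a + i) hn'
          push_cast at this
          simpa only [add_mul, ← add_assoc] using this
      _ ≤ 2 ^ k * (C₂ * A * C₁) * (Real.exp (A + B) * 1) := by
          rw [← Finset.mul_sum, ← Finset.mul_sum]
          gcongr
          exact h.param.sum_length_le _ _
      _ = _ := by ring

/-- A smooth nondecreasing function equal to `0` before `a` and to `1` after `b`. -/
noncomputable def ramp (a b x : ℝ) : ℝ := Real.smoothTransition (-(a / (b - a)) + (b - a)⁻¹ * x)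

section ramp
variable {a b x : ℝ}

theorem ramp_nonneg : 0 ≤ ramp a b x := Real.smoothTransition.nonneg _

theorem ramp_le_one : ramp a b x ≤ 1 := Real.smoothTransition.le_one _

theorem ramp_arg (h : a < b) : -(a / (b - a)) + (b - a)⁻¹ * x = (x - a) / (b - a) := by
  have : b - a ≠ 0 := (sub_pos.2 h).ne'
  field_simp; ring

theorem ramp_zero (h : a < b) (hx : x ≤ a) : ramp a b x = 0 := by
  rw [ramp, ramp_arg h]
  exact Real.smoothTransition.zero_of_nonpos
    (div_nonpos_of_nonpos_of_nonneg (by linarith) (by linarith))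

theorem ramp_one (h : a < b) (hx : b ≤ x) : ramp a b x = 1 := by
  rw [ramp, ramp_arg h]
  exact Real.smoothTransition.one_of_one_le ((one_le_div (by linarith)).2 (by linarith))

theorem contDiff_ramp : ContDiff ℝ ∞ (ramp a b) := by
  unfold ramp
  exact Real.smoothTransition.contDiff.comp (by fun_prop)

end ramp

theorem exists_smoothTransition_bound (n : ℕ) : ∃ C ≥ (1:ℝ), ∀ i ≤ n, ∀ x,
    |iteratedDeriv i Real.smoothTransition x| ≤ C := by
  have hs : ContDiff ℝ ∞ Real.smoothTransition := Real.smoothTransition.contDiff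
  have h1 : ∀ i : ℕ, ∃ C, ∀ x, |iteratedDeriv i Real.smoothTransition x| ≤ C := by
    intro i
    have hc : Continuous (iteratedDeriv i Real.smoothTransition) :=
      hs.continuous_iteratedDeriv i (by exact_mod_cast le_top)
    obtain ⟨C, hC⟩ := isCompact_Icc (a := (0:ℝ)) (b := 1) |>.exists_bound_of_continuousOn
      hc.continuousOn
    refine ⟨max C 1, fun x => ?_⟩
    have hcon : ∀ c x : ℝ, |c| ≤ 1 → Real.smoothTransition =ᶠ[𝓝 x] (fun _ => c) →
        |iteratedDeriv i Real.smoothTransition x| ≤ max C 1 := by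
      intro c x hc h
      rw [h.iteratedDeriv_eq, iteratedDeriv_const]
      refine le_trans ?_ (le_max_right _ _)
      split_ifs <;> simp [hc]
    rcases lt_or_ge x 0 with h | h
    · exact hcon 0 x (by simp) ((eventually_lt_nhds h).mono fun y hy =>
        Real.smoothTransition.zero_of_nonpos hy.le)
    rcases lt_or_ge 1 x with h' | h'
    · exact hcon 1 x (by simp) ((eventually_gt_nhds h').mono fun y hy =>
        Real.smoothTransition.one_of_one_le hy.le)
    exact (hC x ⟨h, h'⟩).trans (le_max_left _ _)
  choose C hC using h1
  refine ⟨1 + ∑ i ∈ Finset.range (n + 1), |C i|, ?_, fun i hi x => ?_⟩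
  · have := Finset.sum_nonneg fun i (_ : i ∈ Finset.range (n + 1)) => abs_nonneg (C i)
    linarith
  · have := Finset.single_le_sum (f := fun i => |C i|) (fun i _ => abs_nonneg (C i))
      (Finset.mem_range.2 (Nat.lt_succ_of_le hi))
    linarith [hC i x, le_abs_self (C i)]

theorem exists_ramp_bound (n : ℕ) : ∃ C ≥ (1:ℝ), ∀ a b : ℝ, a < b → b - a ≤ 1 → ∀ i ≤ n, ∀ x,
    |iteratedDeriv i (ramp a b) x| ≤ C * ((b - a)⁻¹) ^ n := by
  obtain ⟨C, hC1, hC⟩ := exists_smoothTransition_bound n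
  refine ⟨C, hC1, fun a b hab h1 i hi x => ?_⟩
  have h0 : 0 < b - a := sub_pos.2 hab
  have e : iteratedDeriv i (ramp a b) x = _ :=
    iteratedDeriv_comp_affine Real.smoothTransition (-(a / (b - a))) (b - a)⁻¹ i x
  rw [e, abs_mul, abs_of_nonneg (by positivity), mul_comm]
  have h2 : 1 ≤ (b - a)⁻¹ := (one_le_inv₀ h0).2 h1
  exact mul_le_mul (hC i hi _) (pow_le_pow_right₀ h2 hi) (by positivity) (by linarith)

/-- Construction of permutations from increasing diffeomorphisms of `(0, 1)`. -/
theorem exists_perm_of_Ioo {G : ℝ → ℝ} (hG : ∀ x ∈ Ioo (0:ℝ) 1, ContDiffAt ℝ ∞ G x)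
    (hG' : ∀ x ∈ Ioo (0:ℝ) 1, 0 < deriv G x)
    (hlo : ∀ t ∈ Ioo (0:ℝ) 1, ∃ x ∈ Ioo (0:ℝ) t, G x ∈ Ioc 0 t)
    (hhi : ∀ t ∈ Ioo (0:ℝ) 1, ∃ x ∈ Ioo t 1, G x ∈ Ico t 1) :
    ∃ g : Equiv.Perm ℝ, IooDiff g ∧ (∀ x ∈ Ioo (0:ℝ) 1, g x = G x) ∧
      ∀ x, x ∉ Ioo (0:ℝ) 1 → g x = x := by
  classical
  have hmono : StrictMonoOn G (Ioo 0 1) := by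
    refine strictMonoOn_of_deriv_pos (convex_Ioo 0 1)
      (fun x hx => (hG x hx).continuousAt.continuousWithinAt) ?_
    intro x hx; rw [interior_Ioo] at hx; exact hG' x hx
  have hmem : ∀ x ∈ Ioo (0:ℝ) 1, G x ∈ Ioo (0:ℝ) 1 := by
    intro x hx
    obtain ⟨y, hy, hGy⟩ := hlo x hx
    obtain ⟨z, hz, hGz⟩ := hhi x hx
    exact ⟨hGy.1.trans (hmono ⟨hy.1, hy.2.trans hx.2⟩ hx hy.2),
      (hmono hx ⟨hx.1.trans hz.1, hz.2⟩ hz.1).trans hGz.2⟩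
  have hsurj : ∀ t ∈ Ioo (0:ℝ) 1, ∃ x ∈ Ioo (0:ℝ) 1, G x = t := by
    intro t ht
    obtain ⟨y, hy, hGy⟩ := hlo t ht
    obtain ⟨z, hz, hGz⟩ := hhi t ht
    have hsub : Icc y z ⊆ Ioo (0:ℝ) 1 := fun w hw => ⟨hy.1.trans_le hw.1, hw.2.trans_lt hz.2⟩
    obtain ⟨x, hx, hxt⟩ := intermediate_value_Icc (hy.2.trans hz.1).le
      (fun w hw => (hG w (hsub hw)).continuousAt.continuousWithinAt) ⟨hGy.2, hGz.1⟩
    exact ⟨x, hsub hx, hxt⟩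
  set g : ℝ → ℝ := fun x => if x ∈ Ioo (0:ℝ) 1 then G x else x with hg
  have hin : ∀ x ∈ Ioo (0:ℝ) 1, g x = G x := fun x hx => if_pos hx
  have hout : ∀ x, x ∉ Ioo (0:ℝ) 1 → g x = x := fun x hx => if_neg hx
  have hmem' : ∀ x, g x ∈ Ioo (0:ℝ) 1 ↔ x ∈ Ioo (0:ℝ) 1 := by
    intro x
    by_cases hx : x ∈ Ioo (0:ℝ) 1
    · rw [hin x hx]; exact ⟨fun _ => hx, fun _ => hmem x hx⟩
    · rw [hout x hx]
  have hbij : Function.Bijective g := by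
    constructor
    · intro x y hxy
      have hiff : x ∈ Ioo (0:ℝ) 1 ↔ y ∈ Ioo (0:ℝ) 1 := by rw [← hmem', hxy, hmem']
      by_cases hx : x ∈ Ioo (0:ℝ) 1
      · have hy := hiff.1 hx
        rw [hin x hx, hin y hy] at hxy
        exact hmono.injOn hx hy hxy
      · have hy := fun h => hx (hiff.2 h)
        rwa [hout x hx, hout y hy] at hxy
    · intro t
      by_cases ht : t ∈ Ioo (0:ℝ) 1
      · obtain ⟨x, hx, h⟩ := hsurj t ht
        exact ⟨x, by rw [hin x hx, h]⟩
      · exact ⟨t, hout t ht⟩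
  have hev : ∀ x ∈ Ioo (0:ℝ) 1, g =ᶠ[𝓝 x] G := fun x hx => by
    filter_upwards [Ioo_mem_nhds hx.1 hx.2] with y hy using hin y hy
  refine ⟨Equiv.ofBijective g hbij, ⟨hmem', fun x hx => ?_, fun x hx => ?_⟩, hin, hout⟩
  · exact (hG x hx).congr_of_eventuallyEq (hev x hx)
  · change 0 < deriv g x
    rw [(hev x hx).deriv_eq]; exact hG' x hx

/-- A map of `(0, 1)` moving points to the right and very close to the identity near the
endpoints. -/
structure CLData (r : ℕ) (η sa sb : ℝ) (f : Equiv.Perm ℝ) : Prop where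
  diff : IooDiff f
  lt : ∀ x ∈ Ioo (0:ℝ) 1, x < f x
  two_le : 2 ≤ r
  pos : 0 < η
  le_one : η ≤ 1
  sa_pos : 0 < sa
  sa_le : sa ≤ 1 / 10
  sb_pos : 0 < sb
  sb_le : sb ≤ 1 / 10
  left : ∀ j ≤ r, ∀ x ∈ Ioo 0 sa, |iteratedDeriv j (fun x => f x - x) x| ≤ η / 8 * sa ^ (r + 1)
  right : ∀ j ≤ r, ∀ x ∈ Ioo (1 - sb) 1,
    |iteratedDeriv j (fun x => f x - x) x| ≤ η / 8 * sb ^ (r + 1)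

/-- A bump function supported in `[7/20, 9/20]` with value `1` at `2/5`. -/
noncomputable def bump (x : ℝ) : ℝ := ramp (7/20) (2/5) x - ramp (2/5) (9/20) x

theorem contDiff_bump : ContDiff ℝ ∞ bump := contDiff_ramp.sub contDiff_ramp

theorem bump_nonneg (x : ℝ) : 0 ≤ bump x := by
  rcases le_total x (2/5) with h | h
  · rw [bump, ramp_zero (a := 2/5) (by norm_num) h, sub_zero]; exact ramp_nonneg
  · rw [bump, ramp_one (b := 2/5) (by norm_num) h, sub_nonneg]; exact ramp_le_one

theorem bump_le_one (x : ℝ) : bump x ≤ 1 := by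
  have h1 := ramp_le_one (a := 7/20) (b := 2/5) (x := x)
  have h2 := ramp_nonneg (a := 2/5) (b := 9/20) (x := x)
  rw [bump]; linarith

theorem bump_left {x : ℝ} (h : x ≤ 7/20) : bump x = 0 := by
  rw [bump, ramp_zero (by norm_num) h, ramp_zero (by norm_num) (by linarith), sub_zero]

theorem bump_right {x : ℝ} (h : 9/20 ≤ x) : bump x = 0 := by
  rw [bump, ramp_one (by norm_num) (by linarith), ramp_one (by norm_num) (by linarith), sub_self]

theorem bump_mid : bump (2/5) = 1 := by
  rw [bump, ramp_one (by norm_num) le_rfl, ramp_zero (by norm_num) le_rfl, sub_zero]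

/-- A family of explicit maps agreeing with `f` near the endpoints. -/
structure Model (r : ℕ) (C η sa sb : ℝ) (f : Equiv.Perm ℝ) (g : ℝ → Equiv.Perm ℝ) : Prop where
  diff : ∀ θ ∈ Icc (0:ℝ) 1, IooDiff (g θ)
  bound : ∀ θ ∈ Icc (0:ℝ) 1, ∀ x ∈ Ioo (0:ℝ) 1, ∀ j ≤ r,
    |iteratedDeriv j (fun x => g θ x - x) x| ≤ C * η
  lt : ∀ θ ∈ Ico (0:ℝ) 1, ∀ x ∈ Ioo (0:ℝ) 1, x < g θ x
  eq_left : ∀ θ ∈ Icc (0:ℝ) 1, ∀ x ∈ Ioc 0 (sa / 2), g θ x = f x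
  eq_right : ∀ θ ∈ Icc (0:ℝ) 1, ∀ x ∈ Ico (1 - sb / 2) 1, g θ x = f x
  ge_left : ∀ x ∈ Ioo 0 sa, f x ≤ g 0 x
  ge_right : ∀ x ∈ Ioo (1 - sb) 1, f x ≤ g 0 x
  slow : ∀ θ ∈ Icc (0:ℝ) 1, ∀ x ∈ Icc (3 * sa / 4) (1/5), g θ x = x + η * sa ^ r
  plateau : ∀ θ ∈ Icc (0:ℝ) 1, ∀ x ∈ Icc (9/20:ℝ) (7/10), g θ x = x + η
  fast : ∀ x ∈ Icc (3 * sa / 4) (1 - 3 * sb / 4), x + η * (min sa sb) ^ r ≤ g 0 x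
  theta : ∀ θ ∈ Icc (0:ℝ) 1, ∀ x ∈ Ioo (0:ℝ) 1, g θ x = g 0 x - η * θ * bump x
  top : g 1 (2/5) = 2/5

/-- The displacement of the model away from the endpoints. -/
noncomputable def modelY (r : ℕ) (η sa sb θ x : ℝ) : ℝ :=
  η * (sa ^ r * (1 - ramp (1/5) (3/10) x) + (ramp (1/5) (3/10) x - ramp (7/10) (4/5) x) -
    θ * bump x + sb ^ r * ramp (7/10) (4/5) x)

section modelY
variable {r : ℕ} {η sa sb θ x : ℝ}

theorem contDiff_modelY : ContDiff ℝ ∞ (modelY r η sa sb θ) := by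
  unfold modelY
  have h1 := @contDiff_ramp (1/5) (3/10)
  have h2 := @contDiff_ramp (7/10) (4/5)
  have h3 := contDiff_bump
  fun_prop

theorem modelY_left (h : x ≤ 1/5) : modelY r η sa sb θ x = η * sa ^ r := by
  rw [modelY, ramp_zero (by norm_num) h, ramp_zero (by norm_num) (by linarith),
    bump_left (by linarith)]; ring

theorem modelY_right (h : 4/5 ≤ x) : modelY r η sa sb θ x = η * sb ^ r := by
  rw [modelY, ramp_one (by norm_num) (by linarith), ramp_one (by norm_num) h,
    bump_right (by linarith)]; ring

theorem modelY_mid (h : x ∈ Icc (3/10:ℝ) (7/10)) : modelY r η sa sb θ x = η * (1 - θ * bump x) := by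
  rw [modelY, ramp_one (by norm_num) h.1, ramp_zero (by norm_num) h.2]; ring

theorem modelY_zero_ge (hη : 0 ≤ η) {m : ℝ} (h1 : m ≤ 1) (ha : m ≤ sa ^ r) (hb : m ≤ sb ^ r) :
    η * m ≤ modelY r η sa sb 0 x := by
  refine mul_le_mul_of_nonneg_left ?_ hη
  have p0 := @ramp_nonneg (1/5) (3/10) x
  have p1 := @ramp_le_one (1/5) (3/10) x
  have q0 := @ramp_nonneg (7/10) (4/5) x
  have q1 := @ramp_le_one (7/10) (4/5) x
  have hpq : ramp (7/10) (4/5) x ≤ ramp (1/5) (3/10) x := by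
    rcases le_total x (7/10) with h | h
    · rwa [ramp_zero (a := 7/10) (by norm_num) h]
    · rwa [ramp_one (b := 3/10) (by norm_num) (by linarith)]
  nlinarith [mul_nonneg (sub_nonneg.2 ha) (sub_nonneg.2 p1), mul_nonneg (sub_nonneg.2 hb) q0,
    mul_nonneg (sub_nonneg.2 h1) (sub_nonneg.2 hpq)]

theorem modelY_pos (hη : 0 < η) (ha : 0 < sa) (hb : 0 < sb) (hθ : θ ∈ Ico (0:ℝ) 1) :
    0 < modelY r η sa sb θ x := by
  by_cases h : x ∈ Icc (3/10:ℝ) (7/10)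
  · rw [modelY_mid h]
    have := bump_le_one x
    have := bump_nonneg x
    have : θ * bump x < 1 := by nlinarith [hθ.1, hθ.2]
    exact mul_pos hη (by linarith)
  · have hb0 : bump x = 0 := by
      rw [mem_Icc, not_and_or, not_le, not_le] at h
      rcases h with h | h
      · exact bump_left (by linarith)
      · exact bump_right (by linarith)
    have e : modelY r η sa sb θ x = modelY r η sa sb 0 x := by simp [modelY, hb0]
    have hm : 0 < min 1 (min (sa ^ r) (sb ^ r)) :=
      lt_min one_pos (lt_min (pow_pos ha _) (pow_pos hb _))
    rw [e]
    refine lt_of_lt_of_le (mul_pos hη hm) (modelY_zero_ge hη.le (min_le_left _ _) ?_ ?_)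
    · exact (min_le_right _ _).trans (min_le_left _ _)
    · exact (min_le_right _ _).trans (min_le_right _ _)

end modelY

theorem abs_iteratedDeriv_const_le (j : ℕ) (c x : ℝ) : |iteratedDeriv j (fun _ : ℝ => c) x| ≤ |c| := by
  rw [iteratedDeriv_const]; split_ifs <;> simp

theorem exists_modelY_bound (r : ℕ) : ∃ C ≥ (1:ℝ), ∀ η sa sb θ x : ℝ, 0 ≤ η → 0 ≤ sa → sa ≤ 1 →
    0 ≤ sb → sb ≤ 1 → θ ∈ Icc (0:ℝ) 1 → ∀ j ≤ r, |iteratedDeriv j (modelY r η sa sb θ) x| ≤ C * η := by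
  obtain ⟨C, hC1, hC⟩ := exists_ramp_bound r
  set M := C * 20 ^ r with hM
  have hM1 : 1 ≤ M := one_le_mul_of_one_le_of_one_le hC1 (one_le_pow₀ (by norm_num))
  have hR : ∀ a b : ℝ, b - a = 1/10 ∨ b - a = 1/20 → ∀ i ≤ r, ∀ x, |iteratedDeriv i (ramp a b) x| ≤ M := by
    intro a b hab i hi x
    have h0 : 0 < b - a := by rcases hab with h | h <;> rw [h] <;> norm_num
    have h1 : b - a ≤ 1 := by rcases hab with h | h <;> rw [h] <;> norm_num
    refine (hC a b (by linarith) h1 i hi x).trans ?_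
    refine mul_le_mul_of_nonneg_left (pow_le_pow_left₀ (by positivity) ?_ _) (by linarith)
    rcases hab with h | h <;> rw [h] <;> norm_num
  refine ⟨7 * M, by linarith, fun η sa sb θ x hη ha0 ha1 hb0 hb1 hθ j hj => ?_⟩
  have e : modelY r η sa sb θ = fun x => η * ((sa ^ r + ((1 - sa ^ r) * ramp (1/5) (3/10) x +
      (sb ^ r - 1) * ramp (7/10) (4/5) x)) - θ * (ramp (7/20) (2/5) x - ramp (2/5) (9/20) x)) := by
    funext x; rw [modelY, bump]; ring
  have cr : ∀ {a b x : ℝ}, ContDiffAt ℝ j (ramp a b) x := contDiff_ramp.contDiffAt.of_infty j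
  rw [e, iteratedDeriv_const_mul_field, abs_mul, abs_of_nonneg hη, mul_comm]
  refine mul_le_mul_of_nonneg_right ?_ hη
  rw [iteratedDeriv_fun_sub (by fun_prop (disch := exact cr)) (by fun_prop (disch := exact cr)),
    iteratedDeriv_fun_add (by fun_prop) (by fun_prop (disch := exact cr)),
    iteratedDeriv_fun_add (by fun_prop (disch := exact cr)) (by fun_prop (disch := exact cr)),
    iteratedDeriv_const_mul_field, iteratedDeriv_const_mul_field, iteratedDeriv_const_mul_field,
    iteratedDeriv_fun_sub cr cr]
  have a0 := pow_nonneg ha0 r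
  have a1 := pow_le_one₀ (n := r) ha0 ha1
  have b0 := pow_nonneg hb0 r
  have b1 := pow_le_one₀ (n := r) hb0 hb1
  have t0 := abs_iteratedDeriv_const_le j (sa ^ r) x
  rw [abs_of_nonneg a0] at t0
  have t1 := hR (1/5) (3/10) (by norm_num) j hj x
  have t2 := hR (7/10) (4/5) (by norm_num) j hj x
  have t3 := hR (7/20) (2/5) (by norm_num) j hj x
  have t4 := hR (2/5) (9/20) (by norm_num) j hj x
  have mul_le : ∀ c d : ℝ, |c| ≤ 1 → |d| ≤ M → |c * d| ≤ M := fun c d hc hd => by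
    rw [abs_mul]; nlinarith [abs_nonneg c, abs_nonneg d]
  have u1 := mul_le (1 - sa ^ r) _ (by rw [abs_le]; constructor <;> linarith) t1
  have u2 := mul_le (sb ^ r - 1) _ (by rw [abs_le]; constructor <;> linarith) t2
  have u3 : |θ * (iteratedDeriv j (ramp (7/20) (2/5)) x - iteratedDeriv j (ramp (2/5) (9/20)) x)|
      ≤ 2 * M := by
    rw [abs_mul, abs_of_nonneg hθ.1]
    have := abs_sub (iteratedDeriv j (ramp (7/20) (2/5)) x) (iteratedDeriv j (ramp (2/5) (9/20)) x)
    nlinarith [hθ.1, hθ.2, abs_nonneg (iteratedDeriv j (ramp (7/20) (2/5)) x - iteratedDeriv j (ramp (2/5) (9/20)) x)]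
  rw [abs_le] at *
  constructor <;> linarith [t0.1, t0.2, u1.1, u1.2, u2.1, u2.2, u3.1, u3.2]

/-- Interpolation between the displacement `f x - x` near the endpoints and `modelY`. -/
noncomputable def modelZ (r : ℕ) (η sa sb : ℝ) (f : ℝ → ℝ) (θ x : ℝ) : ℝ :=
  modelY r η sa sb θ x + (1 - ramp (sa / 2) (3 * sa / 4) x + ramp (1 - 3 * sb / 4) (1 - sb / 2) x) *
    (f x - x - modelY r η sa sb θ x)

namespace CLData
variable {r : ℕ} {η sa sb : ℝ} {f : Equiv.Perm ℝ} {θ x : ℝ}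

theorem modelZ_left (h : CLData r η sa sb f) (hx : x ≤ sa) : modelZ r η sa sb f θ x =
    (f x - x) - ramp (sa / 2) (3 * sa / 4) x * (f x - x - η * sa ^ r) := by
  have := h.sa_le; have := h.sb_le; have := h.sb_pos
  rw [modelZ, modelY_left (by linarith), ramp_zero (a := 1 - 3 * sb / 4) (by linarith) (by linarith)]
  ring

theorem modelZ_right (h : CLData r η sa sb f) (hx : 1 - sb ≤ x) : modelZ r η sa sb f θ x =
    η * sb ^ r + ramp (1 - 3 * sb / 4) (1 - sb / 2) x * (f x - x - η * sb ^ r) := by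
  have := h.sa_le; have := h.sb_le; have := h.sa_pos
  rw [modelZ, modelY_right (by linarith), ramp_one (a := sa / 2) (by linarith) (by linarith)]
  ring

theorem modelZ_mid (h : CLData r η sa sb f) (hx : 3 * sa / 4 ≤ x) (hx' : x ≤ 1 - 3 * sb / 4) :
    modelZ r η sa sb f θ x = modelY r η sa sb θ x := by
  have := h.sb_pos; have := h.sa_pos
  rw [modelZ, ramp_one (a := sa / 2) (by linarith) (by linarith),
    ramp_zero (a := 1 - 3 * sb / 4) (by linarith) (by linarith)]
  ring

theorem weight_mem (h : CLData r η sa sb f) (x : ℝ) :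
    1 - ramp (sa / 2) (3 * sa / 4) x + ramp (1 - 3 * sb / 4) (1 - sb / 2) x ∈ Icc (0:ℝ) 1 := by
  have := h.sa_le; have := h.sb_le; have := h.sa_pos; have := h.sb_pos
  have p0 := @ramp_nonneg (sa / 2) (3 * sa / 4) x
  have p1 := @ramp_le_one (sa / 2) (3 * sa / 4) x
  have q0 := @ramp_nonneg (1 - 3 * sb / 4) (1 - sb / 2) x
  have q1 := @ramp_le_one (1 - 3 * sb / 4) (1 - sb / 2) x
  rcases le_total x (1/2) with hx | hx
  · rw [ramp_zero (a := 1 - 3 * sb / 4) (by linarith) (by linarith)]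
    constructor <;> linarith
  · rw [ramp_one (a := sa / 2) (by linarith) (by linarith)]
    constructor <;> linarith

theorem modelZ_pos (h : CLData r η sa sb f) (hθ : θ ∈ Ico (0:ℝ) 1) (hx : x ∈ Ioo (0:ℝ) 1) :
    0 < modelZ r η sa sb f θ x := by
  have hw := h.weight_mem x
  have hY : 0 < modelY r η sa sb θ x := modelY_pos h.pos h.sa_pos h.sb_pos hθ
  have hΔ := sub_pos.2 (h.lt x hx)
  rw [modelZ]
  set w := 1 - ramp (sa / 2) (3 * sa / 4) x + ramp (1 - 3 * sb / 4) (1 - sb / 2) x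
  have := mul_nonneg hw.1 hΔ.le
  have := mul_nonneg (sub_nonneg.2 hw.2) hY.le
  rcases hw.1.eq_or_lt with h0 | h0
  · rw [← h0]; linarith
  · nlinarith [mul_pos h0 hΔ]

theorem modelZ_theta (h : CLData r η sa sb f) : modelZ r η sa sb f θ x =
    modelZ r η sa sb f 0 x - η * θ * bump x := by
  by_cases hx : x ∈ Icc (7/20:ℝ) (9/20)
  · have := h.sa_le; have := h.sb_le
    rw [h.modelZ_mid (by linarith [hx.1]) (by linarith [hx.2]),
      h.modelZ_mid (by linarith [hx.1]) (by linarith [hx.2]), modelY, modelY]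
    ring
  · have hb0 : bump x = 0 := by
      rw [mem_Icc, not_and_or, not_le, not_le] at hx
      rcases hx with h | h
      · exact bump_left (by linarith)
      · exact bump_right (by linarith)
    simp [modelZ, modelY, hb0]

theorem contDiffAt_modelZ (h : CLData r η sa sb f) (hx : x ∈ Ioo (0:ℝ) 1) :
    ContDiffAt ℝ ∞ (modelZ r η sa sb f θ) x := by
  have h1 := (@contDiff_modelY r η sa sb θ).contDiffAt (x := x)
  have h2 := (@contDiff_ramp (sa / 2) (3 * sa / 4)).contDiffAt (x := x)
  have h3 := (@contDiff_ramp (1 - 3 * sb / 4) (1 - sb / 2)).contDiffAt (x := x)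
  have h4 := h.diff.smooth x hx
  unfold modelZ
  fun_prop

/-- Bound for the product of a steep ramp and a flat function. -/
theorem side_bound (r : ℕ) : ∃ C ≥ (1:ℝ), ∀ (η s a b x : ℝ) (Δ : ℝ → ℝ), 0 < s → s ≤ 1 → 0 ≤ η →
    b - a = s / 4 → ContDiffAt ℝ ∞ Δ x →
    (∀ j ≤ r, |iteratedDeriv j Δ x| ≤ η / 8 * s ^ (r + 1)) →
    ∀ j ≤ r, |iteratedDeriv j (fun x => ramp a b x * (Δ x - η * s ^ r)) x| ≤ C * η := by
  obtain ⟨C, hC1, hC⟩ := exists_ramp_bound r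
  refine ⟨2 ^ r * (C * 4 ^ r * 2), ?_, fun η s a b x Δ hs hs1 hη hab hΔ hb j hj => ?_⟩
  · refine one_le_mul_of_one_le_of_one_le (one_le_pow₀ (by norm_num)) ?_
    refine one_le_mul_of_one_le_of_one_le ?_ (by norm_num)
    exact one_le_mul_of_one_le_of_one_le hC1 (one_le_pow₀ (by norm_num))
  have hsr : 0 < s ^ r := pow_pos hs _
  have h1 : ∀ i ≤ r, |iteratedDeriv i (fun x => Δ x - η * s ^ r) x| ≤ 2 * (η * s ^ r) := by
    intro i hi
    rw [iteratedDeriv_fun_sub (hΔ.of_infty i) contDiffAt_const]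
    have e1 := hb i hi
    have e2 := abs_iteratedDeriv_const_le i (η * s ^ r) x
    rw [abs_of_nonneg (a := η * s ^ r) (by positivity)] at e2
    have e3 : η / 8 * s ^ (r + 1) ≤ η * s ^ r := by
      rw [pow_succ]; nlinarith [mul_nonneg hη hsr.le]
    have := abs_sub (iteratedDeriv i Δ x) (iteratedDeriv i (fun _ => η * s ^ r) x)
    linarith
  have h2 := iteratedDeriv_mul_bound (n := r) (x := x) (f := ramp a b) contDiff_ramp.contDiffAt
    (hΔ.sub contDiffAt_const) (fun i hi => hC a b (by linarith) (by linarith) i hi x) h1 j hj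
  refine h2.trans (le_of_eq ?_)
  rw [hab, inv_div, div_pow]
  field_simp

theorem exists_modelZ_bound (r : ℕ) : ∃ C ≥ (1:ℝ), ∀ (η sa sb : ℝ) (f : Equiv.Perm ℝ),
    CLData r η sa sb f → ∀ θ ∈ Icc (0:ℝ) 1, ∀ x ∈ Ioo (0:ℝ) 1, ∀ j ≤ r,
    |iteratedDeriv j (modelZ r η sa sb f θ) x| ≤ C * η := by
  obtain ⟨C, hC1, hC⟩ := side_bound r
  obtain ⟨C', hC'1, hC'⟩ := exists_modelY_bound r
  refine ⟨C + C' + 1, by linarith, fun η sa sb f h θ hθ x hx j hj => ?_⟩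
  have hη := h.pos
  have a1 := h.sa_le; have b1 := h.sb_le; have a0 := h.sa_pos; have b0 := h.sb_pos
  have hΔ : ContDiffAt ℝ ∞ (fun x => f x - x) x := (h.diff.smooth x hx).sub contDiffAt_id
  have hp : C' * η ≥ 0 := by positivity
  have hp' : C * η ≥ 0 := by positivity
  rcases lt_or_ge x sa with hxa | hxa
  · have e : modelZ r η sa sb f θ =ᶠ[𝓝 x] fun x => (f x - x) -
        ramp (sa / 2) (3 * sa / 4) x * (f x - x - η * sa ^ r) :=
      (eventually_lt_nhds hxa).mono fun y hy => h.modelZ_left hy.le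
    have hpr : ContDiffAt ℝ ∞ (fun x => ramp (sa / 2) (3 * sa / 4) x * (f x - x - η * sa ^ r)) x :=
      contDiff_ramp.contDiffAt.mul (hΔ.sub contDiffAt_const)
    rw [e.iteratedDeriv_eq, iteratedDeriv_fun_sub (hΔ.of_infty j) (hpr.of_infty j)]
    have e1 := h.left j hj x ⟨hx.1, hxa⟩
    have e2 := hC η sa (sa / 2) (3 * sa / 4) x (fun x => f x - x) a0 (by linarith) hη.le (by ring)
      hΔ (fun j hj => h.left j hj x ⟨hx.1, hxa⟩) j hj
    have e3 : η / 8 * sa ^ (r + 1) ≤ η := by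
      have := pow_le_one₀ (n := r + 1) a0.le (by linarith)
      nlinarith [pow_pos a0 (r+1)]
    refine (abs_sub _ _).trans ?_
    linarith
  rcases lt_or_ge (1 - sb) x with hxb | hxb
  · have e : modelZ r η sa sb f θ =ᶠ[𝓝 x] fun x => η * sb ^ r +
        ramp (1 - 3 * sb / 4) (1 - sb / 2) x * (f x - x - η * sb ^ r) :=
      (eventually_gt_nhds hxb).mono fun y hy => h.modelZ_right hy.le
    have hpr : ContDiffAt ℝ ∞ (fun x => ramp (1 - 3 * sb / 4) (1 - sb / 2) x *
        (f x - x - η * sb ^ r)) x :=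
      contDiff_ramp.contDiffAt.mul (hΔ.sub contDiffAt_const)
    rw [e.iteratedDeriv_eq, iteratedDeriv_fun_add contDiffAt_const (hpr.of_infty j)]
    have e1 := abs_iteratedDeriv_const_le j (η * sb ^ r) x
    rw [abs_of_nonneg (a := η * sb ^ r) (by positivity)] at e1
    have e2 := hC η sb (1 - 3 * sb / 4) (1 - sb / 2) x (fun x => f x - x) b0 (by linarith) hη.le
      (by ring) hΔ (fun j hj => h.right j hj x ⟨hxb, hx.2⟩) j hj
    have e3 : η * sb ^ r ≤ η := mul_le_of_le_one_right hη.le (pow_le_one₀ b0.le (by linarith))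
    refine (abs_add_le _ _).trans ?_
    linarith
  · have e : modelZ r η sa sb f θ =ᶠ[𝓝 x] modelY r η sa sb θ := by
      filter_upwards [eventually_gt_nhds (show 3 * sa / 4 < x by linarith),
        eventually_lt_nhds (show x < 1 - 3 * sb / 4 by linarith)] with y hy hy'
      exact h.modelZ_mid hy.le hy'.le
    rw [e.iteratedDeriv_eq]
    have := hC' η sa sb θ x hη.le a0.le (by linarith) b0.le (by linarith) hθ j hj
    linarith

end CLData

theorem exists_model (r : ℕ) : ∃ C ≥ (1:ℝ), ∀ (η sa sb : ℝ) (f : Equiv.Perm ℝ),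
    CLData r η sa sb f → C * η ≤ 1 / 2 → ∃ g, Model r C η sa sb f g := by
  obtain ⟨C, hC1, hC⟩ := CLData.exists_modelZ_bound r
  refine ⟨C, hC1, fun η sa sb f h hCη => ?_⟩
  have hη := h.pos
  have a1 := h.sa_le; have b1 := h.sb_le; have a0 := h.sa_pos; have b0 := h.sb_pos
  have h2 := h.two_le
  have hZl : ∀ θ x, x ≤ sa / 2 → x + modelZ r η sa sb f θ x = f x := fun θ x hx => by
    rw [h.modelZ_left (by linarith), ramp_zero (by linarith) hx]; ring
  have hZr : ∀ θ x, 1 - sb / 2 ≤ x → x + modelZ r η sa sb f θ x = f x := fun θ x hx => by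
    rw [h.modelZ_right (by linarith), ramp_one (by linarith) hx]; ring
  have hex : ∀ θ, ∃ g : Equiv.Perm ℝ, θ ∈ Icc (0:ℝ) 1 → IooDiff g ∧
      ∀ x ∈ Ioo (0:ℝ) 1, g x = x + modelZ r η sa sb f θ x := by
    intro θ
    by_cases hθ : θ ∈ Icc (0:ℝ) 1
    swap
    · exact ⟨1, fun h => absurd h hθ⟩
    have hs : ∀ x ∈ Ioo (0:ℝ) 1, ContDiffAt ℝ ∞ (modelZ r η sa sb f θ) x := fun x hx =>
      h.contDiffAt_modelZ hx
    have hsup := h.diff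
    obtain ⟨g, hg, hgG, -⟩ := exists_perm_of_Ioo (G := fun x => x + modelZ r η sa sb f θ x)
      (fun x hx => contDiffAt_id.add (hs x hx)) (fun x hx => by
        have h1 := ((hs x hx).differentiableAt (by simp)).hasDerivAt
        have h2' := (hasDerivAt_id x).add h1
        have h3 : HasDerivAt (fun x => x + modelZ r η sa sb f θ x) _ x := h2'
        rw [h3.deriv]
        have h4 := hC η sa sb f h θ hθ x hx 1 (by omega)
        rw [iteratedDeriv_one] at h4
        linarith [(abs_le.1 (h4.trans hCη)).1])
      (fun t ht => by
        have hft : f⁻¹ t ∈ Ioo (0:ℝ) 1 := (hsup.inv.mem_iff t).2 ht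
        have hlt := h.lt _ hft
        rw [apply_inv_perm] at hlt
        set x := min (f⁻¹ t) (sa / 2) with hx
        have hx0 : x ∈ Ioo (0:ℝ) 1 := ⟨lt_min hft.1 (by linarith), (min_le_left _ _).trans_lt hft.2⟩
        refine ⟨x, ⟨hx0.1, (min_le_left _ _).trans_lt hlt⟩, ?_⟩
        rw [hZl θ x (min_le_right _ _)]
        refine ⟨((hsup.mem_iff x).2 hx0).1, ?_⟩
        have := hsup.strictMonoOn.monotoneOn hx0 hft (min_le_left _ _)
        rwa [apply_inv_perm] at this)
      (fun t ht => by
        set x := max t (1 - sb / 4) with hx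
        have hx0 : x ∈ Ioo (0:ℝ) 1 := ⟨ht.1.trans_le (le_max_left _ _), max_lt ht.2 (by linarith)⟩
        set y := (x + 1) / 2 with hy
        have hy0 : y ∈ Ioo (0:ℝ) 1 := ⟨by linarith [hx0.1], by linarith [hx0.2]⟩
        have htx : t ≤ x := le_max_left _ _
        have hsx : 1 - sb / 4 ≤ x := le_max_right _ _
        refine ⟨y, ⟨by linarith [hx0.2], hy0.2⟩, ?_⟩
        rw [hZr θ y (by linarith [hx0.2])]
        exact ⟨by linarith [h.lt y hy0, hx0.2], ((hsup.mem_iff y).2 hy0).2⟩)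
    exact ⟨g, fun _ => ⟨hg, hgG⟩⟩
  choose g hg using hex
  have hgi : ∀ θ ∈ Icc (0:ℝ) 1, ∀ x ∈ Ioo (0:ℝ) 1, g θ x = x + modelZ r η sa sb f θ x :=
    fun θ hθ => (hg θ hθ).2
  have m0 : (0:ℝ) ∈ Icc (0:ℝ) 1 := by norm_num
  have m1 : (1:ℝ) ∈ Icc (0:ℝ) 1 := by norm_num
  refine ⟨g, ⟨fun θ hθ => (hg θ hθ).1, fun θ hθ x hx j hj => ?_, fun θ hθ x hx => ?_,
    fun θ hθ x hx => ?_, fun θ hθ x hx => ?_, fun x hx => ?_, fun x hx => ?_, fun θ hθ x hx => ?_,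
    fun θ hθ x hx => ?_, fun x hx => ?_, fun θ hθ x hx => ?_, ?_⟩⟩
  · have e : (fun x => g θ x - x) =ᶠ[𝓝 x] modelZ r η sa sb f θ := by
      filter_upwards [Ioo_mem_nhds hx.1 hx.2] with y hy
      rw [hgi θ hθ y hy]; ring
    rw [e.iteratedDeriv_eq]; exact hC η sa sb f h θ hθ x hx j hj
  · rw [hgi θ ⟨hθ.1, hθ.2.le⟩ x hx]; linarith [h.modelZ_pos hθ hx]
  · rw [hgi θ hθ x ⟨hx.1, by linarith [hx.2]⟩, hZl θ x hx.2]
  · rw [hgi θ hθ x ⟨by linarith [hx.1], hx.2⟩, hZr θ x hx.1]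
  · rw [hgi 0 m0 x ⟨hx.1, by linarith [hx.2]⟩, h.modelZ_left hx.2.le]
    have e1 := h.left 0 (by omega) x hx
    rw [iteratedDeriv_zero] at e1
    have e2 : η / 8 * sa ^ (r + 1) ≤ η * sa ^ r := by
      rw [pow_succ]; nlinarith [mul_pos hη (pow_pos a0 r)]
    have e3 := @ramp_nonneg (sa / 2) (3 * sa / 4) x
    nlinarith [(abs_le.1 e1).2]
  · rw [hgi 0 m0 x ⟨by linarith [hx.1], hx.2⟩, h.modelZ_right hx.1.le]
    have e1 := h.right 0 (by omega) x hx
    rw [iteratedDeriv_zero] at e1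
    have e2 : η / 8 * sb ^ (r + 1) ≤ η * sb ^ r := by
      rw [pow_succ]; nlinarith [mul_pos hη (pow_pos b0 r)]
    have e3 := @ramp_le_one (1 - 3 * sb / 4) (1 - sb / 2) x
    nlinarith [(abs_le.1 e1).2]
  · rw [hgi θ hθ x ⟨by linarith [hx.1], by linarith [hx.2]⟩, h.modelZ_mid hx.1 (by linarith [hx.2]),
      modelY_left hx.2]
  · rw [hgi θ hθ x ⟨by linarith [hx.1], by linarith [hx.2]⟩,
      h.modelZ_mid (by linarith [hx.1]) (by linarith [hx.2]),
      modelY_mid ⟨by linarith [hx.1], hx.2⟩, bump_right hx.1]; ring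
  · rw [hgi 0 m0 x ⟨by linarith [hx.1], by linarith [hx.2]⟩, h.modelZ_mid hx.1 hx.2]
    have hm : 0 ≤ min sa sb := (lt_min a0 b0).le
    have := modelY_zero_ge (r := r) (sa := sa) (sb := sb) (x := x) hη.le (m := (min sa sb) ^ r)
      (pow_le_one₀ hm ((min_le_left _ _).trans (by linarith)))
      (pow_le_pow_left₀ hm (min_le_left _ _) r) (pow_le_pow_left₀ hm (min_le_right _ _) r)
    linarith
  · rw [hgi θ hθ x hx, hgi 0 m0 x hx, h.modelZ_theta]; ring
  · rw [hgi 1 m1 (2/5) (by norm_num), h.modelZ_mid (by linarith) (by linarith),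
      modelY_mid (by norm_num), bump_mid]; ring

theorem IooDiff.iterate_mem {f : Equiv.Perm ℝ} (hf : IooDiff f) {x : ℝ} (hx : x ∈ Ioo (0:ℝ) 1)
    (n : ℕ) : f^[n] x ∈ Ioo (0:ℝ) 1 := by
  induction n with
  | zero => exact hx
  | succ n ih => rw [Function.iterate_succ_apply']; exact (hf.mem_iff _).2 ih

namespace CLData
variable {r : ℕ} {η sa sb : ℝ} {f : Equiv.Perm ℝ}

theorem disp_left (h : CLData r η sa sb f) {x : ℝ} (hx : x ∈ Ioo 0 sa) :
    f x ≤ x + η / 8 * sa ^ (r + 1) := by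
  have := h.left 0 (by omega) x hx
  rw [iteratedDeriv_zero] at this
  linarith [(abs_le.1 this).2]

theorem disp_right (h : CLData r η sa sb f) {x : ℝ} (hx : x ∈ Ioo (1 - sb) 1) :
    f x ≤ x + η / 8 * sb ^ (r + 1) := by
  have := h.right 0 (by omega) x hx
  rw [iteratedDeriv_zero] at this
  linarith [(abs_le.1 this).2]

theorem disp_before_right (h : CLData r η sa sb f) {x : ℝ} (hx : x ∈ Ioo (0:ℝ) 1)
    (hx' : x ≤ 1 - 9 / 10 * sb) : f x ≤ 1 - 9 / 10 * sb + η / 8 * sb ^ (r + 1) := by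
  have b0 := h.sb_pos; have b1 := h.sb_le
  exact (h.diff.strictMonoOn.monotoneOn hx ⟨by linarith, by linarith⟩ hx').trans
    (h.disp_right ⟨by linarith, by linarith⟩)

end CLData

/-- The explicit model is eventually ahead of the original map. -/
theorem Model.eventually_le {r : ℕ} {C η sa sb : ℝ} {f : Equiv.Perm ℝ} {g : ℝ → Equiv.Perm ℝ}
    (hm : Model r C η sa sb f g) (h : CLData r η sa sb f) {e₀ : ℝ} (he : e₀ ∈ Ioc 0 (4 / 5 * sa)) :
    ∃ n₁ : ℕ, ∀ n ≥ n₁, f^[n] e₀ ≤ (g 0)^[n] (4 / 5 * sa) := by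
  have hη := h.pos; have hη1 := h.le_one
  have a1 := h.sa_le; have b1 := h.sb_le; have a0 := h.sa_pos; have b0 := h.sb_pos
  have h2 := h.two_le
  have m0 : (0:ℝ) ∈ Icc (0:ℝ) 1 := by norm_num
  have m0' : (0:ℝ) ∈ Ico (0:ℝ) 1 := by norm_num
  have hg := hm.diff 0 m0
  set a : ℕ → ℝ := fun n => (g 0)^[n] (4 / 5 * sa) with ha
  set e : ℕ → ℝ := fun n => f^[n] e₀ with hee
  have ham : ∀ n, a n ∈ Ioo (0:ℝ) 1 := fun n => hg.iterate_mem ⟨by linarith, by linarith⟩ n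
  have hem : ∀ n, e n ∈ Ioo (0:ℝ) 1 := fun n =>
    h.diff.iterate_mem ⟨he.1, by linarith [he.2]⟩ n
  have has : ∀ n, a (n + 1) = g 0 (a n) := fun n => Function.iterate_succ_apply' _ _ _
  have hes : ∀ n, e (n + 1) = f (e n) := fun n => Function.iterate_succ_apply' _ _ _
  have hamono : Monotone a := monotone_nat_of_le_succ fun n => by
    rw [has]; exact (hm.lt 0 m0' _ (ham n)).le
  set m := min sa sb with hmdef
  have hmpos : 0 < m := lt_min a0 b0
  set v := η * m ^ r with hv
  have hvpos : 0 < v := by positivity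
  have hmr : m ^ r ≤ m := by
    have hle : m ≤ 1 := (min_le_left _ _).trans (by linarith)
    calc m ^ r ≤ m ^ 1 := pow_le_pow_of_le_one hmpos.le hle (by omega)
      _ = m := pow_one m
  have hv1 : v ≤ 1 / 10 := by
    have : m ≤ 1 / 10 := (min_le_left _ _).trans a1
    nlinarith [pow_pos hmpos r]
  set n₀ := ⌈1 / v⌉₊ with hn₀
  have hn1 : 1 ≤ n₀ * v := by rw [← div_le_iff₀ hvpos]; exact Nat.le_ceil _
  have hn2 : n₀ * v ≤ 1 + v := by
    have := (Nat.ceil_lt_add_one (show 0 ≤ 1 / v by positivity)).le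
    calc n₀ * v ≤ (1 / v + 1) * v := mul_le_mul_of_nonneg_right this hvpos.le
      _ = 1 + v := by field_simp
  have han0 : 1 - 3 * sb / 4 ≤ a n₀ := by
    by_contra! hcon
    have : ∀ k ≤ n₀, k * v ≤ a k := by
      intro k
      induction k with
      | zero => intro _; simpa using (ham 0).1.le
      | succ k ih =>
        intro hk
        have h1 := ih (by omega)
        have h3 : a k ≤ a n₀ := hamono (by omega)
        have h4 : 3 * sa / 4 ≤ a k := by
          have : a 0 ≤ a k := hamono (Nat.zero_le _)
          have e0 : a 0 = 4 / 5 * sa := rfl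
          linarith
        have := hm.fast (a k) ⟨h4, by linarith⟩
        rw [has]; push_cast; linarith
    have := this n₀ le_rfl
    linarith [(ham n₀).2]
  have hen0 : e n₀ ≤ 1 - 3 * sb / 4 := by
    rcases le_total sa sb with hab | hab
    · have hms : m = sa := min_eq_left hab
      have hw : η / 8 * sa ^ (r + 1) = sa / 8 * v := by rw [hv, hms]; ring
      have key : ∀ k ≤ n₀, e k ≤ 4 / 5 * sa + k * (sa / 8 * v) := by
        intro k
        induction k with
        | zero =>
          intro _
          have : e 0 = e₀ := rfl
          push_cast; linarith [he.2]
        | succ k ih =>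
          intro hk
          have h1 := ih (by omega)
          have hkn : (k:ℝ) ≤ n₀ := by exact_mod_cast (by omega : k ≤ n₀)
          have h3 : k * (sa / 8 * v) ≤ sa / 8 * (11 / 10) := by
            have : k * v ≤ 11 / 10 := by linarith [mul_le_mul_of_nonneg_right hkn hvpos.le]
            calc k * (sa / 8 * v) = sa / 8 * (k * v) := by ring
              _ ≤ _ := by gcongr
          have := h.disp_left (x := e k) ⟨(hem k).1, by linarith⟩
          rw [hw] at this
          rw [hes]; push_cast; linarith
      have h1 := key n₀ le_rfl
      have h3 : n₀ * (sa / 8 * v) ≤ sa / 8 * (11 / 10) := by nlinarith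
      linarith
    · have hms : m = sb := min_eq_right hab
      have hw : η / 8 * sb ^ (r + 1) = sb / 8 * v := by rw [hv, hms]; ring
      have key : ∀ k ≤ n₀, e k ≤ 1 - 9 / 10 * sb + (k + 1) * (sb / 8 * v) := by
        intro k
        induction k with
        | zero =>
          intro _
          have : e 0 = e₀ := rfl
          have : 0 < sb / 8 * v := by positivity
          push_cast; linarith [he.2]
        | succ k ih =>
          intro hk
          have h1 := ih (by omega)
          have hp : 0 < sb / 8 * v := by positivity
          rw [hes]; push_cast
          rcases le_total (e k) (1 - 9 / 10 * sb) with h4 | h4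
          · have := h.disp_before_right (hem k) h4
            rw [hw] at this
            have hk0 : (0:ℝ) ≤ k := Nat.cast_nonneg k
            nlinarith
          · have := h.disp_right (x := e k) ⟨by linarith, (hem k).2⟩
            rw [hw] at this
            linarith
      have h1 := key n₀ le_rfl
      have h3 : (n₀ + 1) * (sb / 8 * v) ≤ sb / 8 * (12 / 10) := by nlinarith
      linarith
  refine ⟨n₀, fun n hn => ?_⟩
  induction n, hn using Nat.le_induction with
  | base => exact hen0.trans han0
  | succ n hn ih =>
    change e n ≤ a n at ih
    change e (n + 1) ≤ a (n + 1)
    have h3 : a n₀ ≤ a n := hamono hn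
    rcases le_total (e n) (1 - 9 / 10 * sb) with h4 | h4
    · have h5 := h.disp_before_right (hem n) h4
      have h6 : η / 8 * sb ^ (r + 1) ≤ sb / 8 := by
        have := pow_le_one₀ (n := r) b0.le (by linarith)
        rw [pow_succ]
        have : η * sb ^ r ≤ 1 := mul_le_one₀ hη1 (pow_pos b0 r).le this
        nlinarith
      have : a n ≤ a (n + 1) := hamono (Nat.le_succ n)
      rw [hes]; linarith
    · rw [hes, has]
      exact (hm.ge_right _ ⟨by linarith, (hem n).2⟩).trans
        (hg.strictMonoOn.monotoneOn (hem n) (ham n) ih)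

theorem exists_logD_bound (n : ℕ) : ∃ C ≥ (1:ℝ), ∀ (g : ℝ → ℝ) (x κ : ℝ), ContDiffAt ℝ ∞ g x →
    κ ≤ 1 / 2 → (∀ j, 1 ≤ j → j ≤ n + 1 → |iteratedDeriv j (fun x => g x - x) x| ≤ κ) →
    1 / 2 ≤ deriv g x ∧ ∀ j, 1 ≤ j → j ≤ n → |iteratedDeriv j (logD g) x| ≤ C * κ := by
  obtain ⟨C, hC1, hC⟩ := iteratedDeriv_log_bound n (1/2) (1/2) (by norm_num)
  refine ⟨C, hC1, fun g x κ hg hκ hb => ?_⟩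
  have hd : deriv (fun x => g x - x) =ᶠ[𝓝 x] fun x => deriv g x - 1 := by
    filter_upwards [hg.eventually_differentiableAt] with z hz
    rw [deriv_fun_sub hz differentiableAt_fun_id, deriv_id'']
  have hlow : 1 / 2 ≤ deriv g x := by
    have := hb 1 le_rfl (by omega)
    rw [iteratedDeriv_one, hd.self_of_nhds, abs_le] at this
    linarith
  refine ⟨hlow, hC (deriv g) x κ hg.deriv_infty hlow (fun i h1 h2 => ?_) hκ⟩
  have := hb (i + 1) (by omega) (by omega)
  rw [iteratedDeriv_succ', (hd.iteratedDeriv_eq i), iteratedDeriv_fun_sub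
    (hg.deriv_infty.of_infty i) (by fun_prop), iteratedDeriv_const, if_neg (by omega), sub_zero] at this
  exact this

section
variable {r : ℕ} {C η sa sb : ℝ} {f : Equiv.Perm ℝ} {g : ℝ → Equiv.Perm ℝ}

theorem CLData.sa_pow_le (h : CLData r η sa sb f) : sa ^ r ≤ sa := by
  have a1 := h.sa_le; have a0 := h.sa_pos
  calc sa ^ r ≤ sa ^ 1 := pow_le_pow_of_le_one a0.le (by linarith) (by have := h.two_le; omega)
    _ = sa := pow_one sa

theorem Model.exists_param (hm : Model r C η sa sb f g) (h : CLData r η sa sb f) {θ : ℝ}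
    (hθ : θ ∈ Ico (0:ℝ) 1) : ∃ F, IsParam (g θ) η F ∧
      ∀ y ∈ Icc 0 η, F =ᶠ[𝓝 y] fun y => 4 / 5 * sa + sa ^ r * y := by
  have hη := h.pos; have hη1 := h.le_one
  have a1 := h.sa_le; have a0 := h.sa_pos; have ar := h.sa_pow_le
  have ap : 0 < sa ^ r := pow_pos a0 r
  have hθ' : θ ∈ Icc (0:ℝ) 1 := ⟨hθ.1, hθ.2.le⟩
  have := exists_isParam (hm.diff θ hθ') (hm.lt θ hθ) (η := η) (y₀ := 0) (δ := 1/20)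
    (G := fun y => 4 / 5 * sa + sa ^ r * y) hη (by norm_num) (by fun_prop) (fun y => ?_)
    (fun y hy => ?_) (fun y hy => ?_)
  · simpa using this
  · rw [deriv_const_add, deriv_const_mul_field, deriv_id'', mul_one]; exact ap
  · simp only [zero_sub, zero_add] at hy
    constructor <;> nlinarith [hy.1, hy.2]
  · simp only [zero_sub, zero_add] at hy
    rw [hm.slow θ hθ' _ ⟨by nlinarith [hy.1, hy.2], by nlinarith [hy.1, hy.2]⟩]
    ring

end

/-- Bounds for the parametrizations of the model maps, in terms of the bounds in one window. -/
theorem exists_model_paramHyp (r : ℕ) (C B : ℝ) : ∃ A, ∀ η sa sb f g, CLData r η sa sb f →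
    Model r C η sa sb f g → C * η ≤ 1 / 2 → ∀ θ ∈ Ico (0:ℝ) 1, ∀ F y₀, IsParam (g θ) η F →
    (∀ j, 1 ≤ j → j ≤ r - 1 → ∀ y ∈ Icc y₀ (y₀ + η), |iteratedDeriv j (logD F) y| ≤ B) →
    ParamHyp (r - 1) A B (g θ) η F y₀ := by
  obtain ⟨C', hC1, hC'⟩ := exists_logD_bound (r - 1)
  refine ⟨max C (C' * C), fun η sa sb f g h hm hCη θ hθ F y₀ hF hB => ?_⟩
  have hη := h.pos
  have h2 := h.two_le
  have hθ' : θ ∈ Icc (0:ℝ) 1 := ⟨hθ.1, hθ.2.le⟩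
  refine ⟨hm.diff θ hθ', hF, h.pos, h.le_one, fun x hx => ?_, fun j h1 hj x hx => ?_, hB⟩
  · have := hm.bound θ hθ' x hx 0 (by omega)
    rw [iteratedDeriv_zero] at this
    have := (abs_le.1 this).2
    nlinarith [le_max_left C (C' * C)]
  · have := (hC' (g θ) x (C * η) ((hm.diff θ hθ').smooth x hx) hCη
      (fun j _ h2 => hm.bound θ hθ' x hx j (by omega))).2 j h1 hj
    nlinarith [le_max_right C (C' * C)]

/-- The derivatives of the logarithmic derivative are bounded on `(0, 1)`. -/
def LogDBounded (f : ℝ → ℝ) : Prop :=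
  ∀ j : ℕ, ∃ M : ℝ, ∀ x ∈ Ioo (0:ℝ) 1, |iteratedDeriv j (logD f) x| ≤ M

/-- The maps `log D(fⁿ)` have sublinear variation on `(0, 1)`. -/
def SublinVar (f : ℝ → ℝ) : Prop :=
  ∃ V : ℕ → ℝ, (∀ n, eVariationOn (logD f^[n]) (Ioo 0 1) ≤ ENNReal.ofReal (V n)) ∧
    Tendsto (fun n => V n / n) atTop (𝓝 0)

theorem exists_uniform_bound {P : ℕ → ℝ → Prop} (hP : ∀ j a b, a ≤ b → P j a → P j b)
    (h : ∀ j, ∃ M, P j M) (K : ℕ) : ∃ M, ∀ j ≤ K, P j M := by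
  choose M hM using h
  refine ⟨∑ j ∈ Finset.range (K + 1), |M j|, fun j hj => hP j (M j) _ ?_ (hM j)⟩
  exact (le_abs_self _).trans (Finset.single_le_sum (f := fun j => |M j|)
    (fun _ _ => abs_nonneg _) (Finset.mem_range.2 (by omega)))

theorem IsParam.exists_bound {f : Equiv.Perm ℝ} {η : ℝ} {E : ℝ → ℝ} (hf : IooDiff f)
    (hE : IsParam f η E) (hη : 0 < η) (hη1 : η ≤ 1) (hb : LogDBounded f) (K : ℕ) :
    ∃ M, ∀ j, 1 ≤ j → j ≤ K → ∀ y, |iteratedDeriv j (logD E) y| ≤ M := by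
  obtain ⟨M, hM⟩ := exists_uniform_bound
    (P := fun j M => ∀ x ∈ Ioo (0:ℝ) 1, |iteratedDeriv j (logD f) x| ≤ M)
    (fun j a b hab h x hx => (h x hx).trans hab) hb K
  obtain ⟨B, hB⟩ := exists_uniform_bound
    (P := fun j M => ∀ y ∈ Icc (0:ℝ) (0 + η), |iteratedDeriv j (logD E) y| ≤ M)
    (fun j a b hab h x hx => (h x hx).trans hab) (fun j => by
      obtain ⟨C, hC⟩ := (isCompact_Icc (a := (0:ℝ)) (b := 0 + η)).exists_bound_of_continuousOn
        (hE.contDiff_logD.continuous_iteratedDeriv j (by exact_mod_cast le_top)).continuousOn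
      exact ⟨C, hC⟩) K
  obtain ⟨C, hC⟩ := exists_param_bound K (max 1 M / η) B
  have e : max 1 M / η * η = max 1 M := div_mul_cancel₀ _ hη.ne'
  refine ⟨C, hC f η E 0 ⟨hf, hE, hη, hη1, fun x hx => ?_, fun j _ h2 x hx => ?_,
    fun j _ h2 => hB j h2⟩⟩
  · rw [e]
    have := ((hf.mem_iff x).2 hx).2
    linarith [le_max_left 1 M, hx.1]
  · rw [e]; exact (hM j h2 x hx).trans (le_max_right _ _)

theorem IsParam.logD_iterate {f : Equiv.Perm ℝ} {η : ℝ} {E : ℝ → ℝ} (hf : IooDiff f)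
    (hE : IsParam f η E) (n : ℕ) (y : ℝ) : logD f^[n] (E y) = logD E (y + n * η) - logD E y := by
  have hd : ∀ n : ℕ, IooDiff (f ^ n) := fun n => by
    have := hf.zpow n
    rwa [zpow_natCast] at this
  have e : f^[n] = ⇑(f ^ n) := (Equiv.Perm.coe_pow f n).symm
  rw [e, eq_sub_iff_add_eq, ← logD_comp ((hd n).differentiableAt (hE.mem y)) (hE.differentiableAt y)
    ((hd n).deriv_pos _ (hE.mem y)) (hE.deriv_pos y)]
  have : (⇑(f ^ n) ∘ E) = fun y => E (y + n * η) := by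
    funext z; rw [hE.equi_pow, e]; rfl
  rw [this, logD, logD, deriv_comp_add_const]

theorem exists_small_window {f : Equiv.Perm ℝ} {η : ℝ} {E : ℝ → ℝ} (hf : IooDiff f)
    (hE : IsParam f η E) (hη : 0 < η) (hη1 : η ≤ 1) (hb : LogDBounded f) (hv : SublinVar f)
    (K N₀ : ℕ) {ε : ℝ} (hε : 0 < ε) : ∃ N ≥ N₀, ∃ i < N,
      ∀ j, 1 ≤ j → j ≤ K → ∀ y ∈ Icc ((i - 2 * N : ℝ) * η) ((i - 2 * N : ℝ) * η + η),
        |iteratedDeriv j (logD E) (y + (3 * N : ℕ) * η) - iteratedDeriv j (logD E) y| ≤ ε := by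
  obtain ⟨M, hM⟩ := hE.exists_bound hf hη hη1 hb (K + 1)
  have hM0 : 0 ≤ M := (abs_nonneg _).trans (hM 1 le_rfl (by omega) 0)
  obtain ⟨δ, hδ, H⟩ := iteratedDeriv_small_of_osc_small K (2 * M) η ε (by positivity) hη hε
  obtain ⟨V, hV, hVt⟩ := hv
  have hev : ∀ᶠ n : ℕ in atTop, V n / n < δ / 3 := hVt.eventually_lt_const (by positivity)
  obtain ⟨n₁, hn₁⟩ := eventually_atTop.1 hev
  set N := max (max N₀ n₁) 1 with hN
  have hN1 : 1 ≤ N := le_max_right _ _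
  have hNn : n₁ ≤ N := (le_max_right _ _).trans (le_max_left _ _)
  have hN0 : N₀ ≤ N := (le_max_left _ _).trans (le_max_left _ _)
  have hNR : (1:ℝ) ≤ N := by exact_mod_cast hN1
  have hVN : V (3 * N) < N * δ := by
    have := hn₁ (3 * N) (by omega)
    push_cast at this
    rw [div_lt_iff₀ (by positivity)] at this
    linarith
  set ψ : ℝ → ℝ := fun y => logD E (y + (3 * N : ℕ) * η) - logD E y with hψ
  have hψe : ψ = logD f^[3 * N] ∘ E := by
    funext y; rw [Function.comp_apply, hE.logD_iterate hf]
  have hψs : ContDiff ℝ ∞ ψ := by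
    have := hE.contDiff_logD
    fun_prop
  have hψd : ∀ j y, iteratedDeriv j ψ y =
      iteratedDeriv j (logD E) (y + (3 * N : ℕ) * η) - iteratedDeriv j (logD E) y := fun j y => by
    have h1 := hE.contDiff_logD.contDiffAt.of_infty (x := y) j
    have h2 := hE.contDiff_logD.contDiffAt.of_infty (x := y + (3 * N : ℕ) * η) j
    rw [hψ, iteratedDeriv_fun_sub (by fun_prop) h1, iteratedDeriv_comp_add_const]
  set u : ℕ → ℝ := fun i => (i - 2 * N : ℝ) * η with hu
  have hus : ∀ i, u (i + 1) = u i + η := fun i => by simp only [hu]; push_cast; ring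
  have hum : Monotone u := monotone_nat_of_le_succ fun i => by rw [hus]; linarith
  obtain ⟨i, hi, hosc⟩ : ∃ i < N, ∀ x ∈ Icc (u i) (u i + η), ∀ y ∈ Icc (u i) (u i + η),
      |ψ x - ψ y| ≤ δ := by
    by_contra! hcon
    have h1 : ∀ i < N, ENNReal.ofReal δ ≤ eVariationOn ψ (Icc (u i) (u (i + 1))) := by
      intro i hi
      obtain ⟨x, hx, y, hy, hxy⟩ := hcon i hi
      rw [hus]
      refine le_trans ?_ (eVariationOn.edist_le ψ hx hy)
      rw [edist_dist, Real.dist_eq]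
      exact ENNReal.ofReal_le_ofReal hxy.le
    have h2 : ∑ i ∈ Finset.range N, eVariationOn ψ (Icc (u i) (u (i + 1))) ≤
        eVariationOn (logD f^[3 * N]) (Ioo 0 1) := by
      have := eVariationOn.sum (f := ψ) (s := univ) (n := N) hum (fun _ _ _ => mem_univ _)
      simp only [univ_inter] at this
      rw [this, hψe]
      exact eVariationOn.comp_le_of_monotoneOn _ _ (hE.strictMono.monotone.monotoneOn _)
        (fun y _ => hE.mem y)
    have h3 : ∑ i ∈ Finset.range N, ENNReal.ofReal δ ≤
        ∑ i ∈ Finset.range N, eVariationOn ψ (Icc (u i) (u (i + 1))) :=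
      Finset.sum_le_sum fun i hi => h1 i (Finset.mem_range.1 hi)
    have h4 := h3.trans (h2.trans (hV (3 * N)))
    rw [Finset.sum_const, Finset.card_range, nsmul_eq_mul, ← ENNReal.ofReal_natCast,
      ← ENNReal.ofReal_mul (by positivity)] at h4
    by_cases hV0 : 0 ≤ V (3 * N)
    · exact absurd ((ENNReal.ofReal_le_ofReal_iff hV0).1 h4) (not_le.2 hVN)
    · rw [ENNReal.ofReal_of_nonpos (not_le.1 hV0).le, nonpos_iff_eq_zero,
        ENNReal.ofReal_eq_zero] at h4
      have : 0 < N * δ := by positivity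
      linarith
  refine ⟨N, hN0, i, hi, fun j h1 h2 y hy => ?_⟩
  rw [← hψd]
  refine H ψ (u i) hψs (fun k hk1 hk2 x _ => ?_) hosc j h1 h2 y hy
  rw [hψd]
  have := abs_sub (iteratedDeriv k (logD E) (x + (3 * N : ℕ) * η)) (iteratedDeriv k (logD E) x)
  linarith [hM k hk1 hk2 x, hM k hk1 hk2 (x + (3 * N : ℕ) * η)]

section
variable {r : ℕ} {C η sa sb : ℝ} {f : Equiv.Perm ℝ} {g : ℝ → Equiv.Perm ℝ}

theorem Model.exists_param_map (hm : Model r C η sa sb f g) (h : CLData r η sa sb f) {F : ℝ → ℝ}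
    (hF : IsParam (g 0) η F) (hF0 : F 0 = 4 / 5 * sa) : ∃ E, IsParam f η E ∧
      ∃ k : ℕ, (∀ y ≤ -(k * η) + η, E y = F y) ∧ E 0 ≤ 4 / 5 * sa := by
  have hη := h.pos
  have a1 := h.sa_le; have a0 := h.sa_pos
  have m0 : (0:ℝ) ∈ Icc (0:ℝ) 1 := by norm_num
  obtain ⟨Y, hY⟩ := eventually_atBot.1
    (hF.tendsto_atBot.eventually_lt_const (show (0:ℝ) < sa / 2 by positivity))
  obtain ⟨k, hk⟩ := exists_nat_ge ((η - Y) / η)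
  rw [div_le_iff₀ hη] at hk
  have hgf : ∀ y, F y < sa / 2 → g 0 (F y) = f (F y) := fun y hy =>
    hm.eq_left 0 m0 _ ⟨(hF.mem y).1, hy.le⟩
  obtain ⟨E, hE, hEF⟩ := exists_isParam h.diff h.lt (y₀ := -(k * η)) (δ := η) hη hη hF.smooth
    hF.deriv_pos (fun y _ => hF.mem y) (fun y hy => by
      rw [hF.equi, hgf y (hY y (by linarith [hy.2]))])
  have hEF' : ∀ y ≤ -(k * η) + η, E y = F y := by
    refine hE.eq_of_le hη hF (fun y hy => (hEF y hy).self_of_nhds) fun y hy => ?_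
    have e0 : E (-(k * η)) = F (-(k * η)) := (hEF _ ⟨le_rfl, by linarith⟩).self_of_nhds
    have h1 := hE.strictMono hy
    have h2 := hY (-(k * η)) (by linarith)
    exact (hm.eq_left 0 m0 _ ⟨(hE.mem y).1, by linarith⟩).symm
  refine ⟨E, hE, k, hEF', ?_⟩
  have key : ∀ n ≤ k, E (-(k * η) + n * η) ≤ F (-(k * η) + n * η) := by
    intro n
    induction n with
    | zero => intro _; rw [hEF' _ (by push_cast; linarith)]
    | succ n ih =>
      intro hn
      have e : -(k * η) + ((n + 1 : ℕ) : ℝ) * η = -(k * η) + n * η + η := by push_cast; ring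
      have hnk : (n:ℝ) ≤ k := by exact_mod_cast (by omega : n ≤ k)
      have hle : F (-(k * η) + n * η) ≤ F 0 :=
        hF.strictMono.monotone (by nlinarith)
      rw [e, hE.equi, hF.equi]
      refine (h.diff.strictMonoOn.monotoneOn (hE.mem _) (hF.mem _) (ih (by omega))).trans ?_
      exact hm.ge_left _ ⟨(hF.mem _).1, by rw [hF0] at hle; linarith⟩
  have := key k le_rfl
  rwa [neg_add_cancel, hF0] at this

end

theorem exists_param_deriv_bound (K : ℕ) (hK : 1 ≤ K) (A B : ℝ) : ∃ C, ∀ g η F y₀,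
    ParamHyp K A B g η F y₀ → ∀ y, (∀ j, 1 ≤ j → j ≤ K → |iteratedDeriv j (logD F) y| ≤ C) ∧
      ∀ j, 1 ≤ j → j ≤ K + 1 → |iteratedDeriv j F y| ≤ C := by
  obtain ⟨C₁, h₁⟩ := exists_param_bound K A B
  obtain ⟨C₂, hC₂, h₂⟩ := iteratedDeriv_exp_bound K C₁
  refine ⟨max C₁ (C₂ * (A * Real.exp (A + B))), fun g η F y₀ h y =>
    ⟨fun j hj hjK => (h₁ g η F y₀ h j hj hjK y).trans (le_max_left _ _), fun j hj hjK => ?_⟩⟩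
  obtain ⟨i, rfl⟩ : ∃ i, j = i + 1 := ⟨j - 1, by omega⟩
  have e : deriv F = fun y => Real.exp (logD F y) := funext fun y => (h.param.exp_logD y).symm
  rw [iteratedDeriv_succ', e]
  refine (h₂ (logD F) y h.param.contDiff_logD.contDiffAt
    (fun j hj hjK => h₁ g η F y₀ h j hj hjK y) i (by omega)).trans ?_
  refine le_trans ?_ (le_max_right _ _)
  rw [h.param.exp_logD]
  exact mul_le_mul_of_nonneg_left (h.deriv_le hK y) (by linarith)

/-- Two parametrizations of a model map, one matching `f` on the left and the other one on the
right, which are close to each other. -/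
structure Matching (r : ℕ) (C η : ℝ) (f g : Equiv.Perm ℝ) (F E R : ℝ → ℝ) : Prop where
  paramF : IsParam g η F
  paramE : IsParam f η E
  paramR : IsParam g η R
  left : ∃ t, ∀ y ≤ t, E y = F y
  right : ∃ t, ∀ y, t ≤ y → R y = E y
  boundF : ∀ y, ∀ j, 1 ≤ j → j ≤ r → |iteratedDeriv j F y| ≤ C
  bound_sub : ∀ y, ∀ j, 1 ≤ j → j ≤ r → |iteratedDeriv j (fun y => R y - F y) y| ≤ C
  sub_le : ∀ y, |R y - F y| ≤ C * η ^ 2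
  deriv_sub_le : ∀ y, |deriv (fun y => R y - F y) y| ≤ C * η
  logD_le : ∀ y, |deriv (logD F) y| ≤ C

theorem small_of_zeros {D : ℝ → ℝ} {C η t : ℝ} (hη : 0 < η) (hD : ContDiff ℝ ∞ D)
    (h0 : ∀ n : ℤ, D (t + n * η) = 0) (h2 : ∀ y, |iteratedDeriv 2 D y| ≤ C) (y : ℝ) :
    |deriv D y| ≤ C * η ∧ |D y| ≤ C * η ^ 2 := by
  have hC : 0 ≤ C := (abs_nonneg _).trans (h2 0)
  have hd : Differentiable ℝ D := hD.differentiable (by simp)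
  have hd2 : Differentiable ℝ (deriv D) := by
    have := (contDiff_infty_iff_deriv.1 hD).2
    exact this.differentiable (by simp)
  have h1 : ∀ y, |deriv D y| ≤ C * η := by
    intro y
    obtain ⟨n, hn⟩ := IsParam.exists_int_window hη t y
    obtain ⟨ξ, hξ, hξ0⟩ := exists_deriv_eq_zero (f := D)
      (show t + n * η < t + (n + 1 : ℤ) * η by push_cast; linarith)
      hd.continuous.continuousOn (by rw [h0, h0])
    push_cast at hξ
    have := convex_univ.norm_image_sub_le_of_norm_deriv_le (f := deriv D) (C := C)
      (fun x _ => hd2 x) (fun x _ => by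
        have := h2 x
        rwa [iteratedDeriv_succ, iteratedDeriv_one] at this) (mem_univ ξ) (mem_univ y)
    rw [hξ0, sub_zero, Real.norm_eq_abs, Real.norm_eq_abs] at this
    refine this.trans (mul_le_mul_of_nonneg_left ?_ hC)
    rw [abs_le]
    constructor <;> linarith [hn.1, hn.2, hξ.1, hξ.2]
  refine ⟨h1 y, ?_⟩
  obtain ⟨n, hn⟩ := IsParam.exists_int_window hη t y
  have := convex_univ.norm_image_sub_le_of_norm_deriv_le (f := D) (C := C * η)
      (fun x _ => hd x) (fun x _ => h1 x) (mem_univ (t + n * η)) (mem_univ y)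
  rw [h0, sub_zero, Real.norm_eq_abs, Real.norm_eq_abs] at this
  refine this.trans ?_
  rw [pow_two, ← mul_assoc]
  refine mul_le_mul_of_nonneg_left ?_ (by positivity)
  rw [abs_le]
  constructor <;> linarith [hn.1, hn.2]

section
variable {r : ℕ} {C η sa sb : ℝ} {f : Equiv.Perm ℝ} {g : ℝ → Equiv.Perm ℝ}

theorem Model.iterate_continuousOn (hm : Model r C η sa sb f g) {x : ℝ} (hx : x ∈ Ioo (0:ℝ) 1)
    (n : ℕ) : ContinuousOn (fun θ => (g θ)^[n] x) (Icc 0 1) := by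
  have m0 : (0:ℝ) ∈ Icc (0:ℝ) 1 := by norm_num
  induction n with
  | zero => exact continuousOn_const
  | succ n ih =>
    have hmem : ∀ θ ∈ Icc (0:ℝ) 1, (g θ)^[n] x ∈ Ioo (0:ℝ) 1 := fun θ hθ =>
      (hm.diff θ hθ).iterate_mem hx n
    have h1 : ContinuousOn (fun θ => g 0 ((g θ)^[n] x) - η * θ * bump ((g θ)^[n] x)) (Icc 0 1) := by
      refine ContinuousOn.sub ?_ ?_
      · have hc : ContinuousOn (g 0) (Ioo 0 1) := fun z hz =>
          ((hm.diff 0 m0).smooth z hz).continuousAt.continuousWithinAt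
        exact hc.comp ih hmem
      · exact (continuousOn_const.mul continuousOn_id).mul
          (contDiff_bump.continuous.comp_continuousOn ih)
    refine h1.congr fun θ hθ => ?_
    simp only [Function.iterate_succ_apply']
    rw [hm.theta θ hθ _ (hmem θ hθ)]

theorem Model.iterate_top_le (hm : Model r C η sa sb f g) {x : ℝ} (hx : x ∈ Ioc (0:ℝ) (2/5))
    (n : ℕ) : (g 1)^[n] x ≤ 2/5 := by
  have m1 : (1:ℝ) ∈ Icc (0:ℝ) 1 := by norm_num
  induction n with
  | zero => exact hx.2
  | succ n ih =>
    rw [Function.iterate_succ_apply']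
    exact ((hm.diff 1 m1).strictMonoOn.monotoneOn
      ((hm.diff 1 m1).iterate_mem ⟨hx.1, by linarith [hx.2]⟩ n) (by norm_num) ih).trans_eq hm.top

end

theorem exists_matching (r : ℕ) (C : ℝ) : ∃ C', ∀ η sa sb f g, CLData r η sa sb f →
    Model r C η sa sb f g → C * η ≤ 1 / 2 → LogDBounded f → SublinVar f →
    ∃ θ ∈ Ico (0:ℝ) 1, ∃ F E R, Matching r C' η f (g θ) F E R := by
  by_cases hr : 2 ≤ r
  swap
  · exact ⟨0, fun η sa sb f g h => absurd h.two_le hr⟩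
  obtain ⟨A₁, hA₁⟩ := exists_model_paramHyp r C 0
  obtain ⟨C₁, hC₁⟩ := exists_param_deriv_bound (r - 1) (by omega) A₁ 0
  obtain ⟨A₂, hA₂⟩ := exists_model_paramHyp r C (C₁ + 1)
  obtain ⟨C₂, hC₂⟩ := exists_param_deriv_bound (r - 1) (by omega) A₂ (C₁ + 1)
  refine ⟨C₂ + C₁, fun η sa sb f g h hm hCη hb hv => ?_⟩
  have hη := h.pos; have hη1 := h.le_one
  have a0 := h.sa_pos; have a1 := h.sa_le; have b0 := h.sb_pos; have b1 := h.sb_le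
  have m0 : (0:ℝ) ∈ Ico (0:ℝ) 1 := by norm_num
  have hparam : ∀ θ ∈ Ico (0:ℝ) 1, ∃ F, IsParam (g θ) η F ∧
      (∀ y ∈ Icc 0 η, F y = 4 / 5 * sa + sa ^ r * y) ∧
      ParamHyp (r - 1) A₁ 0 (g θ) η F 0 := by
    intro θ hθ
    obtain ⟨F, hF, hFe⟩ := hm.exists_param h hθ
    refine ⟨F, hF, fun y hy => (hFe y hy).self_of_nhds, ?_⟩
    refine hA₁ η sa sb f g h hm hCη θ hθ F 0 hF fun j h1 hj y hy => ?_
    rw [zero_add] at hy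
    have e : logD F =ᶠ[𝓝 y] fun _ => Real.log (sa ^ r) := by
      filter_upwards [(hFe y hy).eventuallyEq_nhds] with z hz
      rw [logD, hz.deriv_eq, deriv_const_add, deriv_const_mul_field, deriv_id'', mul_one]
    rw [e.iteratedDeriv_eq, iteratedDeriv_const, if_neg (by omega), abs_zero]
  obtain ⟨F₀, hF₀, hF₀e, hF₀p⟩ := hparam 0 m0
  have hF₀0 : F₀ 0 = 4 / 5 * sa := by rw [hF₀e 0 ⟨le_rfl, hη.le⟩]; ring
  obtain ⟨E, hE, k, hEk, hE0⟩ := hm.exists_param_map h hF₀ hF₀0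
  obtain ⟨n₁, hn₁⟩ := hm.eventually_le h ⟨(hE.mem 0).1, hE0⟩
  obtain ⟨Y, hY⟩ := eventually_atTop.1 (hE.tendsto_atTop.eventually_const_lt
    (show 1 - sb / 2 < 1 by linarith))
  obtain ⟨n₂, hn₂⟩ := exists_nat_ge ((Y + η) / η)
  rw [div_le_iff₀ hη] at hn₂
  obtain ⟨N, hN, i, hi, hwin⟩ := exists_small_window h.diff hE hη hη1 hb hv (r - 1)
    (max k (max n₁ n₂)) one_pos
  have hNk : k ≤ N := (le_max_left _ _).trans hN
  have hNn₁ : n₁ ≤ N := (le_max_left _ _).trans ((le_max_right _ _).trans hN)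
  have hNn₂ : n₂ ≤ N := (le_max_right _ _).trans ((le_max_right _ _).trans hN)
  set m := i + N with hmdef
  set t := (m:ℝ) * η with ht
  have htY : Y + η ≤ t := by
    have : (n₂:ℝ) ≤ m := by exact_mod_cast (by omega : n₂ ≤ m)
    rw [ht]; nlinarith
  have hEwin : ∀ j, 1 ≤ j → j ≤ r - 1 → ∀ y ∈ Icc t (t + η), |iteratedDeriv j (logD E) y| ≤ C₁ + 1 := by
    intro j h1 hj y hy
    have hw := hwin j h1 hj (y - (3 * N : ℕ) * η) (by
      rw [ht, hmdef] at hy; push_cast at hy ⊢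
      constructor <;> linarith [hy.1, hy.2])
    rw [sub_add_cancel] at hw
    have e : E =ᶠ[𝓝 (y - (3 * N : ℕ) * η)] F₀ := by
      have hlt : y - (3 * N : ℕ) * η < -(k * η) + η := by
        rw [ht, hmdef] at hy; push_cast at hy ⊢
        have h1 : (k:ℝ) * η ≤ N * η := by gcongr
        have h2 : ((i:ℝ) + 1) * η ≤ N * η := by gcongr; exact_mod_cast hi
        linarith [hy.2]
      filter_upwards [Iio_mem_nhds hlt] with z hz using hEk z (le_of_lt hz)
    have e2 : logD E =ᶠ[𝓝 (y - (3 * N : ℕ) * η)] logD F₀ := by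
      filter_upwards [e.eventuallyEq_nhds] with z hz
      rw [logD, logD, hz.deriv_eq]
    rw [e2.iteratedDeriv_eq] at hw
    have h3 := (hC₁ _ _ _ _ hF₀p (y - (3 * N : ℕ) * η)).1 j h1 hj
    have h4 := abs_sub_abs_le_abs_sub (iteratedDeriv j (logD E) y)
      (iteratedDeriv j (logD F₀) (y - (3 * N : ℕ) * η))
    linarith
  have hx₀ : 4 / 5 * sa ∈ Ioo (0:ℝ) 1 := ⟨by linarith, by linarith⟩
  have hEt : f^[m] (E 0) = E t := by rw [ht, ← hE.equi_pow, zero_add]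
  have hEt1 : 1 - sb / 2 < E t := hY t (by linarith)
  obtain ⟨θ, hθ, hθe⟩ : ∃ θ ∈ Icc (0:ℝ) 1, (g θ)^[m] (4 / 5 * sa) = E t := by
    refine intermediate_value_Icc' zero_le_one (hm.iterate_continuousOn hx₀ m) ⟨?_, ?_⟩
    · have := hm.iterate_top_le (x := 4 / 5 * sa) ⟨hx₀.1, by linarith⟩ m
      linarith
    · rw [← hEt]; exact hn₁ m (by omega)
  have hθ1 : θ ∈ Ico (0:ℝ) 1 := by
    refine ⟨hθ.1, lt_of_le_of_ne hθ.2 ?_⟩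
    rintro rfl
    have := hm.iterate_top_le (x := 4 / 5 * sa) ⟨hx₀.1, by linarith⟩ m
    linarith
  obtain ⟨F, hF, hFe, hFp⟩ := hparam θ hθ1
  have hF0 : F 0 = 4 / 5 * sa := by rw [hFe 0 ⟨le_rfl, hη.le⟩]; ring
  have hFt : F t = E t := by
    have := hF.equi_pow m 0
    rwa [zero_add, hF0, hθe] at this
  have hFF : ∀ y ≤ 0 + η, F y = F₀ y := by
    refine hF.eq_of_le hη hF₀ (fun y hy => ?_) fun y hy => ?_
    · rw [zero_add] at hy; rw [hFe y hy, hF₀e y hy]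
    · have : F y < F 0 := hF.strictMono hy
      rw [hm.theta θ hθ _ (hF.mem y), bump_left (by linarith), mul_zero, sub_zero]
  have hgf : ∀ x, 1 - sb / 2 < x → x < 1 → g θ x = f x := fun x h1 h2 =>
    hm.eq_right θ hθ x ⟨h1.le, h2⟩
  obtain ⟨R, hR, hRE⟩ := exists_isParam (hm.diff θ hθ) (hm.lt θ hθ1) (y₀ := t) (δ := η) hη hη
    hE.smooth hE.deriv_pos (fun y _ => hE.mem y) (fun y hy => by
      rw [hE.equi, hgf _ (hY y (by linarith [hy.1])) (hE.mem y).2])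
  have hRt : R t = E t := (hRE t ⟨le_rfl, by linarith⟩).self_of_nhds
  have hRp : ParamHyp (r - 1) A₂ (C₁ + 1) (g θ) η R t := by
    refine hA₂ η sa sb f g h hm hCη θ hθ1 R t hR fun j h1 hj y hy => ?_
    have e2 : logD R =ᶠ[𝓝 y] logD E := by
      filter_upwards [(hRE y hy).eventuallyEq_nhds] with z hz
      rw [logD, logD, hz.deriv_eq]
    rw [e2.iteratedDeriv_eq]
    exact hEwin j h1 hj y hy
  have hC₂0 : 0 ≤ C₂ := (abs_nonneg _).trans ((hC₂ _ _ _ _ hRp 0).1 1 le_rfl (by omega))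
  have hC₁0 : 0 ≤ C₁ := (abs_nonneg _).trans ((hC₁ _ _ _ _ hFp 0).1 1 le_rfl (by omega))
  have hbd : ∀ y, ∀ j, 1 ≤ j → j ≤ r → |iteratedDeriv j (fun y => R y - F y) y| ≤ C₂ + C₁ := by
    intro y j h1 hj
    rw [iteratedDeriv_fun_sub (hR.smooth.contDiffAt.of_infty j) (hF.smooth.contDiffAt.of_infty j)]
    refine (abs_sub _ _).trans (add_le_add ?_ ?_)
    · exact (hC₂ _ _ _ _ hRp y).2 j h1 (by omega)
    · exact (hC₁ _ _ _ _ hFp y).2 j h1 (by omega)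
  have hzero : ∀ n : ℤ, R (t + n * η) - F (t + n * η) = 0 := fun n => by
    rw [hR.equi_zpow, hF.equi_zpow, hRt, hFt, sub_self]
  have hsmall := small_of_zeros hη (hR.smooth.sub hF.smooth) hzero
    (fun y => hbd y 2 (by omega) hr)
  refine ⟨θ, hθ1, F, E, R, hF, hE, hR, ⟨-(k * η) + η, fun y hy => ?_⟩, ⟨t, ?_⟩,
    fun y j h1 hj => ?_, hbd, fun y => (hsmall y).2, fun y => (hsmall y).1, fun y => ?_⟩
  · have : 0 ≤ (k:ℝ) * η := by positivity
    rw [hEk y hy, hFF y (by linarith)]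
  · refine hR.eq_of_ge hη hE (fun y hy => (hRE y hy).self_of_nhds) fun y hy => ?_
    have := hR.strictMono.monotone hy
    exact hgf _ (by linarith) (hR.mem y).2
  · linarith [(hC₁ _ _ _ _ hFp y).2 j h1 (by omega)]
  · have := (hC₁ _ _ _ _ hFp y).1 1 le_rfl (by omega)
    rw [iteratedDeriv_one] at this
    linarith

/-- A smooth diffeomorphism of `(0, 1)`, equal to the identity near the endpoints. -/
structure CompactDiff (φ : Equiv.Perm ℝ) : Prop where
  diff : IooDiff φ
  eq_id : ∃ σ > (0:ℝ), ∀ x, x ∉ Ioo σ (1 - σ) → φ x = x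

theorem eventuallyEq_of_comp {G H K : ℝ → ℝ} {y : ℝ} (hG : ContDiff ℝ ∞ G) (hG' : 0 < deriv G y)
    (h : ∀ᶠ z in 𝓝 y, H (G z) = K (G z)) : H =ᶠ[𝓝 (G y)] K := by
  have := (hG.contDiffAt (x := y)).hasStrictDerivAt (by simp)
  have := this.map_nhds_eq hG'.ne'
  rw [← this]
  exact h

theorem exists_perm_of_params {f : Equiv.Perm ℝ} {η : ℝ} {E G : ℝ → ℝ} (hE : IsParam f η E)
    (hG : ContDiff ℝ ∞ G) (hG' : ∀ y, 0 < deriv G y) (h1 : ∃ t, ∀ y ≤ t, E y = G y)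
    (h2 : ∃ t, ∀ y, t ≤ y → E y = G y) :
    ∃ φ : Equiv.Perm ℝ, CompactDiff φ ∧ ∀ y, φ (E y) = G y := by
  choose! Ei hEi using hE.surj
  have hEiE : ∀ y, Ei (E y) = y := fun y => hE.strictMono.injective (hEi _ (hE.mem y))
  obtain ⟨t₁, ht₁⟩ := h1
  obtain ⟨t₂, ht₂⟩ := h2
  have hcomp : ∀ y, (fun x => G (Ei x)) (E y) = G y := fun y => by simp only [hEiE]
  have hsm : ∀ x ∈ Ioo (0:ℝ) 1, ContDiffAt ℝ ∞ (fun x => G (Ei x)) x := fun x hx => by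
    obtain ⟨y, rfl⟩ := hE.surj x hx
    exact ContDiffAt.of_comp hE.smooth.contDiffAt (hE.deriv_pos y).ne' hG.contDiffAt
      (Eventually.of_forall hcomp)
  have hlow : ∀ x ∈ Ioo (0:ℝ) 1, x ≤ E t₁ → G (Ei x) = x := fun x hx h => by
    obtain ⟨y, rfl⟩ := hE.surj x hx
    rw [hEiE, ht₁ y (hE.strictMono.le_iff_le.1 h)]
  have hhigh : ∀ x ∈ Ioo (0:ℝ) 1, E t₂ ≤ x → G (Ei x) = x := fun x hx h => by
    obtain ⟨y, rfl⟩ := hE.surj x hx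
    rw [hEiE, ht₂ y (hE.strictMono.le_iff_le.1 h)]
  obtain ⟨φ, hφ, hφG, hφid⟩ := exists_perm_of_Ioo hsm (fun x hx => by
      obtain ⟨y, rfl⟩ := hE.surj x hx
      have hd := ((hsm _ hx).differentiableAt (by simp)).hasDerivAt.comp y
        (hE.differentiableAt y).hasDerivAt
      have e : (fun x => G (Ei x)) ∘ E = G := funext hcomp
      rw [e] at hd
      have := hG' y
      rw [hd.deriv] at this
      exact pos_of_mul_pos_left this (hE.deriv_pos y).le)
    (fun t ht => by
      have h3 := hE.mem t₁
      have hm : 0 < min (t / 2) (E t₁) := lt_min (by linarith [ht.1]) h3.1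
      have hm1 := min_le_left (t / 2) (E t₁)
      refine ⟨min (t / 2) (E t₁), ⟨hm, by linarith [ht.1]⟩, ?_⟩
      rw [hlow _ ⟨hm, by linarith [ht.1, ht.2]⟩ (min_le_right _ _)]
      exact ⟨hm, by linarith [ht.1]⟩)
    (fun t ht => by
      have h3 := hE.mem t₂
      have hm : max ((1 + t) / 2) (E t₂) < 1 := max_lt (by linarith [ht.2]) h3.2
      have hm1 := le_max_left ((1 + t) / 2) (E t₂)
      refine ⟨max ((1 + t) / 2) (E t₂), ⟨by linarith [ht.2], hm⟩, ?_⟩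
      rw [hhigh _ ⟨by linarith [ht.1, ht.2], hm⟩ (le_max_right _ _)]
      exact ⟨by linarith [ht.2], hm⟩)
  refine ⟨φ, ⟨hφ, min (E t₁) (1 - E t₂), lt_min (hE.mem _).1 (by linarith [(hE.mem t₂).2]),
    fun x hx => ?_⟩, fun y => by rw [hφG _ (hE.mem y), hEiE]⟩
  by_cases hx' : x ∈ Ioo (0:ℝ) 1
  · rw [hφG x hx']
    rw [mem_Ioo, not_and_or, not_lt, not_lt] at hx
    rcases hx with hx | hx
    · exact hlow x hx' (hx.trans (min_le_left _ _))
    · exact hhigh x hx' (by linarith [min_le_right (E t₁) (1 - E t₂)])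
  · exact hφid x hx'

namespace Matching
variable {r : ℕ} {C C' η sa sb θ : ℝ} {f : Equiv.Perm ℝ} {g : ℝ → Equiv.Perm ℝ} {F E R : ℝ → ℝ}

theorem half_le_deriv (h : Matching r C' η f (g θ) F E R) (hm : Model r C η sa sb f g)
    (hη : 0 < η) (hθ : θ ∈ Icc (0:ℝ) 1) (hCη : C' * η ≤ 1 / 2) {y : ℝ}
    (hy : F y ∈ Icc (9/20:ℝ) (7/10)) : 1 / 2 ≤ deriv F y := by
  have h1 : F (y + η) = F y + η := by rw [h.paramF.equi, hm.plateau θ hθ _ hy]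
  obtain ⟨ξ, hξ, hξe⟩ := exists_deriv_eq_slope F (show y < y + η by linarith)
    h.paramF.smooth.continuous.continuousOn
    (fun z _ => (h.paramF.differentiableAt z).differentiableWithinAt)
  rw [h1, add_sub_cancel_left, add_sub_cancel_left, div_self hη.ne'] at hξe
  have hd : Differentiable ℝ (logD F) := h.paramF.contDiff_logD.differentiable (by simp)
  have := convex_univ.norm_image_sub_le_of_norm_deriv_le (f := logD F) (C := C')
      (fun x _ => hd x) (fun x _ => h.logD_le x) (mem_univ ξ) (mem_univ y)
  have e0 : logD F ξ = 0 := by rw [logD, hξe, Real.log_one]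
  rw [e0, sub_zero, Real.norm_eq_abs, Real.norm_eq_abs] at this
  have hC : 0 ≤ C' := (abs_nonneg _).trans (h.logD_le 0)
  have h2 : |y - ξ| ≤ η := by rw [abs_le]; constructor <;> linarith [hξ.1, hξ.2]
  have h3 : -(1 / 2) ≤ logD F y := by
    have : |logD F y| ≤ C' * η := this.trans (mul_le_mul_of_nonneg_left h2 hC)
    linarith [(abs_le.1 this).1]
  rw [← h.paramF.exp_logD]
  linarith [Real.add_one_le_exp (logD F y)]

end Matching

/-- Interpolation between two parametrizations. -/
noncomputable def glue (F R : ℝ → ℝ) (y : ℝ) : ℝ := F y + ramp (11/20) (13/20) (F y) * (R y - F y)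

section glue
variable {F R : ℝ → ℝ} {y : ℝ}

theorem glue_left (h : F y ≤ 11/20) : glue F R y = F y := by
  rw [glue, ramp_zero (by norm_num) h, zero_mul, add_zero]

theorem glue_right (h : 13/20 ≤ F y) : glue F R y = R y := by
  rw [glue, ramp_one (by norm_num) h]; ring

theorem contDiff_glue (hF : ContDiff ℝ ∞ F) (hR : ContDiff ℝ ∞ R) : ContDiff ℝ ∞ (glue F R) :=
  hF.add ((contDiff_ramp.comp hF).mul (hR.sub hF))

theorem hasDerivAt_glue (hF : Differentiable ℝ F) (hR : Differentiable ℝ R) :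
    HasDerivAt (glue F R) (deriv F y + (deriv (ramp (11/20) (13/20)) (F y) * deriv F y * (R y - F y) +
      ramp (11/20) (13/20) (F y) * deriv (fun y => R y - F y) y)) y := by
  have h1 := (hF y).hasDerivAt
  have h2 : HasDerivAt (ramp (11/20) (13/20)) _ (F y) :=
    ((@contDiff_ramp (11/20) (13/20)).differentiable (by simp) (F y)).hasDerivAt
  have h3 := ((hR.fun_sub hF) y).hasDerivAt
  exact h1.add ((h2.comp y h1).mul h3)

end glue

theorem exists_conj_of_matching (r : ℕ) (C C' : ℝ) : ∃ C'', ∃ η₁ > (0:ℝ), ∀ η ≤ η₁,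
    ∀ sa sb f g, CLData r η sa sb f → Model r C η sa sb f g → ∀ θ ∈ Ico (0:ℝ) 1,
    ∀ F E R, Matching r C' η f (g θ) F E R → ∃ φ : Equiv.Perm ℝ, CompactDiff φ ∧
      ∀ j ≤ r, ∀ x ∈ Ioo (0:ℝ) 1, |iteratedDeriv j (fun x => (φ * f * φ⁻¹) x - x) x| ≤ C'' * η := by
  obtain ⟨M₀, hM₀, hM⟩ := exists_ramp_bound (r + 1)
  set M := M₀ * (((13/20:ℝ) - 11/20)⁻¹) ^ (r + 1) with hMdef
  replace hM : ∀ i ≤ r + 1, ∀ x, |iteratedDeriv i (ramp (11/20) (13/20)) x| ≤ M :=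
    hM _ _ (by norm_num) (by norm_num)
  have hM0 : 0 ≤ M := (abs_nonneg _).trans (hM 0 (by omega) 0)
  obtain ⟨C₁, hC₁1, hC₁⟩ := iteratedDeriv_comp_bound r C'
  set B := C' + 2 ^ r * (C₁ * M * C') with hB
  obtain ⟨C₃, hC₃1, hC₃⟩ := iteratedDeriv_of_comp_bound r (1/4) B (by norm_num)
  set C₂ := 2 ^ r * (C₁ * M * C') with hC₂
  set P := 1 + |C| + |C'| + M * C' ^ 2 with hP
  have hMC : 0 ≤ M * C' ^ 2 := by positivity
  have hP1 : 1 ≤ P := by linarith [abs_nonneg C, abs_nonneg C']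
  refine ⟨|C| + (C₃ * C₂ + 1), 1 / (50 * P), by positivity, ?_⟩
  intro η hη₁ sa sb f g h hm θ hθ F E R hmat
  have hη := h.pos
  have hη1 := h.le_one
  have hθ' : θ ∈ Icc (0:ℝ) 1 := ⟨hθ.1, hθ.2.le⟩
  have hPη : P * η ≤ 1 / 50 := by
    rw [le_div_iff₀ (by positivity)] at hη₁; linarith
  have hC'0 : 0 ≤ C' := (abs_nonneg _).trans (hmat.logD_le 0)
  have q0 : 0 ≤ |C| * η := by positivity
  have q1 : 0 ≤ C' * η := by positivity
  have q2 : 0 ≤ M * C' ^ 2 * η := by positivity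
  have hPe : P * η = η + |C| * η + C' * η + M * C' ^ 2 * η := by
    rw [hP, abs_of_nonneg hC'0]; ring
  have s1 : C * η ≤ 1 / 50 := by
    have : C * η ≤ |C| * η := mul_le_mul_of_nonneg_right (le_abs_self C) hη.le
    linarith
  have s2 : C' * η ≤ 1 / 50 := by linarith
  have s3 : C' * η ^ 2 ≤ 1 / 50 := by nlinarith
  have s4 : M * C' ^ 2 * η ≤ 1 / 50 := by linarith
  have sη : η ≤ 1 / 50 := by linarith
  have hFs := hmat.paramF.smooth
  have hRs := hmat.paramR.smooth
  have hGs : ContDiff ℝ ∞ (glue F R) := contDiff_glue hFs hRs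
  have hFd : Differentiable ℝ F := hFs.differentiable (by simp)
  have hRd : Differentiable ℝ R := hRs.differentiable (by simp)
  have hFc := hFs.continuous
  have hplat : ∀ y, F y ∈ Icc (9/20:ℝ) (7/10) → 1 / 4 ≤ deriv (glue F R) y := by
    intro y hy
    rw [(hasDerivAt_glue hFd hRd).deriv]
    have h1 := hmat.half_le_deriv hm hη hθ' (by linarith) hy
    have h2 : |deriv (ramp (11/20) (13/20)) (F y) * deriv F y * (R y - F y)| ≤ 1 / 50 := by
      rw [abs_mul, abs_mul]
      have e1 := hM 1 (by omega) (F y)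
      have e2 := hmat.boundF y 1 le_rfl (by linarith [h.two_le])
      rw [iteratedDeriv_one] at e1 e2
      calc _ ≤ M * C' * (C' * η ^ 2) := by gcongr; exact hmat.sub_le y
        _ = M * C' ^ 2 * η * η := by ring
        _ ≤ 1 / 50 := by nlinarith
    have h3 : |ramp (11/20) (13/20) (F y) * deriv (fun y => R y - F y) y| ≤ 1 / 50 := by
      rw [abs_mul, abs_of_nonneg ramp_nonneg]
      calc _ ≤ 1 * (C' * η) := by
            gcongr
            · exact ramp_le_one
            · exact hmat.deriv_sub_le y
        _ ≤ 1 / 50 := by linarith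
    linarith [(abs_le.1 h2).1, (abs_le.1 h3).1]
  have hleft : ∀ y, F y < 11/20 → glue F R =ᶠ[𝓝 y] F := fun y hy => by
    filter_upwards [hFc.continuousAt.eventually_lt_const hy] with z hz using glue_left (le_of_lt hz)
  have hright : ∀ y, 13/20 < F y → glue F R =ᶠ[𝓝 y] R := fun y hy => by
    filter_upwards [hFc.continuousAt.eventually_const_lt hy] with z hz using glue_right (le_of_lt hz)
  have hG' : ∀ y, 0 < deriv (glue F R) y := fun y => by
    rcases lt_or_ge (F y) (11/20) with h1 | h1
    · rw [(hleft y h1).deriv_eq]; exact hmat.paramF.deriv_pos y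
    rcases le_or_gt (F y) (13/20) with h2 | h2
    · linarith [hplat y ⟨by linarith, by linarith⟩]
    · rw [(hright y h2).deriv_eq]; exact hmat.paramR.deriv_pos y
  obtain ⟨φ, hφ, hφG⟩ := exists_perm_of_params hmat.paramE hGs hG' (by
      obtain ⟨t, ht⟩ := hmat.left
      obtain ⟨Y, hY⟩ := eventually_atBot.1 (hmat.paramF.tendsto_atBot.eventually_lt_const
        (show (0:ℝ) < 11/20 by norm_num))
      refine ⟨min t Y, fun y hy => ?_⟩
      rw [glue_left (hY y (hy.trans (min_le_right _ _))).le, ht y (hy.trans (min_le_left _ _))])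
    (by
      obtain ⟨t, ht⟩ := hmat.right
      obtain ⟨Y, hY⟩ := eventually_atTop.1 (hmat.paramF.tendsto_atTop.eventually_const_lt
        (show (13/20:ℝ) < 1 by norm_num))
      refine ⟨max t Y, fun y hy => ?_⟩
      rw [glue_right (hY y ((le_max_right _ _).trans hy)).le, ht y ((le_max_left _ _).trans hy)])
  refine ⟨φ, hφ, ?_⟩
  set k : Equiv.Perm ℝ := φ * f * φ⁻¹ with hk
  have hkd : IooDiff k := (hφ.diff.mul h.diff).mul hφ.diff.inv
  have hkG : ∀ y, k (glue F R y) = glue F R (y + η) := fun y => by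
    rw [hk, Equiv.Perm.mul_apply, Equiv.Perm.mul_apply, ← hφG, inv_perm_apply,
      ← hmat.paramE.equi, hφG]
  have hC₂0 : 0 ≤ C₂ := by positivity
  have hC₃2 : 0 ≤ C₃ * C₂ := by positivity
  have hfar : ∀ y, k =ᶠ[𝓝 (glue F R y)] g θ → ∀ j ≤ r,
      |iteratedDeriv j (fun x => k x - x) (glue F R y)| ≤ (|C| + (C₃ * C₂ + 1)) * η := by
    intro y hy j hj
    have e : (fun x => k x - x) =ᶠ[𝓝 (glue F R y)] fun x => g θ x - x := by
      filter_upwards [hy] with z hz; rw [hz]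
    rw [e.iteratedDeriv_eq]
    refine (hm.bound θ hθ' _ ?_ j hj).trans ?_
    · have := (hφ.diff.mem_iff _).2 (hmat.paramE.mem y)
      rwa [hφG] at this
    · exact mul_le_mul_of_nonneg_right (by linarith [le_abs_self C]) hη.le
  intro j hj x hx
  obtain ⟨y, rfl⟩ : ∃ y, glue F R y = x := by
    obtain ⟨y, hy⟩ := hmat.paramE.surj _ ((hφ.diff.inv.mem_iff x).2 hx)
    exact ⟨y, by rw [← hφG, hy, apply_inv_perm]⟩
  have hFsh : Continuous fun y => F (y + η) := by fun_prop
  rcases lt_or_ge (F (y + η)) (11/20) with h1 | h1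
  · refine hfar y (eventuallyEq_of_comp hGs (hG' y) ?_) j hj
    filter_upwards [hFsh.continuousAt.eventually_lt_const h1] with z hz
    rw [hkG, glue_left hz.le, hmat.paramF.equi, glue_left]
    exact (hmat.paramF.strictMono (show z < z + η by linarith)).le.trans hz.le
  rcases lt_or_ge (13/20) (F y) with h2 | h2
  · refine hfar y (eventuallyEq_of_comp hGs (hG' y) ?_) j hj
    filter_upwards [hFc.continuousAt.eventually_const_lt h2] with z hz
    rw [hkG, glue_right hz.le, ← hmat.paramR.equi, glue_right]
    exact hz.le.trans (hmat.paramF.strictMono (show z < z + η by linarith)).le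
  have h3 : 1/2 ≤ F y := by
    have := hm.bound θ hθ' (F y) (hmat.paramF.mem y) 0 (by omega)
    rw [iteratedDeriv_zero, ← hmat.paramF.equi] at this
    linarith [(abs_le.1 this).2]
  have hpl : ∀ z, 12/25 < F z → F z < 67/100 → F (z + η) = F z + η ∧ R (z + η) = R z + η := by
    intro z hz1 hz2
    have := abs_le.1 (hmat.sub_le z)
    rw [hmat.paramF.equi, hmat.paramR.equi, hm.plateau θ hθ' _ ⟨by linarith, by linarith⟩,
      hm.plateau θ hθ' _ ⟨by linarith, by linarith⟩]
    exact ⟨rfl, rfl⟩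
  set χ := ramp (11/20) (13/20) with hχ
  have hχs : ContDiff ℝ ∞ χ := contDiff_ramp
  set q : ℝ → ℝ := fun x => χ (x + η) - χ x with hq
  have hqs : ContDiff ℝ ∞ q := by fun_prop
  have hqb : ∀ i ≤ r, ∀ x, |iteratedDeriv i q x| ≤ M * η := by
    intro i hi x
    rw [hq, iteratedDeriv_fun_sub (ContDiffAt.fun_comp x (hχs.contDiffAt.of_infty i) (by fun_prop))
      (hχs.contDiffAt.of_infty i), iteratedDeriv_comp_add_const]
    have hd : Differentiable ℝ (iteratedDeriv i χ) :=
      hχs.differentiable_iteratedDeriv i (by exact_mod_cast ENat.natCast_lt_top i)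
    have := convex_univ.norm_image_sub_le_of_norm_deriv_le (f := iteratedDeriv i χ) (C := M)
      (fun x _ => hd x) (fun x _ => by
        rw [← iteratedDeriv_succ]; exact hM (i + 1) (by omega) x) (mem_univ x) (mem_univ (x + η))
    rwa [add_sub_cancel_left, Real.norm_eq_abs, Real.norm_eq_abs, abs_of_pos hη] at this
  set D : ℝ → ℝ := fun y => R y - F y with hD
  have hDs : ContDiff ℝ ∞ D := hRs.sub hFs
  have hDb : ∀ i ≤ r, |iteratedDeriv i D y| ≤ C' := by
    intro i hi
    rcases Nat.eq_zero_or_pos i with rfl | hi0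
    · rw [iteratedDeriv_zero]
      refine (hmat.sub_le y).trans ?_
      have : η ^ 2 ≤ 1 := pow_le_one₀ hη.le hη1
      nlinarith
    · exact hmat.bound_sub y i hi0 hi
  have hub : ∀ i ≤ r, |iteratedDeriv i (fun y => (q ∘ F) y * D y) y| ≤ C₂ * η := by
    intro i hi
    refine (iteratedDeriv_mul_bound (hqs.comp hFs).contDiffAt hDs.contDiffAt
      (hC₁ q F y (M * η) hqs.contDiffAt hFs.contDiffAt (fun i hi => hqb i hi _)
        (fun i h1 h2 => hmat.boundF y i h1 h2)) hDb i hi).trans_eq ?_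
    rw [hC₂]; ring
  have hGb : ∀ i, 1 ≤ i → i ≤ r → |iteratedDeriv i (glue F R) y| ≤ B := by
    intro i hi1 hi
    have e : glue F R = fun y => F y + (χ ∘ F) y * D y := rfl
    rw [e, iteratedDeriv_fun_add (hFs.contDiffAt.of_infty i)
      (((hχs.comp hFs).mul hDs).contDiffAt.of_infty i)]
    refine (abs_add_le _ _).trans (add_le_add (hmat.boundF y i hi1 hi) ?_)
    exact iteratedDeriv_mul_bound (hχs.comp hFs).contDiffAt hDs.contDiffAt
      (hC₁ χ F y M hχs.contDiffAt hFs.contDiffAt (fun i hi => hM i (by omega) _)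
        (fun i h1 h2 => hmat.boundF y i h1 h2)) hDb i hi
  have hks : ContDiffAt ℝ ∞ (fun x => k x - x - η) (glue F R y) := by
    have := hkd.smooth _ hx
    fun_prop
  have hcomp : (fun x => k x - x - η) ∘ glue F R =ᶠ[𝓝 y] fun y => (q ∘ F) y * D y := by
    filter_upwards [hFc.continuousAt.eventually_const_lt (show 12/25 < F y by linarith),
      hFc.continuousAt.eventually_lt_const (show F y < 67/100 by linarith)] with z hz1 hz2
    obtain ⟨e1, e2⟩ := hpl z hz1 hz2
    simp only [Function.comp_apply, hkG, hq, hD]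
    rw [glue, glue, e1, e2]
    ring
  have hH := hC₃ (fun x => k x - x - η) (glue F R) (fun y => (q ∘ F) y * D y) y (C₂ * η) hks
    hGs.contDiffAt ((hqs.comp hFs).mul hDs).contDiffAt hcomp (hplat y ⟨by linarith, by linarith⟩)
    hub hGb j hj
  have e : (fun x => k x - x) = fun x => (k x - x - η) + η := by funext x; ring
  rw [e, iteratedDeriv_fun_add (hks.of_infty j) contDiffAt_const]
  refine (abs_add_le _ _).trans ?_
  have := abs_iteratedDeriv_const_le j η (glue F R y)
  rw [abs_of_pos hη] at this
  nlinarith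

/-- A diffeomorphism of `(0, 1)` moving points to the right, with sublinear variation, which is
very close to the identity near the endpoints, is conjugate to a map close to the identity. -/
theorem exists_conj_unit {r : ℕ} (hr : 2 ≤ r) : ∃ κ > (0:ℝ), ∀ ε ∈ Ioc (0:ℝ) 1,
    ∀ sa ∈ Ioc (0:ℝ) (1/10), ∀ sb ∈ Ioc (0:ℝ) (1/10), ∀ f : Equiv.Perm ℝ, IooDiff f →
    (∀ x ∈ Ioo (0:ℝ) 1, x < f x) →
    (∀ j ≤ r, ∀ x ∈ Ioo 0 sa, |iteratedDeriv j (fun x => f x - x) x| ≤ κ * ε * sa ^ (r + 1)) →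
    (∀ j ≤ r, ∀ x ∈ Ioo (1 - sb) 1,
      |iteratedDeriv j (fun x => f x - x) x| ≤ κ * ε * sb ^ (r + 1)) →
    LogDBounded f → SublinVar f → ∃ φ : Equiv.Perm ℝ, CompactDiff φ ∧
      ∀ j ≤ r, ∀ x ∈ Ioo (0:ℝ) 1, |iteratedDeriv j (fun x => (φ * f * φ⁻¹) x - x) x| ≤ ε := by
  obtain ⟨C, hC1, hC⟩ := exists_model r
  obtain ⟨C', hC'⟩ := exists_matching r C
  obtain ⟨C'', η₁, hη₁, hC''⟩ := exists_conj_of_matching r C C'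
  set c := min (min 1 η₁) (min (1 / (2 * C)) (1 / (|C''| + 1))) with hc
  have hc0 : 0 < c := by positivity
  have c1 : c ≤ 1 := (min_le_left _ _).trans (min_le_left _ _)
  have c2 : c ≤ η₁ := (min_le_left _ _).trans (min_le_right _ _)
  have c3 : C * c ≤ 1 / 2 := by
    have : c ≤ 1 / (2 * C) := (min_le_right _ _).trans (min_le_left _ _)
    rw [le_div_iff₀ (by positivity)] at this; linarith
  have c4 : |C''| * c ≤ 1 := by
    have : c ≤ 1 / (|C''| + 1) := (min_le_right _ _).trans (min_le_right _ _)
    rw [le_div_iff₀ (by positivity)] at this; linarith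
  refine ⟨c / 8, by positivity, fun ε hε sa hsa sb hsb f hf hlt hl hrt hb hv => ?_⟩
  have hε0 := hε.1
  have hεc : c * ε ≤ c := mul_le_of_le_one_right hc0.le hε.2
  have e : c / 8 * ε = c * ε / 8 := by ring
  rw [e] at hl hrt
  have h : CLData r (c * ε) sa sb f := ⟨hf, hlt, hr, by positivity, by linarith, hsa.1, hsa.2, hsb.1,
    hsb.2, hl, hrt⟩
  have hCη : C * (c * ε) ≤ 1 / 2 := by nlinarith
  obtain ⟨g, hg⟩ := hC _ _ _ _ h hCη
  obtain ⟨θ, hθ, F, E, R, hmat⟩ := hC' _ _ _ _ _ h hg hCη hb hv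
  obtain ⟨φ, hφ, hφb⟩ := hC'' _ (by linarith) _ _ _ _ h hg θ hθ F E R hmat
  refine ⟨φ, hφ, fun j hj x hx => (hφb j hj x hx).trans ?_⟩
  have : C'' * (c * ε) ≤ |C''| * (c * ε) := mul_le_mul_of_nonneg_right (le_abs_self _) (by positivity)
  nlinarith

/-- A sequence of continuous functions on `[0, 1]`, each one the derivative of the previous one in
the interior. -/
structure Jet (d : ℕ → ℝ → ℝ) : Prop where
  cont : ∀ j, ContinuousOn (d j) (Icc 0 1)
  der : ∀ j, ∀ x ∈ Ioo (0:ℝ) 1, HasDerivAt (d j) (d (j + 1) x) x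

/-- `p` is a zero of infinite order. -/
def FlatAt (d : ℕ → ℝ → ℝ) (p : ℝ) : Prop := ∀ j, d j p = 0

/-- `(a, b)` is a connected component of the complement of the zeros of `d 0`. -/
structure IsComp (d : ℕ → ℝ → ℝ) (a b : ℝ) : Prop where
  nonneg : 0 ≤ a
  lt : a < b
  le_one : b ≤ 1
  left : d 0 a = 0
  right : d 0 b = 0
  ne : ∀ x ∈ Ioo a b, d 0 x ≠ 0

def LNice (d : ℕ → ℝ → ℝ) (r : ℕ) (c a b : ℝ) : Prop :=
  ∃ S > 0, S ≤ (b - a) / 10 ∧ ∀ j ≤ r, ∀ x ∈ Ioo a (a + S), |d j x| ≤ c * S ^ (r + 1)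

def RNice (d : ℕ → ℝ → ℝ) (r : ℕ) (c a b : ℝ) : Prop :=
  ∃ S > 0, S ≤ (b - a) / 10 ∧ ∀ j ≤ r, ∀ x ∈ Ioo (b - S) b, |d j x| ≤ c * S ^ (r + 1)

/-- The jet of the displacement conjugated by `x ↦ 1 - x`. -/
def reflJet (d : ℕ → ℝ → ℝ) (j : ℕ) (x : ℝ) : ℝ := (-1) ^ j * d j (1 - x)

namespace Jet

variable {d : ℕ → ℝ → ℝ} {r : ℕ} {c ε : ℝ}

theorem refl (h : Jet d) : Jet (reflJet d) where
  cont j := by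
    refine continuousOn_const.mul ((h.cont j).comp (by fun_prop) fun x hx => ?_)
    exact ⟨by linarith [hx.2], by linarith [hx.1]⟩
  der j x hx := by
    have h1 := h.der j (1 - x) ⟨by linarith [hx.2], by linarith [hx.1]⟩
    have h2 := (h1.comp x ((hasDerivAt_id x).const_sub 1)).const_mul ((-1) ^ j)
    unfold reflJet
    refine (h2.congr_deriv (by ring)).congr_of_eventuallyEq (Eventually.of_forall fun y => ?_)
    simp

theorem abs_reflJet (j : ℕ) (x : ℝ) : |reflJet d j x| = |d j (1 - x)| := by
  simp [reflJet, abs_mul]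

theorem exists_bound (h : Jet d) (k : ℕ) : ∃ M, 1 ≤ M ∧ ∀ j ≤ k, ∀ x ∈ Icc (0:ℝ) 1, |d j x| ≤ M := by
  obtain ⟨M, hM⟩ := exists_uniform_bound (P := fun j M => ∀ x ∈ Icc (0:ℝ) 1, |d j x| ≤ M)
    (fun j a b hab ha x hx => (ha x hx).trans hab)
    (fun j => isCompact_Icc.exists_bound_of_continuousOn (h.cont j)) k
  exact ⟨max M 1, le_max_right _ _, fun j hj x hx => (hM j hj x hx).trans (le_max_left _ _)⟩

theorem abs_sub_le (h : Jet d) {u v M : ℝ} (hu : 0 ≤ u) (hv : v ≤ 1) {j : ℕ}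
    (hM : ∀ x ∈ Icc u v, |d (j + 1) x| ≤ M) {x y : ℝ} (hx : x ∈ Icc u v) (hy : y ∈ Icc u v) :
    |d j x - d j y| ≤ M * |x - y| := by
  wlog hxy : x < y generalizing x y
  · rcases (not_lt.1 hxy).eq_or_lt with rfl | h'
    · simp
    · rw [abs_sub_comm, abs_sub_comm x]
      exact this hy hx h'
  obtain ⟨z, hz, hz'⟩ := exists_hasDerivAt_eq_slope (d j) (d (j + 1)) hxy
    ((h.cont j).mono (Icc_subset_Icc (hu.trans hx.1) (hy.2.trans hv)))
    (fun z hz => h.der j z ⟨by linarith [hz.1, hx.1], by linarith [hz.2, hy.2]⟩)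
  have h1 : d j y - d j x = d (j + 1) z * (y - x) := by
    rw [hz']
    field_simp [(sub_pos.2 hxy).ne']
  rw [abs_sub_comm, abs_sub_comm x, h1, abs_mul]
  exact mul_le_mul_of_nonneg_right (hM z ⟨hx.1.trans hz.1.le, hz.2.le.trans hy.2⟩) (abs_nonneg _)

theorem abs_le_of_zeros (h : Jet d) {u v M : ℝ} (hu : 0 ≤ u) (hv : v ≤ 1) {k : ℕ}
    (hz : ∀ i < k, ∃ z ∈ Icc u v, d i z = 0) (hM : ∀ x ∈ Icc u v, |d k x| ≤ M) :
    ∀ i ≤ k, ∀ x ∈ Icc u v, |d (k - i) x| ≤ M * (v - u) ^ i := by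
  intro i
  induction i with
  | zero => intro _ x hx; simpa using hM x hx
  | succ i ih =>
    intro hi x hx
    obtain ⟨z, hz, hz0⟩ := hz (k - (i + 1)) (by omega)
    have e : k - i = k - (i + 1) + 1 := by omega
    have h1 := h.abs_sub_le hu hv (j := k - (i + 1)) (by rw [← e]; exact ih (by omega)) hx hz
    rw [hz0, sub_zero] at h1
    have h0 : 0 ≤ M * (v - u) ^ i := (abs_nonneg _).trans (ih (by omega) x hx)
    refine h1.trans ?_
    rw [pow_succ, ← mul_assoc]
    refine mul_le_mul_of_nonneg_left ?_ h0
    rw [abs_le]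
    constructor <;> linarith [hx.1, hx.2, hz.1, hz.2]

theorem rolle (h : Jet d) {j : ℕ} {x y : ℝ} (hx : 0 ≤ x) (hxy : x < y) (hy : y ≤ 1)
    (h1 : d j x = 0) (h2 : d j y = 0) : ∃ z ∈ Ioo x y, d (j + 1) z = 0 :=
  exists_hasDerivAt_eq_zero hxy ((h.cont j).mono (Icc_subset_Icc hx hy)) (h1.trans h2.symm)
    (fun z hz => h.der j z ⟨by linarith [hz.1], by linarith [hz.2]⟩)

theorem exists_zero (h : Jet d) {u v : ℝ} (hu : 0 ≤ u) (hv : v ≤ 1) {K : ℕ} (z : ℕ → ℝ)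
    (hz : ∀ i ≤ K, z i ∈ Icc u v) (hzz : ∀ i < K, z (i + 1) < z i) (hz0 : ∀ i ≤ K, d 0 (z i) = 0) :
    ∀ j ≤ K, ∃ x ∈ Icc u v, d j x = 0 := by
  have key : ∀ j ≤ K, ∃ w : ℕ → ℝ, (∀ i ≤ K - j, w i ∈ Icc u v) ∧
      (∀ i < K - j, w (i + 1) < w i) ∧ ∀ i ≤ K - j, d j (w i) = 0 := by
    intro j
    induction j with
    | zero => intro _; exact ⟨z, hz, hzz, hz0⟩
    | succ j ih =>
      intro hj
      obtain ⟨w, hw, hww, hw0⟩ := ih (by omega)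
      have : ∀ i, ∃ y, i ≤ K - (j + 1) → y ∈ Ioo (w (i + 1)) (w i) ∧ d (j + 1) y = 0 := fun i => by
        by_cases hi : i ≤ K - (j + 1)
        · obtain ⟨y, hy, hy0⟩ := h.rolle (hu.trans (hw (i + 1) (by omega)).1) (hww i (by omega))
            ((hw i (by omega)).2.trans hv) (hw0 (i + 1) (by omega)) (hw0 i (by omega))
          exact ⟨y, fun _ => ⟨hy, hy0⟩⟩
        · exact ⟨0, fun h' => absurd h' hi⟩
      choose y hy using this
      refine ⟨y, fun i hi => ?_, fun i hi => ?_, fun i hi => (hy i hi).2⟩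
      · exact ⟨(hw (i + 1) (by omega)).1.trans (hy i hi).1.1.le,
          (hy i hi).1.2.le.trans (hw i (by omega)).2⟩
      · exact (hy (i + 1) (by omega)).1.2.trans (hy i (by omega)).1.1
  intro j hj
  obtain ⟨w, hw, -, hw0⟩ := key j hj
  exact ⟨w 0, hw 0 (by omega), hw0 0 (by omega)⟩

theorem eq_zero_of_accum (h : Jet d) {p : ℝ} (hp : p ∈ Icc (0:ℝ) 1) {j : ℕ}
    (hacc : ∀ δ > 0, ∃ q ∈ Icc (0:ℝ) 1, |q - p| < δ ∧ d j q = 0) : d j p = 0 := by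
  by_contra hne
  have h1 := (h.cont j p hp).eventually_ne hne
  rw [eventually_nhdsWithin_iff, Metric.eventually_nhds_iff] at h1
  obtain ⟨δ, hδ, hd⟩ := h1
  obtain ⟨q, hq, hqp, hq0⟩ := hacc δ hδ
  exact hd (by rwa [Real.dist_eq]) hq hq0

theorem flatAt_of_accum (h : Jet d) {p : ℝ} (hp : p ∈ Icc (0:ℝ) 1)
    (hacc : ∀ δ > 0, ∃ q ∈ Icc (0:ℝ) 1, q ≠ p ∧ |q - p| < δ ∧ d 0 q = 0) : FlatAt d p := by
  have key : ∀ j, ∀ δ > 0, ∃ q ∈ Icc (0:ℝ) 1, q ≠ p ∧ |q - p| < δ ∧ d j q = 0 := by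
    intro j
    induction j with
    | zero => exact hacc
    | succ j ih =>
      intro δ hδ
      have h0 : d j p = 0 := h.eq_zero_of_accum hp fun δ hδ => by
        obtain ⟨q, h1, -, h2⟩ := ih δ hδ
        exact ⟨q, h1, h2⟩
      obtain ⟨q, hq, hne, hqp, hq0⟩ := ih δ hδ
      rw [abs_lt] at hqp
      rcases lt_or_gt_of_ne hne with hlt | hlt
      · obtain ⟨z, hz, hz0⟩ := h.rolle hq.1 hlt hp.2 hq0 h0
        exact ⟨z, ⟨by linarith [hz.1, hq.1], by linarith [hz.2, hp.2]⟩, hz.2.ne,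
          by rw [abs_lt]; constructor <;> linarith [hz.1, hz.2], hz0⟩
      · obtain ⟨z, hz, hz0⟩ := h.rolle hp.1 hlt hq.2 h0 hq0
        exact ⟨z, ⟨by linarith [hz.1, hp.1], by linarith [hz.2, hq.2]⟩, hz.1.ne',
          by rw [abs_lt]; constructor <;> linarith [hz.1, hz.2], hz0⟩
  exact fun j => h.eq_zero_of_accum hp fun δ hδ => by
    obtain ⟨q, h1, -, h2⟩ := key j δ hδ
    exact ⟨q, h1, h2⟩

theorem isolated (h : Jet d) {p : ℝ} (hp : p ∈ Icc (0:ℝ) 1) (hn : ¬ FlatAt d p) :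
    ∃ δ > 0, ∀ q ∈ Icc (0:ℝ) 1, d 0 q = 0 → q ≠ p → δ ≤ |q - p| := by
  by_contra! hcon
  refine hn (h.flatAt_of_accum hp fun δ hδ => ?_)
  obtain ⟨q, h1, h2, h3, h4⟩ := hcon δ hδ
  exact ⟨q, h1, h3, h4, h2⟩

theorem isClosed_zeros (h : Jet d) (j : ℕ) {u v : ℝ} (hu : 0 ≤ u) (hv : v ≤ 1) :
    IsCompact {x | x ∈ Icc u v ∧ d j x = 0} := by
  refine isCompact_Icc.of_isClosed_subset ?_ (fun x hx => hx.1)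
  exact ((h.cont j).mono (Icc_subset_Icc hu hv)).preimage_isClosed_of_isClosed isClosed_Icc
    (isClosed_singleton (x := (0:ℝ)))

theorem exists_comp (h : Jet d) (h0 : d 0 0 = 0) (h1 : d 0 1 = 0) {x : ℝ} (hx : x ∈ Icc (0:ℝ) 1)
    (hne : d 0 x ≠ 0) : ∃ a b, IsComp d a b ∧ x ∈ Ioo a b := by
  obtain ⟨a, ha, hamax⟩ := (h.isClosed_zeros 0 le_rfl hx.2).exists_isGreatest
    ⟨0, ⟨le_rfl, hx.1⟩, h0⟩
  obtain ⟨b, hb, hbmin⟩ := (h.isClosed_zeros 0 hx.1 le_rfl).exists_isLeast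
    ⟨1, ⟨hx.2, le_rfl⟩, h1⟩
  have hax : a < x := lt_of_le_of_ne ha.1.2 (by rintro rfl; exact hne ha.2)
  have hxb : x < b := lt_of_le_of_ne hb.1.1 (by rintro rfl; exact hne hb.2)
  refine ⟨a, b, ⟨ha.1.1, hax.trans hxb, hb.1.2, ha.2, hb.2, fun y hy hy0 => ?_⟩, hax, hxb⟩
  rcases le_total y x with hyx | hyx
  · exact absurd (hamax ⟨⟨ha.1.1.trans hy.1.le, hyx⟩, hy0⟩) (not_le.2 hy.1)
  · exact absurd (hbmin ⟨⟨hyx, hy.2.le.trans hb.1.2⟩, hy0⟩) (not_le.2 hy.2)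

end Jet

namespace IsComp

variable {d : ℕ → ℝ → ℝ} {r : ℕ} {c a b a' b' : ℝ}

theorem le_left (h : IsComp d a b) {q : ℝ} (hq : d 0 q = 0) (hqb : q < b) : q ≤ a := by
  by_contra! hlt
  exact h.ne q ⟨hlt, hqb⟩ hq

theorem right_le (h : IsComp d a b) {q : ℝ} (hq : d 0 q = 0) (hqa : a < q) : b ≤ q := by
  by_contra! hlt
  exact h.ne q ⟨hqa, hlt⟩ hq

theorem unique (h : IsComp d a b) (h' : IsComp d a' b') (h1 : a < b') (h2 : a' < b) :
    a = a' ∧ b = b' :=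
  ⟨le_antisymm (h'.le_left h.left h1) (h.le_left h'.left h2),
    le_antisymm (h.right_le h'.right h1) (h'.right_le h.right h2)⟩

theorem refl (h : IsComp d a b) : IsComp (reflJet d) (1 - b) (1 - a) where
  nonneg := by linarith [h.le_one]
  lt := by linarith [h.lt]
  le_one := by linarith [h.nonneg]
  left := by simp [reflJet, h.right]
  right := by simp [reflJet, h.left]
  ne x hx := by simpa [reflJet] using h.ne (1 - x) ⟨by linarith [hx.2], by linarith [hx.1]⟩

theorem lNice_of_flatAt (h : IsComp d a b) (hd : Jet d) (hc : 0 < c) (ha : FlatAt d a) :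
    LNice d r c a b := by
  obtain ⟨M, hM1, hM⟩ := hd.exists_bound (2 * r + 2)
  have hM0 : 0 < M := by linarith
  have hl := h.lt
  have hb := h.le_one
  have h0 := h.nonneg
  refine ⟨min ((b - a) / 10) (c / M), lt_min (by linarith) (by positivity), min_le_left _ _, ?_⟩
  set S := min ((b - a) / 10) (c / M) with hS
  have hS0 : 0 < S := lt_min (by linarith) (by positivity)
  have hS1 : S ≤ (b - a) / 10 := min_le_left _ _
  have hS2 : M * S ≤ c := by
    have := min_le_right ((b - a) / 10) (c / M)
    rw [← hS, le_div_iff₀ hM0] at this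
    linarith
  intro j hj x hx
  have h1 := hd.abs_le_of_zeros (k := 2 * r + 2) (u := a) (v := a + S) (M := M) h0 (by linarith)
    (fun i _ => ⟨a, ⟨le_rfl, by linarith⟩, ha i⟩)
    (fun y hy => hM _ le_rfl y ⟨by linarith [hy.1], by linarith [hy.2]⟩) (2 * r + 2 - j) (by omega) x
    ⟨hx.1.le, hx.2.le⟩
  rw [show 2 * r + 2 - (2 * r + 2 - j) = j by omega, add_sub_cancel_left] at h1
  calc |d j x| ≤ M * S ^ (2 * r + 2 - j) := h1
    _ ≤ M * S ^ (r + 2) := by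
        refine mul_le_mul_of_nonneg_left (pow_le_pow_of_le_one hS0.le (by linarith) (by omega)) hM0.le
    _ = (M * S) * S ^ (r + 1) := by ring
    _ ≤ c * S ^ (r + 1) := by gcongr

theorem lNice_of_calm (h : IsComp d a b)
    (hca : ∀ j ≤ r, ∀ x ∈ Ioo a b, |d j x| ≤ c * ((b - a) / 10) ^ (r + 1)) : LNice d r c a b :=
  ⟨(b - a) / 10, by linarith [h.lt], le_rfl, fun j hj x hx => hca j hj x
    ⟨hx.1, by linarith [hx.2, h.lt]⟩⟩

theorem rNice_of_refl (h : LNice (reflJet d) r c (1 - b) (1 - a)) : RNice d r c a b := by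
  obtain ⟨S, hS, hS1, hb⟩ := h
  refine ⟨S, hS, by linarith, fun j hj x hx => ?_⟩
  have := hb j hj (1 - x) ⟨by linarith [hx.2], by linarith [hx.1]⟩
  rwa [Jet.abs_reflJet, sub_sub_cancel] at this

end IsComp

namespace Jet

variable {d : ℕ → ℝ → ℝ} {r : ℕ} {c ε : ℝ}

theorem abs_le_of_clustered (h : Jet d) {N : ℕ} (hN2 : 2 ≤ N) {M q p a b l : ℝ}
    (hM : ∀ j ≤ N, ∀ x ∈ Icc (0:ℝ) 1, |d j x| ≤ M) (hq : q ∈ Icc (0:ℝ) 1) (hqf : FlatAt d q)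
    (hp : p ≤ 1) (hl0 : 0 < l) (hla : b - l ≤ a) (hbp : b ≤ p)
    (hcl : ∀ x ∈ Icc q p, ∃ z, d 0 z = 0 ∧ x - 2 * l ≤ z ∧ z ≤ x) {x : ℝ} (hx : x ∈ Icc a b)
    (hqx : q ≤ x) {j : ℕ} (hj : j ≤ N) : |d j x| ≤ M * (4 * N * l) ^ (N - j) := by
  have hN1 : (2:ℝ) ≤ N := by exact_mod_cast hN2
  have hM0 : 0 ≤ M := (abs_nonneg _).trans (hM 0 (by omega) q hq)
  have hNl : 2 * l ≤ N * l := by gcongr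
  rcases le_total (b - q) (4 * N * l) with hcase | hcase
  · have h2 := h.abs_le_of_zeros (k := N) (u := q) (v := b) (M := M) hq.1 (by linarith)
      (fun i _ => ⟨q, ⟨le_rfl, by linarith [hx.2]⟩, hqf i⟩)
      (fun y hy => hM _ le_rfl y ⟨hq.1.trans hy.1, by linarith [hy.2]⟩) (N - j) (by omega) x
      ⟨by linarith [hx.1], hx.2⟩
    rw [show N - (N - j) = j by omega] at h2
    refine h2.trans (mul_le_mul_of_nonneg_left ?_ hM0)
    exact pow_le_pow_left₀ (by linarith [hx.2]) hcase _
  · have hex : ∀ i : ℕ, ∃ z, i ≤ N → d 0 z = 0 ∧ b - 3 * i * l - 2 * l ≤ z ∧ z ≤ b - 3 * i * l := by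
      intro i
      by_cases hi : i ≤ N
      · have hi' : (i:ℝ) ≤ N := by exact_mod_cast hi
        have hil : i * l ≤ N * l := by gcongr
        have hil0 : 0 ≤ i * l := by positivity
        obtain ⟨z, hz⟩ := hcl (b - 3 * i * l) ⟨by linarith, by linarith⟩
        exact ⟨z, fun _ => hz⟩
      · exact ⟨0, fun h' => absurd h' hi⟩
    choose z hz using hex
    have hu : 0 ≤ b - 4 * N * l := by linarith [hq.1]
    have hzeros := h.exists_zero (u := b - 4 * N * l) (v := b) (K := N) hu (by linarith) z
      (fun i hi => by
        have hi' : (i:ℝ) ≤ N := by exact_mod_cast hi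
        have hil : i * l ≤ N * l := by gcongr
        have hil0 : 0 ≤ i * l := by positivity
        have hNl : 2 * l ≤ N * l := by gcongr
        obtain ⟨-, h2, h3⟩ := hz i hi
        exact ⟨by linarith, by linarith⟩)
      (fun i hi => by
        have h2 := (hz (i + 1) hi).2.2
        have h3 := (hz i hi.le).2.1
        push_cast at h2
        linarith)
      (fun i hi => (hz i hi).1)
    have h2 := h.abs_le_of_zeros (k := N) (u := b - 4 * N * l) (v := b) (M := M) hu
      (by linarith) (fun i hi => hzeros i hi.le)
      (fun y hy => hM _ le_rfl y ⟨hu.trans hy.1, by linarith [hy.2]⟩) (N - j) (by omega) x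
      ⟨by linarith [hx.1], hx.2⟩
    rwa [show N - (N - j) = j by omega, sub_sub_cancel] at h2

/-- To the right of a flat point, there are points which are either flat or separated by nice
ends. -/
theorem exists_barrier_right (h : Jet d) (h0 : d 0 0 = 0) (h1 : d 0 1 = 0) (hc : 0 < c) (r : ℕ) {q : ℝ}
    (hq : q ∈ Icc (0:ℝ) 1) (hqf : FlatAt d q) {δ : ℝ} (hδ : 0 < δ) :
    ∃ m ∈ Ioo q (q + δ), (d 0 m = 0 → m ∈ Icc (0:ℝ) 1 → FlatAt d m) ∧
      ∀ a b, IsComp d a b → a < m → m < b → LNice d r c a b := by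
  rcases hq.2.eq_or_lt with rfl | hq1
  · refine ⟨1 + δ / 2, ⟨by linarith, by linarith⟩, fun _ hm => absurd hm.2 (by linarith),
      fun a b hab _ hb => absurd hab.le_one (by linarith)⟩
  by_cases hA : ∃ δ' > 0, ∀ x ∈ Ioo q (q + δ'), x < 1 → d 0 x ≠ 0
  · obtain ⟨δ', hδ', hA⟩ := hA
    set μ := min (min δ δ') (1 - q) with hμ
    have hμ0 : 0 < μ := lt_min (lt_min hδ hδ') (by linarith)
    have hμ1 : μ ≤ δ := (min_le_left _ _).trans (min_le_left _ _)
    have hμ2 : μ ≤ δ' := (min_le_left _ _).trans (min_le_right _ _)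
    have hμ3 : μ ≤ 1 - q := min_le_right _ _
    refine ⟨q + μ / 2, ⟨by linarith, by linarith⟩, fun hm _ => absurd hm
      (hA _ ⟨by linarith, by linarith⟩ (by linarith)), fun a b hab ha hb => ?_⟩
    have hqa : q ≤ a := hab.le_left (hqf 0) (by linarith)
    rcases hqa.eq_or_lt with rfl | hqa
    · exact hab.lNice_of_flatAt h hc hqf
    · exact absurd hab.left (hA a ⟨hqa, by linarith⟩ (by linarith))
  push Not at hA
  obtain ⟨N, hN⟩ : ∃ N, N = 2 * r + 2 := ⟨_, rfl⟩
  obtain ⟨M, hM1, hM⟩ := h.exists_bound N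
  have hM0 : 0 < M := by linarith
  have hN1 : (2:ℝ) ≤ N := by
    rw [hN]; push_cast; have : (0:ℝ) ≤ r := Nat.cast_nonneg r; linarith
  have hN0 : (0:ℝ) < N := by linarith
  set Q : ℝ := M * (4 * N) * (40 * N) ^ (r + 1) with hQ
  have hQ0 : 0 < Q := by positivity
  set η := min (1 / (4 * (N:ℝ))) (c / Q) with hη
  have hη0 : 0 < η := lt_min (by positivity) (by positivity)
  have hη1 : 4 * N * η ≤ 1 := by
    have : η ≤ 1 / (4 * (N:ℝ)) := min_le_left _ _
    rw [le_div_iff₀ (by positivity)] at this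
    linarith
  have hη2 : Q * η ≤ c := by
    have : η ≤ c / Q := min_le_right _ _
    rw [le_div_iff₀ hQ0] at this
    linarith
  obtain ⟨p, hp, hp1, hp0⟩ := hA (min δ η) (lt_min hδ hη0)
  have hpδ : p < q + δ := hp.2.trans_le (by linarith [min_le_left δ η])
  have hpη : p < q + η := hp.2.trans_le (by linarith [min_le_right δ η])
  have hqp := hp.1
  by_cases hall : ∀ x ∈ Icc q p, d 0 x = 0
  · refine ⟨(q + p) / 2, ⟨by linarith, by linarith⟩, fun _ hm => h.flatAt_of_accum hm
      fun t ht => ?_, fun a b hab ha hb => absurd (hall ((q + p) / 2) ⟨by linarith, by linarith⟩)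
        (hab.ne _ ⟨ha, hb⟩)⟩
    set μ := min t (p - q) with hμ
    have hμ0 : 0 < μ := lt_min ht (by linarith)
    have hμ1 : μ ≤ t := min_le_left _ _
    have hμ2 : μ ≤ p - q := min_le_right _ _
    refine ⟨(q + p) / 2 + μ / 2, ⟨by linarith [hm.1], by linarith⟩, by linarith, ?_,
      hall _ ⟨by linarith, by linarith⟩⟩
    rw [add_sub_cancel_left, abs_of_pos (by linarith)]
    linarith
  push Not at hall
  obtain ⟨x₀, hx₀, hx₀0⟩ := hall
  have hcomp : ∀ x ∈ Icc q p, d 0 x ≠ 0 → ∃ a b, IsComp d a b ∧ q ≤ a ∧ b ≤ p ∧ x ∈ Ioo a b := by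
    intro x hx hx0
    obtain ⟨a, b, hab, hxab⟩ := h.exists_comp h0 h1 ⟨hq.1.trans hx.1, hx.2.trans hp1.le⟩ hx0
    exact ⟨a, b, hab, hab.le_left (hqf 0) (hx.1.trans_lt hxab.2),
      hab.right_le hp0 (hxab.1.trans_le hx.2), hxab⟩
  set Λ : Set ℝ := {l | ∃ a b, IsComp d a b ∧ q ≤ a ∧ b ≤ p ∧ l = b - a} with hΛ
  have hΛb : BddAbove Λ := ⟨p - q, by rintro _ ⟨a, b, -, h1, h2, rfl⟩; linarith⟩
  obtain ⟨a₀, b₀, hab₀, hqa₀, hbp₀, -⟩ := hcomp x₀ hx₀ hx₀0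
  have hΛ0 : b₀ - a₀ ∈ Λ := ⟨a₀, b₀, hab₀, hqa₀, hbp₀, rfl⟩
  have hs0 : 0 < sSup Λ := (sub_pos.2 hab₀.lt).trans_le (le_csSup hΛb hΛ0)
  obtain ⟨l, ⟨a, b, hab, hqa, hbp, rfl⟩, hl⟩ := exists_lt_of_lt_csSup ⟨_, hΛ0⟩ (half_lt_self hs0)
  have hlen : ∀ a' b', IsComp d a' b' → q ≤ a' → b' ≤ p → b' - a' ≤ 2 * (b - a) := by
    intro a' b' h' ha' hb'
    have := le_csSup hΛb (show b' - a' ∈ Λ from ⟨a', b', h', ha', hb', rfl⟩)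
    linarith
  have hcl : ∀ x ∈ Icc q p, ∃ z, d 0 z = 0 ∧ x - 2 * (b - a) ≤ z ∧ z ≤ x := by
    intro x hx
    by_cases hz : d 0 x = 0
    · exact ⟨x, hz, by linarith [hab.lt], le_rfl⟩
    · obtain ⟨a₁, b₁, hab₁, h2, h3, h4⟩ := hcomp _ hx hz
      have := hlen _ _ hab₁ h2 h3
      exact ⟨a₁, hab₁.left, by linarith [h4.2], h4.1.le⟩
  have hab1 := hab.lt
  refine ⟨(a + b) / 2, ⟨by linarith, by linarith⟩, fun hm _ => absurd hm
    (hab.ne _ ⟨by linarith, by linarith⟩), fun a' b' hab' ha' hb' => ?_⟩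
  obtain ⟨rfl, rfl⟩ := hab'.unique hab (by linarith) (by linarith)
  refine hab.lNice_of_calm fun j hj x hx => ?_
  generalize hl' : b' - a' = l at hcl hl ⊢
  have hl0 : 0 < l := by linarith
  have hlη : l ≤ η := by linarith
  have hW := h.abs_le_of_clustered (N := N) (by omega) hM hq hqf (by linarith) hl0 (by linarith)
    (by linarith) hcl ⟨hx.1.le, hx.2.le⟩ (by linarith [hx.1]) (j := j) (by omega)
  have hsm : 4 * N * l ≤ 1 := le_trans (by gcongr) hη1
  calc |d j x| ≤ M * (4 * N * l) ^ (N - j) := hW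
    _ ≤ M * (4 * N * l) ^ (r + 2) := mul_le_mul_of_nonneg_left
        (pow_le_pow_of_le_one (by positivity) hsm (by omega)) hM0.le
    _ = Q * l * (l / 10) ^ (r + 1) := by
        rw [hQ, show (40 * (N:ℝ)) = 10 * (4 * N) by ring, div_pow, mul_pow, mul_pow, mul_pow]
        field_simp
        ring
    _ ≤ c * (l / 10) ^ (r + 1) := by
        refine mul_le_mul_of_nonneg_right (le_trans ?_ hη2) (by positivity)
        gcongr

theorem exists_barrier_left (h : Jet d) (h0 : d 0 0 = 0) (h1 : d 0 1 = 0) (hc : 0 < c) (r : ℕ) {q : ℝ}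
    (hq : q ∈ Icc (0:ℝ) 1) (hqf : FlatAt d q) {δ : ℝ} (hδ : 0 < δ) :
    ∃ m ∈ Ioo (q - δ) q, (d 0 m = 0 → m ∈ Icc (0:ℝ) 1 → FlatAt d m) ∧
      ∀ a b, IsComp d a b → a < m → m < b → RNice d r c a b := by
  obtain ⟨m, hm, hm1, hm2⟩ := h.refl.exists_barrier_right (q := 1 - q) (by simpa [reflJet] using h1)
    (by simpa [reflJet] using h0) hc r ⟨by linarith [hq.2], by linarith [hq.1]⟩
    (fun j => by simp [reflJet, hqf j]) hδ
  refine ⟨1 - m, ⟨by linarith [hm.2], by linarith [hm.1]⟩, fun hm0 hmI j => ?_, fun a b hab ha hb =>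
    IsComp.rNice_of_refl (hm2 _ _ hab.refl (by linarith) (by linarith))⟩
  have := hm1 (by simpa [reflJet] using hm0) ⟨by linarith [hmI.2], by linarith [hmI.1]⟩ j
  simpa [reflJet] using this

theorem exists_small (h : Jet d) (hε : 0 < ε) (r : ℕ) {q : ℝ} (hq : q ∈ Icc (0:ℝ) 1)
    (hqf : FlatAt d q) :
    ∃ δ > 0, ∀ x ∈ Icc (0:ℝ) 1, |x - q| < δ → ∀ j ≤ r, |d j x| ≤ ε := by
  have h1 : ∀ j ∈ Finset.range (r + 1), ∀ᶠ x in 𝓝[Icc 0 1] q, |d j x| ≤ ε := fun j _ => by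
    have h2 := (h.cont j q hq).abs
    rw [ContinuousWithinAt, hqf j, abs_zero] at h2
    exact h2.eventually_le_const hε
  rw [← Filter.eventually_all_finset, eventually_nhdsWithin_iff, Metric.eventually_nhds_iff] at h1
  obtain ⟨δ, hδ, hd⟩ := h1
  exact ⟨δ, hδ, fun x hx hxq j hj => hd (by rwa [Real.dist_eq]) hx j
    (Finset.mem_range.2 (by omega))⟩

/-- Choice of the finitely many fixed points to zoom in on, and of the finitely many components to
modify. -/
theorem exists_selection (h : Jet d) (h0 : d 0 0 = 0) (h1 : d 0 1 = 0) (hc : 0 < c) (hε : 0 < ε)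
    (r : ℕ) : ∃ (B : Finset ℝ) (T : Set (ℝ × ℝ)), T.Finite ∧
      (∀ p ∈ B, p ∈ Icc (0:ℝ) 1 ∧ d 0 p = 0 ∧ ¬ FlatAt d p) ∧
      ((∀ p ∈ Icc (0:ℝ) 1, d 0 p = 0 → ¬ FlatAt d p) → ∀ p ∈ Icc (0:ℝ) 1, d 0 p = 0 → p ∈ B) ∧
      (∀ a b, IsComp d a b → (a, b) ∉ T → a ∉ B ∧ b ∉ B ∧ ∀ j ≤ r, ∀ x ∈ Ioo a b, |d j x| ≤ ε) ∧
      ∀ a b, IsComp d a b → (a, b) ∈ T → (a ∈ B ∨ LNice d r c a b) ∧ (b ∈ B ∨ RNice d r c a b) := by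
  have hloc : ∀ q, ∃ l m, q ∈ Icc (0:ℝ) 1 → FlatAt d q → l < q ∧ q < m ∧
      (∀ x ∈ Icc (0:ℝ) 1, x ∈ Ioo l m → ∀ j ≤ r, |d j x| ≤ ε) ∧
      (d 0 m = 0 → m ∈ Icc (0:ℝ) 1 → FlatAt d m) ∧ (d 0 l = 0 → l ∈ Icc (0:ℝ) 1 → FlatAt d l) ∧
      (∀ a b, IsComp d a b → a < m → m < b → LNice d r c a b) ∧
      ∀ a b, IsComp d a b → a < l → l < b → RNice d r c a b := by
    intro q
    by_cases hq : q ∈ Icc (0:ℝ) 1 ∧ FlatAt d q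
    · obtain ⟨hq, hqf⟩ := hq
      obtain ⟨δ, hδ, hd⟩ := h.exists_small hε r hq hqf
      obtain ⟨m, hm, hm1, hm2⟩ := h.exists_barrier_right h0 h1 hc r hq hqf hδ
      obtain ⟨l, hl, hl1, hl2⟩ := h.exists_barrier_left h0 h1 hc r hq hqf hδ
      refine ⟨l, m, fun _ _ => ⟨hl.2, hm.1, fun x hx hxl => hd x hx ?_, hm1, hl1, hm2, hl2⟩⟩
      rw [abs_lt]
      constructor <;> linarith [hxl.1, hxl.2, hl.1, hm.2]
    · exact ⟨0, 0, fun h2 h3 => absurd ⟨h2, h3⟩ hq⟩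
  choose l m hlm using hloc
  have hcl : IsCompact {q | q ∈ Icc (0:ℝ) 1 ∧ FlatAt d q} := by
    have : {q | q ∈ Icc (0:ℝ) 1 ∧ FlatAt d q} = ⋂ j, {x | x ∈ Icc (0:ℝ) 1 ∧ d j x = 0} := by
      ext x
      simp only [mem_ofPred_eq, mem_iInter, FlatAt]
      exact ⟨fun h j => ⟨h.1, h.2 j⟩, fun h => ⟨(h 0).1, fun j => (h j).2⟩⟩
    rw [this]
    exact (h.isClosed_zeros 0 le_rfl le_rfl).of_isClosed_subset
      (isClosed_iInter fun j => (h.isClosed_zeros j le_rfl le_rfl).isClosed) (iInter_subset _ 0)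
  obtain ⟨t, htZ, htU⟩ := hcl.elim_nhds_subcover (fun q => Ioo (l q) (m q)) fun q hq =>
    Ioo_mem_nhds (hlm q hq.1 hq.2).1 (hlm q hq.1 hq.2).2.1
  set F : Set ℝ := {p | p ∈ Icc (0:ℝ) 1 ∧ d 0 p = 0} \ ⋃ q ∈ t, Ioo (l q) (m q) with hF
  have hFn : ∀ p ∈ F, ¬ FlatAt d p := fun p hp hf => hp.2 (htU ⟨hp.1.1, hf⟩)
  have hFc : IsCompact F := (h.isClosed_zeros 0 le_rfl le_rfl).diff
    (isOpen_biUnion fun _ _ => isOpen_Ioo)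
  have hFf : F.Finite := by
    by_contra hinf
    obtain ⟨p, hp, hacc⟩ := Set.Infinite.exists_accPt_of_subset_isCompact hinf hFc le_rfl
    obtain ⟨δ, hδ, hd⟩ := h.isolated hp.1.1 (hFn p hp)
    rw [accPt_iff_nhds] at hacc
    obtain ⟨q, hq, hqp⟩ := hacc _ (Metric.ball_mem_nhds p hδ)
    have := hd q hq.2.1.1 hq.2.1.2 hqp
    have h2 := hq.1
    rw [Metric.mem_ball, Real.dist_eq] at h2
    linarith
  have hIcc : ∀ {a b}, IsComp d a b → a ∈ Icc (0:ℝ) 1 ∧ b ∈ Icc (0:ℝ) 1 := fun hab =>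
    ⟨⟨hab.nonneg, by linarith [hab.lt, hab.le_one]⟩, ⟨by linarith [hab.lt, hab.nonneg], hab.le_one⟩⟩
  have hleft : ∀ a b, IsComp d a b → (¬ ∃ q ∈ t, l q ≤ a ∧ b ≤ m q) → a ∉ F →
      ∃ q ∈ t, l q < a ∧ a < m q ∧ m q < b := by
    intro a b hab hT haF
    have : a ∈ ⋃ q ∈ t, Ioo (l q) (m q) := by
      by_contra hcon
      exact haF ⟨⟨(hIcc hab).1, hab.left⟩, hcon⟩
    simp only [mem_iUnion] at this
    obtain ⟨q, hqt, hq⟩ := this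
    exact ⟨q, hqt, hq.1, hq.2, not_le.1 fun hle => hT ⟨q, hqt, hq.1.le, hle⟩⟩
  have hright : ∀ a b, IsComp d a b → (¬ ∃ q ∈ t, l q ≤ a ∧ b ≤ m q) → b ∉ F →
      ∃ q ∈ t, a < l q ∧ l q < b ∧ b < m q := by
    intro a b hab hT hbF
    have : b ∈ ⋃ q ∈ t, Ioo (l q) (m q) := by
      by_contra hcon
      exact hbF ⟨⟨(hIcc hab).2, hab.right⟩, hcon⟩
    simp only [mem_iUnion] at this
    obtain ⟨q, hqt, hq⟩ := this
    exact ⟨q, hqt, not_le.1 fun hle => hT ⟨q, hqt, hle, hq.2.le⟩, hq.1, hq.2⟩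
  refine ⟨hFf.toFinset, {T | IsComp d T.1 T.2 ∧ ¬ ∃ q ∈ t, l q ≤ T.1 ∧ T.2 ≤ m q}, ?_, ?_, ?_, ?_, ?_⟩
  · have hP : (F ∪ m '' t).Finite := hFf.union (t.finite_toSet.image m)
    refine (hP.biUnion (t := fun p => {T : ℝ × ℝ | IsComp d T.1 T.2 ∧ T.1 ≤ p ∧ p < T.2})
      fun p _ => ?_).subset ?_
    · refine Set.Subsingleton.finite fun T hT T' hT' => ?_
      have := hT.1.unique hT'.1 (hT.2.1.trans_lt hT'.2.2) (hT'.2.1.trans_lt hT.2.2)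
      exact Prod.ext this.1 this.2
    · rintro ⟨a, b⟩ ⟨hab, hT⟩
      simp only [mem_iUnion]
      by_cases haF : a ∈ F
      · exact ⟨a, Or.inl haF, hab, le_rfl, hab.lt⟩
      · obtain ⟨q, hqt, -, h3, h4⟩ := hleft a b hab hT haF
        exact ⟨m q, Or.inr ⟨q, hqt, rfl⟩, hab, h3.le, h4⟩
  · intro p hp
    rw [Set.Finite.mem_toFinset] at hp
    exact ⟨hp.1.1, hp.1.2, hFn p hp⟩
  · intro hno p hp hp0
    rw [Set.Finite.mem_toFinset]
    refine ⟨⟨hp, hp0⟩, fun hpU => ?_⟩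
    simp only [mem_iUnion] at hpU
    obtain ⟨q, hqt, -⟩ := hpU
    exact hno q (htZ q hqt).1 ((htZ q hqt).2 0) (htZ q hqt).2
  · intro a b hab hT
    have : ∃ q ∈ t, l q ≤ a ∧ b ≤ m q := by
      by_contra hcon
      exact hT ⟨hab, hcon⟩
    obtain ⟨q, hqt, h2, h3⟩ := this
    obtain ⟨-, -, h4, h5, h6, -⟩ := hlm q (htZ q hqt).1 (htZ q hqt).2
    have hlt := hab.lt
    refine ⟨fun haB => ?_, fun hbB => ?_, fun j hj x hx => h4 x
      ⟨hab.nonneg.trans hx.1.le, hx.2.le.trans hab.le_one⟩ ⟨h2.trans_lt hx.1, hx.2.trans_le h3⟩ j hj⟩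
    · rw [Set.Finite.mem_toFinset] at haB
      rcases h2.eq_or_lt with h7 | h7
      · rw [h7] at h6
        exact hFn a haB (h6 hab.left (hIcc hab).1)
      · exact haB.2 (mem_biUnion hqt ⟨h7, by linarith⟩)
    · rw [Set.Finite.mem_toFinset] at hbB
      rcases h3.eq_or_lt with h7 | h7
      · rw [← h7] at h5
        exact hFn b hbB (h5 hab.right (hIcc hab).2)
      · exact hbB.2 (mem_biUnion hqt ⟨by linarith, h7⟩)
  · rintro a b hab ⟨-, hT⟩
    simp only [Set.Finite.mem_toFinset]
    constructor
    · by_cases haF : a ∈ F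
      · exact Or.inl haF
      · obtain ⟨q, hqt, -, h3, h4⟩ := hleft a b hab hT haF
        exact Or.inr ((hlm q (htZ q hqt).1 (htZ q hqt).2).2.2.2.2.2.1 a b hab h3 h4)
    · by_cases hbF : b ∈ F
      · exact Or.inl hbF
      · obtain ⟨q, hqt, h3, h4, -⟩ := hright a b hab hT hbF
        exact Or.inr ((hlm q (htZ q hqt).1 (htZ q hqt).2).2.2.2.2.2.2 a b hab h3 h4)

end Jet

theorem ContDiffOn.boundedVariationOn_Icc {h : ℝ → ℝ} (hh : ContDiffOn ℝ ∞ h (Icc 0 1)) :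
    BoundedVariationOn h (Icc 0 1) := by
  obtain ⟨K, hK⟩ := hh.exists_lipschitzOnWith (by simp) (convex_Icc _ _) isCompact_Icc
  have := hK.locallyBoundedVariationOn 0 1 (by simp) (by simp)
  rwa [inter_self] at this

theorem eVariationOn_add_le (f g : ℝ → ℝ) (s : Set ℝ) :
    eVariationOn (fun x => f x + g x) s ≤ eVariationOn f s + eVariationOn g s := by
  refine iSup_le fun p => ?_
  calc ∑ i ∈ Finset.range p.1, edist (f (p.2.1 (i + 1)) + g (p.2.1 (i + 1))) (f (p.2.1 i) + g (p.2.1 i))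
      ≤ ∑ i ∈ Finset.range p.1, (edist (f (p.2.1 (i + 1))) (f (p.2.1 i)) +
          edist (g (p.2.1 (i + 1))) (g (p.2.1 i))) :=
        Finset.sum_le_sum fun i _ => edist_add_add_le _ _ _ _
    _ ≤ _ := by
        rw [Finset.sum_add_distrib]
        exact add_le_add (eVariationOn.sum_le p.2.2.1 p.2.2.2) (eVariationOn.sum_le p.2.2.1 p.2.2.2)

/-- A smooth diffeomorphism of the line fixing `0` and `1`. -/
structure GDiff (φ : Equiv.Perm ℝ) : Prop where
  smooth : ContDiff ℝ ∞ φ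
  deriv_pos : ∀ x, 0 < deriv φ x
  zero : φ 0 = 0
  one : φ 1 = 1

namespace GDiff

variable {φ ψ : Equiv.Perm ℝ}

theorem id : GDiff 1 where
  smooth := contDiff_id
  deriv_pos x := by
    have : ((1 : Equiv.Perm ℝ) : ℝ → ℝ) = _root_.id := rfl
    rw [this]; simp
  zero := rfl
  one := rfl

theorem differentiable (h : GDiff φ) : Differentiable ℝ φ := h.smooth.differentiable (by simp)

theorem mul (h : GDiff φ) (h' : GDiff ψ) : GDiff (φ * ψ) where
  smooth := by
    rw [Equiv.Perm.coe_mul]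
    exact h.smooth.comp h'.smooth
  deriv_pos x := by
    rw [Equiv.Perm.coe_mul, deriv_comp x (h.differentiable _) (h'.differentiable _)]
    exact mul_pos (h.deriv_pos _) (h'.deriv_pos _)
  zero := by rw [Equiv.Perm.mul_apply, h'.zero, h.zero]
  one := by rw [Equiv.Perm.mul_apply, h'.one, h.one]

theorem inv (h : GDiff φ) : GDiff φ⁻¹ := by
  have hcomp : (φ⁻¹ : Equiv.Perm ℝ) ∘ φ = _root_.id := by ext x; simp
  have hs : ContDiff ℝ ∞ (φ⁻¹ : Equiv.Perm ℝ) := by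
    rw [contDiff_iff_contDiffAt]
    intro x
    have := ContDiffAt.of_comp (φ := (φ⁻¹ : Equiv.Perm ℝ)) (h.smooth.contDiffAt (x := φ⁻¹ x))
      (h.deriv_pos _).ne' contDiffAt_id (by rw [hcomp])
    rwa [apply_inv_perm] at this
  refine ⟨hs, fun x => ?_, ?_, ?_⟩
  · have h1 : HasDerivAt ((φ⁻¹ : Equiv.Perm ℝ) ∘ φ)
        (deriv (φ⁻¹ : Equiv.Perm ℝ) x * deriv φ (φ⁻¹ x)) (φ⁻¹ x) := by
      refine HasDerivAt.comp _ ?_ (h.differentiable _).hasDerivAt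
      rw [apply_inv_perm]
      exact (hs.differentiable (by simp) x).hasDerivAt
    rw [hcomp] at h1
    have h2 := h1.unique (hasDerivAt_id _)
    have := h.deriv_pos (φ⁻¹ x)
    by_contra hneg
    nlinarith [mul_nonneg_of_nonpos_of_nonpos (not_lt.1 hneg) (neg_nonpos.2 this.le)]
  · rw [Equiv.Perm.inv_eq_iff_eq, h.zero]
  · rw [Equiv.Perm.inv_eq_iff_eq, h.one]

theorem strictMono (h : GDiff φ) : StrictMono φ := strictMono_of_deriv_pos h.deriv_pos

theorem mem_Icc_iff (h : GDiff φ) (x : ℝ) : φ x ∈ Icc (0:ℝ) 1 ↔ x ∈ Icc (0:ℝ) 1 := by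
  have h0 := h.strictMono.le_iff_le (a := 0) (b := x)
  have h1 := h.strictMono.le_iff_le (a := x) (b := 1)
  rw [h.zero] at h0
  rw [h.one] at h1
  rw [mem_Icc, mem_Icc, h0, h1]

theorem mem_Ioo_iff (h : GDiff φ) (x : ℝ) : φ x ∈ Ioo (0:ℝ) 1 ↔ x ∈ Ioo (0:ℝ) 1 := by
  have h0 := h.strictMono.lt_iff_lt (a := 0) (b := x)
  have h1 := h.strictMono.lt_iff_lt (a := x) (b := 1)
  rw [h.zero] at h0
  rw [h.one] at h1
  rw [mem_Ioo, mem_Ioo, h0, h1]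

theorem contDiff_logD (h : GDiff φ) : ContDiff ℝ ∞ (logD φ) :=
  contDiff_iff_contDiffAt.2 fun x => h.smooth.contDiffAt.logD (h.deriv_pos x)

end GDiff

/-- A smooth diffeomorphism of `[0, 1]`, as a permutation of the line. -/
structure IccDiff (f : Equiv.Perm ℝ) : Prop where
  smooth : ContDiffOn ℝ ∞ f (Icc 0 1)
  mem_iff : ∀ x, f x ∈ Icc (0:ℝ) 1 ↔ x ∈ Icc (0:ℝ) 1
  deriv_pos : ∀ x ∈ Icc (0:ℝ) 1, 0 < derivWithin f (Icc 0 1) x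
  zero : f 0 = 0
  one : f 1 = 1

theorem uniqueDiffOn_unitIcc : UniqueDiffOn ℝ (Icc (0:ℝ) 1) := uniqueDiffOn_Icc zero_lt_one

theorem GDiff.iccDiff {φ : Equiv.Perm ℝ} (h : GDiff φ) : IccDiff φ where
  smooth := h.smooth.contDiffOn
  mem_iff := h.mem_Icc_iff
  deriv_pos x hx := by
    rw [(h.differentiable x).derivWithin (uniqueDiffOn_unitIcc x hx)]
    exact h.deriv_pos x
  zero := h.zero
  one := h.one

/-- The derivatives of the displacement on `[0, 1]`. -/
noncomputable def dsp (f : ℝ → ℝ) (j : ℕ) (x : ℝ) : ℝ :=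
  iteratedDerivWithin j (fun x => f x - x) (Icc 0 1) x

theorem dsp_zero (f : ℝ → ℝ) (x : ℝ) : dsp f 0 x = f x - x := by simp [dsp]

theorem dsp_congr {f g : ℝ → ℝ} {x δ : ℝ} (hδ : 0 < δ) (hx : x ∈ Icc (0:ℝ) 1)
    (h : ∀ y ∈ Icc (0:ℝ) 1, |y - x| < δ → f y = g y) (j : ℕ) : dsp f j x = dsp g j x := by
  refine EventuallyEq.iteratedDerivWithin_eq ?_ ?_
  · rw [EventuallyEq, eventually_nhdsWithin_iff, Metric.eventually_nhds_iff]
    exact ⟨δ, hδ, fun y hy hyI => by rw [h y hyI (by rwa [Real.dist_eq] at hy)]⟩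
  · simp only [h x hx (by simpa using hδ)]

namespace IccDiff

variable {f g φ : Equiv.Perm ℝ}

theorem mul (hf : IccDiff f) (hg : IccDiff g) : IccDiff (f * g) where
  smooth := by
    rw [Equiv.Perm.coe_mul]
    exact hf.smooth.comp hg.smooth fun x hx => (hg.mem_iff x).2 hx
  mem_iff x := by rw [Equiv.Perm.mul_apply, hf.mem_iff, hg.mem_iff]
  deriv_pos x hx := by
    have hx' := (hg.mem_iff x).2 hx
    rw [Equiv.Perm.coe_mul, derivWithin_comp (s' := Icc 0 1) x
      (hf.smooth.differentiableOn (by simp) _ hx') (hg.smooth.differentiableOn (by simp) _ hx)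
      (fun y hy => (hg.mem_iff y).2 hy)]
    exact mul_pos (hf.deriv_pos _ hx') (hg.deriv_pos _ hx)
  zero := by rw [Equiv.Perm.mul_apply, hg.zero, hf.zero]
  one := by rw [Equiv.Perm.mul_apply, hg.one, hf.one]

theorem conj (hf : IccDiff f) (hφ : GDiff φ) : IccDiff (φ * f * φ⁻¹) :=
  (hφ.iccDiff.mul hf).mul hφ.inv.iccDiff

theorem pow (hf : IccDiff f) (n : ℕ) : IccDiff (f ^ n) := by
  induction n with
  | zero => exact GDiff.id.iccDiff
  | succ n ih => rw [pow_succ]; exact ih.mul hf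

theorem contDiffAt (hf : IccDiff f) {x : ℝ} (hx : x ∈ Ioo (0:ℝ) 1) : ContDiffAt ℝ ∞ f x :=
  hf.smooth.contDiffAt (Icc_mem_nhds hx.1 hx.2)

theorem derivWithin_eq (hf : IccDiff f) {x : ℝ} (hx : x ∈ Ioo (0:ℝ) 1) :
    derivWithin f (Icc 0 1) x = deriv f x :=
  ((hf.contDiffAt hx).differentiableAt (by simp)).derivWithin
    (uniqueDiffOn_unitIcc x (Ioo_subset_Icc_self hx))

theorem iooDiff (hf : IccDiff f) : IooDiff f where
  mem_iff x := by
    have h0 : f x = 0 ↔ x = 0 := ⟨fun h => f.injective (h.trans hf.zero.symm), fun h => by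
      rw [h, hf.zero]⟩
    have h1 : f x = 1 ↔ x = 1 := ⟨fun h => f.injective (h.trans hf.one.symm), fun h => by
      rw [h, hf.one]⟩
    have key : ∀ y : ℝ, y ∈ Ioo (0:ℝ) 1 ↔ y ∈ Icc (0:ℝ) 1 ∧ y ≠ 0 ∧ y ≠ 1 := fun y =>
      ⟨fun h => ⟨Ioo_subset_Icc_self h, h.1.ne', h.2.ne⟩, fun h =>
        ⟨h.1.1.lt_of_ne' h.2.1, h.1.2.lt_of_ne h.2.2⟩⟩
    rw [key, key, hf.mem_iff, Ne, Ne, h0, h1]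
  smooth x hx := hf.contDiffAt hx
  deriv_pos x hx := by
    rw [← hf.derivWithin_eq hx]
    exact hf.deriv_pos x (Ioo_subset_Icc_self hx)

theorem strictMonoOn (hf : IccDiff f) : StrictMonoOn f (Icc 0 1) := by
  refine strictMonoOn_of_deriv_pos (convex_Icc _ _) hf.smooth.continuousOn fun x hx => ?_
  rw [interior_Icc] at hx
  exact hf.iooDiff.deriv_pos x hx

theorem smooth_logDeriv (hf : IccDiff f) :
    ContDiffOn ℝ ∞ (fun x => Real.log (derivWithin f (Icc 0 1) x)) (Icc 0 1) :=
  (hf.smooth.derivWithin uniqueDiffOn_unitIcc (by simp)).log fun x hx => (hf.deriv_pos x hx).ne'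

theorem logD_eq (hf : IccDiff f) {x : ℝ} (hx : x ∈ Ioo (0:ℝ) 1) :
    logD f x = Real.log (derivWithin f (Icc 0 1) x) := by rw [logD, hf.derivWithin_eq hx]

theorem logDBounded (hf : IccDiff f) : LogDBounded f := fun j => by
  obtain ⟨M, hM⟩ := isCompact_Icc.exists_bound_of_continuousOn
    (hf.smooth_logDeriv.continuousOn_iteratedDerivWithin (m := j)
      (by exact_mod_cast le_top) uniqueDiffOn_unitIcc)
  refine ⟨M, fun x hx => ?_⟩
  have h1 := hM x (Ioo_subset_Icc_self hx)
  rw [iteratedDerivWithin_eq_iteratedDeriv uniqueDiffOn_unitIcc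
    ((hf.smooth_logDeriv.contDiffAt (Icc_mem_nhds hx.1 hx.2)).of_le (by exact_mod_cast le_top))
    (Ioo_subset_Icc_self hx)] at h1
  have h2 : logD f =ᶠ[𝓝 x] fun x => Real.log (derivWithin f (Icc 0 1) x) := by
    filter_upwards [Ioo_mem_nhds hx.1 hx.2] with y hy using hf.logD_eq hy
  rwa [h2.iteratedDeriv_eq]

theorem smooth_disp (hf : IccDiff f) : ContDiffOn ℝ ∞ (fun x => f x - x) (Icc 0 1) :=
  hf.smooth.sub contDiffOn_id

theorem dsp_eq (hf : IccDiff f) (j : ℕ) {x : ℝ} (hx : x ∈ Ioo (0:ℝ) 1) :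
    dsp f j x = iteratedDeriv j (fun x => f x - x) x :=
  iteratedDerivWithin_eq_iteratedDeriv uniqueDiffOn_unitIcc
    ((hf.smooth_disp.contDiffAt (Icc_mem_nhds hx.1 hx.2)).of_le (by exact_mod_cast le_top))
    (Ioo_subset_Icc_self hx)

theorem jet (hf : IccDiff f) : Jet (dsp f) where
  cont j := hf.smooth_disp.continuousOn_iteratedDerivWithin (by exact_mod_cast le_top)
    uniqueDiffOn_unitIcc
  der j x hx := by
    rw [hf.dsp_eq _ hx]
    have h1 := ContDiffAt.hasDerivAt_iteratedDeriv
      (hf.smooth_disp.contDiffAt (Icc_mem_nhds hx.1 hx.2)) j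
    refine h1.congr_of_eventuallyEq ?_
    filter_upwards [Ioo_mem_nhds hx.1 hx.2] with y hy using hf.dsp_eq j hy

theorem dsp_one (hf : IccDiff f) {x : ℝ} (hx : x ∈ Icc (0:ℝ) 1) :
    dsp f 1 x = derivWithin f (Icc 0 1) x - 1 := by
  rw [dsp, iteratedDerivWithin_one]
  have h1 := ((hf.smooth.differentiableOn (by simp) x hx).hasDerivWithinAt.sub
    (hasDerivWithinAt_id x _))
  exact h1.derivWithin (uniqueDiffOn_unitIcc x hx)

end IccDiff

namespace SublinVar

variable {f φ : Equiv.Perm ℝ}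

theorem of_tendsto (hf : IccDiff f)
    (h : Tendsto (fun n : ℕ => (eVariationOn (fun x => Real.log (derivWithin f^[n] (Icc 0 1) x))
      (Icc 0 1)).toReal / n) atTop (𝓝 0)) : SublinVar f := by
  refine ⟨_, fun n => ?_, h⟩
  have hn := hf.pow n
  have hb := hn.smooth_logDeriv.boundedVariationOn_Icc
  rw [Equiv.Perm.coe_pow] at hb
  rw [ENNReal.ofReal_toReal hb]
  refine (eVariationOn.congr fun x hx => ?_).trans_le (eVariationOn.mono _ Ioo_subset_Icc_self)
  have := hn.logD_eq hx
  rwa [Equiv.Perm.coe_pow] at this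

theorem conj (h : SublinVar f) (hf : IccDiff f) (hφ : GDiff φ) : SublinVar (φ * f * φ⁻¹ : Equiv.Perm ℝ) := by
  obtain ⟨V, hV, hV0⟩ := h
  have b1 := hφ.contDiff_logD.contDiffOn.boundedVariationOn_Icc
  have b2 := hφ.inv.contDiff_logD.contDiffOn.boundedVariationOn_Icc
  set C₁ := (eVariationOn (logD φ) (Icc 0 1)).toReal with hC₁
  set C₂ := (eVariationOn (logD (φ⁻¹ : Equiv.Perm ℝ)) (Icc 0 1)).toReal with hC₂
  refine ⟨fun n => C₁ + (max (V n) 0 + C₂), fun n => ?_, ?_⟩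
  · have hn := (hf.pow n).iooDiff
    have e : ((φ * f * φ⁻¹ : Equiv.Perm ℝ) : ℝ → ℝ)^[n] = φ ∘ (f ^ n : Equiv.Perm ℝ) ∘ (φ⁻¹ : Equiv.Perm ℝ) := by
      rw [← Equiv.Perm.coe_pow, conj_pow, Equiv.Perm.coe_mul, Equiv.Perm.coe_mul]
      rfl
    have hi : ∀ x ∈ Ioo (0:ℝ) 1, φ⁻¹ x ∈ Ioo (0:ℝ) 1 := fun x hx => (hφ.inv.mem_Ioo_iff x).2 hx
    have e2 : ∀ x ∈ Ioo (0:ℝ) 1, logD ((φ * f * φ⁻¹ : Equiv.Perm ℝ) : ℝ → ℝ)^[n] x =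
        (logD φ ∘ ((f ^ n : Equiv.Perm ℝ) ∘ (φ⁻¹ : Equiv.Perm ℝ))) x +
          ((logD f^[n] ∘ (φ⁻¹ : Equiv.Perm ℝ)) x + logD (φ⁻¹ : Equiv.Perm ℝ) x) := fun x hx => by
      have d1 := (hn.smooth _ (hi x hx)).differentiableAt (by simp)
      rw [e, logD_comp (hφ.differentiable _) (d1.comp x (hφ.inv.differentiable x)) (hφ.deriv_pos _)
        ?_, logD_comp d1 (hφ.inv.differentiable x) (hn.deriv_pos _ (hi x hx)) (hφ.inv.deriv_pos x)]
      · rw [Equiv.Perm.coe_pow]; rfl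
      · rw [deriv_comp x d1 (hφ.inv.differentiable x)]
        exact mul_pos (hn.deriv_pos _ (hi x hx)) (hφ.inv.deriv_pos x)
    rw [eVariationOn.congr e2, ENNReal.ofReal_add ENNReal.toReal_nonneg (by positivity),
      ENNReal.ofReal_add (le_max_right _ _) ENNReal.toReal_nonneg,
      ENNReal.ofReal_toReal b1, ENNReal.ofReal_toReal b2]
    refine (eVariationOn_add_le _ _ _).trans (add_le_add ?_ ((eVariationOn_add_le _ _ _).trans
      (add_le_add ?_ ?_)))
    · refine eVariationOn.comp_le_of_monotoneOn _ _ (fun x hx y hy hxy => ?_) fun x hx => ?_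
      · exact hn.strictMonoOn.monotoneOn (hi x hx) (hi y hy) (hφ.inv.strictMono.monotone hxy)
      · exact Ioo_subset_Icc_self ((hn.mem_iff _).2 (hi x hx))
    · refine (eVariationOn.comp_le_of_monotoneOn _ _ (hφ.inv.strictMono.monotone.monotoneOn _)
        hi).trans ((hV n).trans (ENNReal.ofReal_le_ofReal (le_max_left _ _)))
    · exact eVariationOn.mono _ Ioo_subset_Icc_self
  · have h1 : Tendsto (fun n : ℕ => (C₁ + C₂) / (n:ℝ)) atTop (𝓝 0) :=
      tendsto_const_div_atTop_nhds_zero_nat _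
    have h2 : Tendsto (fun n : ℕ => max (V n / n) 0) atTop (𝓝 0) := by
      simpa using hV0.max (tendsto_const_nhds (x := (0:ℝ)))
    have h3 := h1.add h2
    rw [add_zero] at h3
    refine h3.congr fun n => ?_
    have h4 : max (V n / n) 0 = max (V n) 0 / (n:ℝ) := by
      rw [← max_div_div_right (Nat.cast_nonneg n), zero_div]
    rw [h4]
    ring

/-- Fixed points are tangent to the identity. -/
theorem dsp_one_eq_zero (h : SublinVar f) (hf : IccDiff f) {p : ℝ} (hp : p ∈ Icc (0:ℝ) 1)
    (hfp : f p = p) : dsp f 1 p = 0 := by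
  obtain ⟨V, hV, hV0⟩ := h
  set D := derivWithin f (Icc 0 1) p with hD
  have hD0 : 0 < D := hf.deriv_pos p hp
  have key : ∀ n : ℕ, n * |Real.log D| ≤ max (V n) 0 := fun n => by
    set G : ℝ → ℝ := fun x => Real.log (derivWithin (f ^ n : Equiv.Perm ℝ) (Icc 0 1) x) with hG
    have hn := hf.pow n
    have hGc : ContinuousOn G (Icc 0 1) := hn.smooth_logDeriv.continuousOn
    have hGp : G p = n * Real.log D := by
      have h1 := ((hf.smooth.differentiableOn (by simp) p hp).hasDerivWithinAt).iterate p hfp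
        (fun x hx => (hf.mem_iff x).2 hx) n
      rw [hG]
      simp only
      rw [Equiv.Perm.coe_pow, h1.derivWithin (uniqueDiffOn_unitIcc p hp), Real.log_pow]
    obtain ⟨z, hz, hz'⟩ := exists_deriv_eq_slope (f ^ n : Equiv.Perm ℝ) zero_lt_one
      hn.smooth.continuousOn (fun x hx =>
        ((hn.contDiffAt hx).differentiableAt (by simp)).differentiableWithinAt)
    have hGz : G z = 0 := by
      rw [hG]
      simp only
      rw [hn.derivWithin_eq hz, hz', hn.zero, hn.one]
      simp
    have hbd : ∀ x ∈ Ioo (0:ℝ) 1, |G x| ≤ max (V n) 0 := fun x hx => by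
      have h1 := eVariationOn.edist_le (logD f^[n]) hx hz
      have h2 := h1.trans ((hV n).trans (ENNReal.ofReal_le_ofReal (le_max_left _ 0)))
      rw [edist_dist, ENNReal.ofReal_le_ofReal_iff (le_max_right _ _), Real.dist_eq,
        ← Equiv.Perm.coe_pow, hn.logD_eq hx, hn.logD_eq hz] at h2
      change |G x - G z| ≤ _ at h2
      rwa [hGz, sub_zero] at h2
    have : |G p| ≤ max (V n) 0 := by
      have hcl : p ∈ closure (Ioo (0:ℝ) 1) := by rwa [closure_Ioo (by norm_num)]
      have : (𝓝[Ioo (0:ℝ) 1] p).NeBot := mem_closure_iff_nhdsWithin_neBot.1 hcl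
      have hc : Tendsto (fun x => |G x|) (𝓝[Ioo 0 1] p) (𝓝 |G p|) :=
        ((hGc p hp).mono Ioo_subset_Icc_self).abs
      exact le_of_tendsto hc (eventually_nhdsWithin_of_forall hbd)
    rwa [hGp, abs_mul, Nat.abs_cast] at this
  have h2 : Tendsto (fun n : ℕ => max (V n / n) 0) atTop (𝓝 0) := by
    simpa using hV0.max (tendsto_const_nhds (x := (0:ℝ)))
  have h3 : |Real.log D| ≤ 0 := by
    refine ge_of_tendsto h2 ?_
    filter_upwards [eventually_gt_atTop 0] with n hn
    have hn' : (0:ℝ) < n := by exact_mod_cast hn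
    have h4 : max (V n / n) 0 = max (V n) 0 / (n:ℝ) := by
      rw [← max_div_div_right hn'.le, zero_div]
    rw [h4, le_div_iff₀ hn', mul_comm]
    exact key n
  have h4 : Real.log D = 0 := by simpa using h3
  rw [hf.dsp_one hp, ← hD, ← Real.exp_log hD0, h4, Real.exp_zero, sub_self]

end SublinVar

/-- The affine map `x ↦ p + q x`. -/
noncomputable def affinePerm (p q : ℝ) (hq : q ≠ 0) : Equiv.Perm ℝ where
  toFun x := p + q * x
  invFun x := (x - p) / q
  left_inv x := by field_simp; ring
  right_inv x := by field_simp; ring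

theorem affinePerm_apply {p q : ℝ} (hq : q ≠ 0) (x : ℝ) : affinePerm p q hq x = p + q * x := rfl

theorem affinePerm_inv_apply {p q : ℝ} (hq : q ≠ 0) (x : ℝ) :
    (affinePerm p q hq)⁻¹ x = (x - p) / q := rfl

theorem deriv_affine_conj (g : ℝ → ℝ) {p q : ℝ} (hq : q ≠ 0) (x : ℝ) :
    deriv (fun x => (g (p + q * x) - p) / q) x = deriv g (p + q * x) := by
  have h := iteratedDeriv_comp_affine g p q 1 x
  simp only [iteratedDeriv_one, pow_one] at h
  rw [deriv_div_const, deriv_sub_const, h]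
  field_simp

theorem iteratedDeriv_affine_conj_sub (g : ℝ → ℝ) {p q : ℝ} (hq : q ≠ 0) (j : ℕ) (x : ℝ) :
    iteratedDeriv j (fun x => (g (p + q * x) - p) / q - x) x =
      q⁻¹ * (q ^ j * iteratedDeriv j (fun x => g x - x) (p + q * x)) := by
  rw [← iteratedDeriv_comp_affine (fun x => g x - x), ← iteratedDeriv_const_mul_field]
  congr 1
  ext y
  field_simp
  ring

/-- A correspondence between `(0, 1)` and `(a, b)`. -/
structure AffineUnit (p q a b : ℝ) : Prop where
  ne : q ≠ 0
  le_one : |q| ≤ 1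
  mem_iff : ∀ σ y : ℝ, p + q * y ∈ Ioo (a + |q| * σ) (b - |q| * σ) ↔ y ∈ Ioo σ (1 - σ)

theorem AffineUnit.of_pos {a b : ℝ} (ha : 0 ≤ a) (hab : a < b) (hb : b ≤ 1) :
    AffineUnit a (b - a) a b where
  ne := (sub_pos.2 hab).ne'
  le_one := by rw [abs_of_pos (sub_pos.2 hab)]; linarith
  mem_iff σ y := by
    have h := sub_pos.2 hab
    rw [abs_of_pos h, mem_Ioo, mem_Ioo, add_lt_add_iff_left, mul_lt_mul_iff_right₀ h]
    refine and_congr_right fun _ => ?_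
    rw [← mul_lt_mul_iff_right₀ h (b := y)]
    constructor <;> intro <;> linarith

theorem AffineUnit.of_neg {a b : ℝ} (ha : 0 ≤ a) (hab : a < b) (hb : b ≤ 1) :
    AffineUnit b (-(b - a)) a b where
  ne := (neg_neg_of_pos (sub_pos.2 hab)).ne
  le_one := by rw [abs_neg, abs_of_pos (sub_pos.2 hab)]; linarith
  mem_iff σ y := by
    have h := sub_pos.2 hab
    rw [abs_neg, abs_of_pos h, mem_Ioo, mem_Ioo, ← mul_lt_mul_iff_right₀ h (b := σ),
      ← mul_lt_mul_iff_right₀ h (b := y), and_comm]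
    refine and_congr ?_ ?_ <;> constructor <;> intro <;> linarith

namespace AffineUnit

variable {p q a b : ℝ} {f : Equiv.Perm ℝ}

theorem mem_Ioo_iff (h : AffineUnit p q a b) (y : ℝ) : p + q * y ∈ Ioo a b ↔ y ∈ Ioo (0:ℝ) 1 := by
  simpa using h.mem_iff 0 y

theorem conj_apply (h : AffineUnit p q a b) (g : Equiv.Perm ℝ) :
    (((affinePerm p q h.ne)⁻¹ * g * affinePerm p q h.ne : Equiv.Perm ℝ) : ℝ → ℝ) =
      fun x => (g (p + q * x) - p) / q := rfl

theorem iooDiff (h : AffineUnit p q a b) (hf : IooDiff f) (hsub : Ioo a b ⊆ Ioo 0 1)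
    (hmem : ∀ x, f x ∈ Ioo a b ↔ x ∈ Ioo a b) :
    IooDiff ((affinePerm p q h.ne)⁻¹ * f * affinePerm p q h.ne) where
  mem_iff x := by
    rw [← h.mem_Ioo_iff, ← h.mem_Ioo_iff x, ← hmem (p + q * x), h.conj_apply,
      mul_div_cancel₀ _ h.ne, add_sub_cancel]
  smooth x hx := by
    rw [h.conj_apply]
    have := hf.smooth _ (hsub ((h.mem_Ioo_iff x).2 hx))
    have h2 : ContDiffAt ℝ ∞ (fun x : ℝ => p + q * x) x := by fun_prop
    exact ((this.comp x h2).sub contDiffAt_const).div_const q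
  deriv_pos x hx := by
    rw [h.conj_apply, deriv_affine_conj _ h.ne]
    exact hf.deriv_pos _ (hsub ((h.mem_Ioo_iff x).2 hx))

theorem logD_iterate (h : AffineUnit p q a b) (n : ℕ) :
    logD (((affinePerm p q h.ne)⁻¹ * f * affinePerm p q h.ne : Equiv.Perm ℝ) : ℝ → ℝ)^[n] =
      fun x => logD f^[n] (p + q * x) := by
  have e : ((affinePerm p q h.ne)⁻¹ * f * affinePerm p q h.ne) ^ n =
      (affinePerm p q h.ne)⁻¹ * f ^ n * affinePerm p q h.ne := by
    have := conj_pow (a := (affinePerm p q h.ne)⁻¹) (b := f) (i := n)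
    rwa [inv_inv] at this
  ext x
  rw [← Equiv.Perm.coe_pow, e, h.conj_apply, logD, deriv_affine_conj _ h.ne, logD,
    Equiv.Perm.coe_pow]

theorem logDBounded (h : AffineUnit p q a b) (hf : LogDBounded f) (hsub : Ioo a b ⊆ Ioo 0 1) :
    LogDBounded ((affinePerm p q h.ne)⁻¹ * f * affinePerm p q h.ne : Equiv.Perm ℝ) := fun j => by
  obtain ⟨M, hM⟩ := hf j
  refine ⟨M, fun x hx => ?_⟩
  have e := h.logD_iterate (f := f) 1
  simp only [Function.iterate_one] at e
  rw [e, iteratedDeriv_comp_affine, abs_mul, abs_pow]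
  exact (mul_le_of_le_one_left (abs_nonneg _) (pow_le_one₀ (abs_nonneg _) h.le_one)).trans
    (hM _ (hsub ((h.mem_Ioo_iff x).2 hx)))

theorem sublinVar (h : AffineUnit p q a b) (hf : SublinVar f) (hsub : Ioo a b ⊆ Ioo 0 1) :
    SublinVar ((affinePerm p q h.ne)⁻¹ * f * affinePerm p q h.ne : Equiv.Perm ℝ) := by
  obtain ⟨V, hV, hV0⟩ := hf
  refine ⟨V, fun n => ?_, hV0⟩
  rw [h.logD_iterate]
  refine le_trans ?_ (hV n)
  have hmaps : MapsTo (fun x : ℝ => p + q * x) (Ioo 0 1) (Ioo 0 1) := fun x hx =>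
    hsub ((h.mem_Ioo_iff x).2 hx)
  rcases h.ne.lt_or_gt with hq | hq
  · exact eVariationOn.comp_le_of_antitoneOn (logD f^[n]) (fun x : ℝ => p + q * x)
      (fun x _ y _ hxy => by simpa using mul_le_mul_of_nonpos_left hxy hq.le) hmaps
  · exact eVariationOn.comp_le_of_monotoneOn (logD f^[n]) (fun x : ℝ => p + q * x)
      (fun x _ y _ hxy => by simpa using mul_le_mul_of_nonneg_left hxy hq.le) hmaps

theorem gdiff (h : AffineUnit p q a b) (ha : 0 ≤ a) (hb : b ≤ 1) {φ : Equiv.Perm ℝ}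
    (hφ : CompactDiff φ) : GDiff (affinePerm p q h.ne * φ * (affinePerm p q h.ne)⁻¹) ∧
      ∃ σ > 0, ∀ x ∉ Ioo (a + σ) (b - σ),
        (affinePerm p q h.ne * φ * (affinePerm p q h.ne)⁻¹) x = x := by
  obtain ⟨σ, hσ, hid⟩ := hφ.eq_id
  have hq := abs_pos.2 h.ne
  have happ : ∀ x, (affinePerm p q h.ne * φ * (affinePerm p q h.ne)⁻¹) x =
    p + q * φ ((x - p) / q) := fun x => rfl
  have hback : ∀ x, p + q * ((x - p) / q) = x := fun x => by field_simp [h.ne]; ring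
  have hid' : ∀ x ∉ Ioo (a + |q| * σ) (b - |q| * σ),
      (affinePerm p q h.ne * φ * (affinePerm p q h.ne)⁻¹) x = x := fun x hx => by
    rw [happ, hid, hback]
    rwa [← h.mem_iff, hback]
  have key : ∀ x, ContDiffAt ℝ ∞ (affinePerm p q h.ne * φ * (affinePerm p q h.ne)⁻¹) x ∧
      0 < deriv (affinePerm p q h.ne * φ * (affinePerm p q h.ne)⁻¹) x := fun x => by
    by_cases hx : x ∈ Ioo a b
    · have e : ((affinePerm p q h.ne * φ * (affinePerm p q h.ne)⁻¹ : Equiv.Perm ℝ) : ℝ → ℝ) =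
          fun x => p + q * φ (-p / q + q⁻¹ * x) := by
        ext y
        rw [happ]
        congr 3
        field_simp [h.ne]
        ring
      have hx' : -p / q + q⁻¹ * x ∈ Ioo (0:ℝ) 1 := by
        rw [← h.mem_Ioo_iff]
        convert hx using 1
        field_simp [h.ne]
        ring
      rw [e]
      refine ⟨contDiffAt_const.add (contDiffAt_const.mul ((hφ.diff.smooth _ hx').comp x
        (by fun_prop))), ?_⟩
      have h1 := iteratedDeriv_comp_affine φ (-p / q) q⁻¹ 1 x
      simp only [iteratedDeriv_one, pow_one] at h1
      rw [deriv_const_add, deriv_const_mul_field, h1, mul_inv_cancel_left₀ h.ne]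
      exact hφ.diff.deriv_pos _ hx'
    · have e : ((affinePerm p q h.ne * φ * (affinePerm p q h.ne)⁻¹ : Equiv.Perm ℝ) : ℝ → ℝ)
          =ᶠ[𝓝 x] id := by
        have : ∀ᶠ y in 𝓝 x, y ∉ Icc (a + |q| * σ) (b - |q| * σ) := by
          refine isClosed_Icc.isOpen_compl.mem_nhds fun h' => hx ?_
          have := mul_pos hq hσ
          exact ⟨by linarith [h'.1], by linarith [h'.2]⟩
        filter_upwards [this] with y hy using hid' y fun h' => hy (Ioo_subset_Icc_self h')
      refine ⟨contDiffAt_id.congr_of_eventuallyEq e, ?_⟩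
      rw [e.deriv_eq]
      simp
  refine ⟨⟨contDiff_iff_contDiffAt.2 fun x => (key x).1, fun x => (key x).2, hid' 0 ?_, hid' 1 ?_⟩,
    |q| * σ, mul_pos hq hσ, hid'⟩
  · exact fun h' => by linarith [h'.1, mul_pos hq hσ]
  · exact fun h' => by linarith [h'.2, mul_pos hq hσ]

end AffineUnit

/-- `κ` is a smallness constant for conjugating fixed-point-free maps of `(0, 1)`. -/
def UnitConst (r : ℕ) (κ : ℝ) : Prop :=
  ∀ ε ∈ Ioc (0:ℝ) 1, ∀ sa ∈ Ioc (0:ℝ) (1 / 10), ∀ sb ∈ Ioc (0:ℝ) (1 / 10), ∀ f : Equiv.Perm ℝ,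
    IooDiff f → (∀ x ∈ Ioo (0:ℝ) 1, x < f x) →
    (∀ j ≤ r, ∀ x ∈ Ioo 0 sa, |iteratedDeriv j (fun x => f x - x) x| ≤ κ * ε * sa ^ (r + 1)) →
    (∀ j ≤ r, ∀ x ∈ Ioo (1 - sb) 1,
      |iteratedDeriv j (fun x => f x - x) x| ≤ κ * ε * sb ^ (r + 1)) →
    LogDBounded f → SublinVar f → ∃ φ : Equiv.Perm ℝ, CompactDiff φ ∧
      ∀ j ≤ r, ∀ x ∈ Ioo (0:ℝ) 1, |iteratedDeriv j (fun x => (φ * f * φ⁻¹) x - x) x| ≤ ε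

theorem exists_unitConst {r : ℕ} (hr : 2 ≤ r) : ∃ κ > 0, UnitConst r κ := exists_conj_unit hr

theorem AffineUnit.conj {p q a b : ℝ} (h : AffineUnit p q a b) {r : ℕ} {κ : ℝ} (hκ : 0 < κ)
    (hU : UnitConst r κ) {ε : ℝ} (hε : ε ∈ Ioc (0:ℝ) 1) {f : Equiv.Perm ℝ} (hf : IccDiff f)
    (hV : SublinVar f) (ha : 0 ≤ a) (hb : b ≤ 1) (hmem : ∀ x, f x ∈ Ioo a b ↔ x ∈ Ioo a b)
    (hpos : ∀ x ∈ Ioo (0:ℝ) 1, 0 < dsp f 0 (p + q * x) / q) {S₁ S₂ : ℝ} (hS₁ : 0 < S₁)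
    (hS₂ : 0 < S₂) (hS₁' : S₁ ≤ |q| / 10) (hS₂' : S₂ ≤ |q| / 10)
    (h₁ : ∀ j ≤ r, ∀ x ∈ Ioo 0 (S₁ / |q|), |dsp f j (p + q * x)| ≤ κ * ε * S₁ ^ (r + 1))
    (h₂ : ∀ j ≤ r, ∀ x ∈ Ioo (1 - S₂ / |q|) 1, |dsp f j (p + q * x)| ≤ κ * ε * S₂ ^ (r + 1)) :
    ∃ φ : Equiv.Perm ℝ, GDiff φ ∧ (∃ σ > 0, ∀ x ∉ Ioo (a + σ) (b - σ), φ x = x) ∧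
      ∀ j ≤ r, ∀ x ∈ Ioo a b, |dsp (φ * f * φ⁻¹ : Equiv.Perm ℝ) j x| ≤ ε := by
  have hq := abs_pos.2 h.ne
  have hsub : Ioo a b ⊆ Ioo 0 1 := Ioo_subset_Ioo ha hb
  have hder : ∀ g : Equiv.Perm ℝ, IccDiff g → ∀ j, ∀ x ∈ Ioo (0:ℝ) 1,
      iteratedDeriv j (fun x => ((affinePerm p q h.ne)⁻¹ * g * affinePerm p q h.ne) x - x) x =
        q⁻¹ * (q ^ j * dsp g j (p + q * x)) := fun g hg j x hx => by
    rw [hg.dsp_eq j (hsub ((h.mem_Ioo_iff x).2 hx)), ← iteratedDeriv_affine_conj_sub _ h.ne]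
    rfl
  have hend : ∀ S > 0, ∀ j, ∀ x ∈ Ioo (0:ℝ) 1, |dsp f j (p + q * x)| ≤ κ * ε * S ^ (r + 1) →
      |iteratedDeriv j (fun x => ((affinePerm p q h.ne)⁻¹ * f * affinePerm p q h.ne) x - x) x| ≤
        κ * (ε * |q| ^ r) * (S / |q|) ^ (r + 1) := fun S hS j x hx hb => by
    rw [hder f hf j x hx, abs_mul, abs_mul, abs_pow, abs_inv]
    calc |q|⁻¹ * (|q| ^ j * |dsp f j (p + q * x)|)
        ≤ |q|⁻¹ * (1 * (κ * ε * S ^ (r + 1))) := by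
          gcongr
          exact pow_le_one₀ hq.le h.le_one
      _ = _ := by
          rw [div_pow]
          field_simp
          ring
  have hq1 : |q| ^ r ≤ 1 := pow_le_one₀ hq.le h.le_one
  have hs : ∀ S > 0, S ≤ |q| / 10 → S / |q| ∈ Ioc (0:ℝ) (1 / 10) := fun S hS hS' =>
    ⟨div_pos hS hq, by rw [div_le_iff₀ hq]; linarith⟩
  have hlt : ∀ x ∈ Ioo (0:ℝ) 1,
      x < ((affinePerm p q h.ne)⁻¹ * f * affinePerm p q h.ne) x := fun x hx => by
    have h1 := hpos x hx
    rw [dsp_zero, sub_div, add_div, mul_div_cancel_left₀ _ h.ne] at h1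
    rw [h.conj_apply]
    simp only [sub_div]
    linarith
  have hs₁ := hs S₁ hS₁ hS₁'
  have hs₂ := hs S₂ hS₂ hS₂'
  obtain ⟨φ, hφ, hsmall⟩ := hU (ε * |q| ^ r) ⟨mul_pos hε.1 (pow_pos hq r),
    mul_le_one₀ hε.2 (pow_pos hq r).le hq1⟩ _ hs₁ _ hs₂ _ (h.iooDiff hf.iooDiff hsub hmem)
    hlt (fun j hj x hx => hend _ hS₁ j x ⟨hx.1, by linarith [hx.2, hs₁.2]⟩ (h₁ j hj x hx))
    (fun j hj x hx => hend _ hS₂ j x ⟨by linarith [hx.1, hs₂.2], hx.2⟩ (h₂ j hj x hx))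
    (h.logDBounded hf.logDBounded hsub) (h.sublinVar hV hsub)
  obtain ⟨hG, hσ⟩ := h.gdiff ha hb hφ
  refine ⟨_, hG, hσ, fun j hj x hx => ?_⟩
  obtain ⟨y, hy⟩ := (affinePerm p q h.ne).surjective x
  rw [affinePerm_apply] at hy
  rw [← hy, h.mem_Ioo_iff] at hx
  have h1 := hsmall j hj y hx
  have e : φ * ((affinePerm p q h.ne)⁻¹ * f * affinePerm p q h.ne) * φ⁻¹ =
      (affinePerm p q h.ne)⁻¹ * (affinePerm p q h.ne * φ * (affinePerm p q h.ne)⁻¹ * f *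
        (affinePerm p q h.ne * φ * (affinePerm p q h.ne)⁻¹)⁻¹) * affinePerm p q h.ne := by group
  rw [e, hder _ (hf.conj hG) j y hx, hy, abs_mul, abs_mul, abs_pow, abs_inv,
    inv_mul_le_iff₀ hq] at h1
  have h2 : |q| * (ε * |q| ^ r) ≤ |q| ^ j * ε := by
    have : |q| ^ (r + 1) ≤ |q| ^ j := pow_le_pow_of_le_one hq.le h.le_one (by omega)
    calc _ = |q| ^ (r + 1) * ε := by ring
      _ ≤ _ := mul_le_mul_of_nonneg_right this hε.1.le
  exact le_of_mul_le_mul_left (h1.trans h2) (pow_pos hq j)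

namespace IsComp

variable {a b : ℝ} {f : Equiv.Perm ℝ}

theorem Ioo_subset {d : ℕ → ℝ → ℝ} (h : IsComp d a b) : Ioo a b ⊆ Ioo 0 1 :=
  Ioo_subset_Ioo h.nonneg h.le_one

theorem mem_Ioo_iff (h : IsComp (dsp f) a b) (hf : IccDiff f) (x : ℝ) :
    f x ∈ Ioo a b ↔ x ∈ Ioo a b := by
  have ha : f a = a := by have := h.left; rw [dsp_zero] at this; linarith
  have hb : f b = b := by have := h.right; rw [dsp_zero] at this; linarith
  have key : ∀ x ∈ Icc (0:ℝ) 1, (f x ∈ Ioo a b ↔ x ∈ Ioo a b) := fun x hx => by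
    have h1 := hf.strictMonoOn.lt_iff_lt (a := a) (b := x) ⟨h.nonneg, h.lt.le.trans h.le_one⟩ hx
    have h2 := hf.strictMonoOn.lt_iff_lt (a := x) (b := b) hx ⟨h.nonneg.trans h.lt.le, h.le_one⟩
    rw [ha] at h1
    rw [hb] at h2
    rw [mem_Ioo, mem_Ioo, h1, h2]
  exact ⟨fun h' => (key x ((hf.mem_iff x).1 (Ioo_subset_Icc_self (h.Ioo_subset h')))).1 h',
    fun h' => (key x (Ioo_subset_Icc_self (h.Ioo_subset h'))).2 h'⟩

theorem sign (h : IsComp (dsp f) a b) (hf : IccDiff f) :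
    (∀ x ∈ Ioo a b, 0 < dsp f 0 x) ∨ ∀ x ∈ Ioo a b, dsp f 0 x < 0 := by
  by_contra! hc
  obtain ⟨⟨x, hx, hx0⟩, y, hy, hy0⟩ := hc
  have hcont : ContinuousOn (dsp f 0) (Ioo a b) :=
    (hf.jet.cont 0).mono (h.Ioo_subset.trans Ioo_subset_Icc_self)
  obtain ⟨z, hz, hz0⟩ := isPreconnected_Ioo.intermediate_value hx hy hcont ⟨hx0, hy0⟩
  exact h.ne z hz hz0

theorem exists_conj {r : ℕ} {κ : ℝ} (hκ : 0 < κ)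
    (hU : UnitConst r κ) {ε : ℝ} (hε : ε ∈ Ioc (0:ℝ) 1) (hf : IccDiff f)
    (hV : SublinVar f) (h : IsComp (dsp f) a b) (hl : LNice (dsp f) r (κ * ε) a b)
    (hr : RNice (dsp f) r (κ * ε) a b) :
    ∃ φ : Equiv.Perm ℝ, GDiff φ ∧ (∃ σ > 0, ∀ x ∉ Ioo (a + σ) (b - σ), φ x = x) ∧
      ∀ j ≤ r, ∀ x ∈ Ioo a b, |dsp (φ * f * φ⁻¹ : Equiv.Perm ℝ) j x| ≤ ε := by
  obtain ⟨S₁, hS₁, hS₁', h₁⟩ := hl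
  obtain ⟨S₂, hS₂, hS₂', h₂⟩ := hr
  have hab := sub_pos.2 h.lt
  have hmul : ∀ S y : ℝ, y < S / (b - a) → (b - a) * y < S := fun S y hy => by
    rw [lt_div_iff₀ hab] at hy
    linarith
  rcases h.sign hf with hs | hs
  · have hA := AffineUnit.of_pos h.nonneg h.lt h.le_one
    refine hA.conj hκ hU hε hf hV h.nonneg h.le_one (h.mem_Ioo_iff hf) (fun x hx =>
      div_pos (hs _ ((hA.mem_Ioo_iff x).2 hx)) hab) hS₁ hS₂ ?_ ?_ ?_ ?_ <;>
      rw [abs_of_pos hab]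
    · exact hS₁'
    · exact hS₂'
    · exact fun j hj x hx => h₁ j hj _ ⟨by linarith [mul_pos hab hx.1], by
        linarith [hmul _ _ hx.2]⟩
    · exact fun j hj x hx => h₂ j hj _ ⟨by linarith [hmul S₂ (1 - x) (by linarith [hx.1])], by
        linarith [mul_pos hab (sub_pos.2 hx.2)]⟩
  · have hA := AffineUnit.of_neg h.nonneg h.lt h.le_one
    refine hA.conj hκ hU hε hf hV h.nonneg h.le_one (h.mem_Ioo_iff hf) (fun x hx =>
      div_pos_of_neg_of_neg (hs _ ((hA.mem_Ioo_iff x).2 hx)) (neg_neg_of_pos hab)) hS₂ hS₁ ?_ ?_ ?_ ?_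
      <;> rw [abs_neg, abs_of_pos hab]
    · exact hS₂'
    · exact hS₁'
    · exact fun j hj x hx => h₂ j hj _ ⟨by linarith [hmul _ _ hx.2], by
        linarith [mul_pos hab hx.1]⟩
    · exact fun j hj x hx => h₁ j hj _ ⟨by linarith [mul_pos hab (sub_pos.2 hx.2)], by
        linarith [hmul S₁ (1 - x) (by linarith [hx.1])]⟩

end IsComp

theorem dsp_id (j : ℕ) (x : ℝ) : dsp id j x = 0 := by
  have : (fun x : ℝ => id x - x) = fun _ => (0:ℝ) := by ext; simp
  rw [dsp, this, iteratedDerivWithin_const, ite_self]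

theorem IccDiff.abs_dsp_le {f : Equiv.Perm ℝ} (hf : IccDiff f) {r : ℕ} {ε : ℝ} (hε : 0 ≤ ε)
    (h : ∀ a b, IsComp (dsp f) a b → ∀ j ≤ r, ∀ x ∈ Ioo a b, |dsp f j x| ≤ ε) :
    ∀ j ≤ r, ∀ x ∈ Icc (0:ℝ) 1, |dsp f j x| ≤ ε := fun j hj x hx => by
  by_cases hc : x ∈ closure {y | y ∈ Icc (0:ℝ) 1 ∧ dsp f 0 y ≠ 0}
  · have hcl : IsClosed (Icc (0:ℝ) 1 ∩ (fun x => |dsp f j x|) ⁻¹' Iic ε) :=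
      (hf.jet.cont j).abs.preimage_isClosed_of_isClosed isClosed_Icc isClosed_Iic
    refine (closure_minimal (fun y hy => ?_) hcl hc).2
    obtain ⟨a, b, hab, hy'⟩ := hf.jet.exists_comp (by rw [dsp_zero, hf.zero, sub_zero])
      (by rw [dsp_zero, hf.one, sub_self]) hy.1 hy.2
    exact ⟨hy.1, h a b hab j hj y hy'⟩
  · rw [Metric.mem_closure_iff] at hc
    push Not at hc
    obtain ⟨δ, hδ, h1⟩ := hc
    have : dsp f j x = dsp id j x := dsp_congr hδ hx (fun y hy hyx => by
      by_contra hne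
      refine not_lt.2 (h1 y ⟨hy, fun h0 => hne ?_⟩) (by rwa [dist_comm, Real.dist_eq])
      rw [dsp_zero] at h0
      simp only [id]
      linarith) j
    rw [this, dsp_id, abs_zero]
    exact hε

theorem IsComp.congr {d d' : ℕ → ℝ → ℝ} {a b : ℝ} (h : ∀ x ∈ Icc (0:ℝ) 1, d 0 x = 0 ↔ d' 0 x = 0)
    (hd : IsComp d a b) : IsComp d' a b where
  nonneg := hd.nonneg
  lt := hd.lt
  le_one := hd.le_one
  left := (h a ⟨hd.nonneg, hd.lt.le.trans hd.le_one⟩).1 hd.left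
  right := (h b ⟨hd.nonneg.trans hd.lt.le, hd.le_one⟩).1 hd.right
  ne x hx h0 := hd.ne x hx ((h x (Ioo_subset_Icc_self (hd.Ioo_subset hx))).2 h0)

theorem LNice.congr {d d' : ℕ → ℝ → ℝ} {r : ℕ} {c a b : ℝ}
    (h : ∀ j, ∀ x ∈ Ioo a b, d j x = d' j x) (hd : LNice d r c a b) : LNice d' r c a b := by
  obtain ⟨S, hS, hS', h1⟩ := hd
  refine ⟨S, hS, hS', fun j hj x hx => ?_⟩
  rw [← h j x ⟨hx.1, by linarith [hx.2]⟩]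
  exact h1 j hj x hx

theorem RNice.congr {d d' : ℕ → ℝ → ℝ} {r : ℕ} {c a b : ℝ}
    (h : ∀ j, ∀ x ∈ Ioo a b, d j x = d' j x) (hd : RNice d r c a b) : RNice d' r c a b := by
  obtain ⟨S, hS, hS', h1⟩ := hd
  refine ⟨S, hS, hS', fun j hj x hx => ?_⟩
  rw [← h j x ⟨by linarith [hx.1], hx.2⟩]
  exact h1 j hj x hx

theorem exists_conj_of_nice {r : ℕ} {κ ε : ℝ} (hκ : 0 < κ) (hU : UnitConst r κ)
    (hε : ε ∈ Ioc (0:ℝ) 1) {T : Set (ℝ × ℝ)} (hT : T.Finite) {f : Equiv.Perm ℝ} (hf : IccDiff f)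
    (hV : SublinVar f)
    (h1 : ∀ a b, IsComp (dsp f) a b → (a, b) ∉ T → ∀ j ≤ r, ∀ x ∈ Ioo a b, |dsp f j x| ≤ ε)
    (h2 : ∀ a b, IsComp (dsp f) a b → (a, b) ∈ T →
      LNice (dsp f) r (κ * ε) a b ∧ RNice (dsp f) r (κ * ε) a b) :
    ∃ φ : Equiv.Perm ℝ, GDiff φ ∧ (∃ σ > 0, ∀ x ∉ Ioo σ (1 - σ), φ x = x) ∧
      ∀ j ≤ r, ∀ x ∈ Icc (0:ℝ) 1, |dsp (φ * f * φ⁻¹ : Equiv.Perm ℝ) j x| ≤ ε := by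
  induction T, hT using Set.Finite.induction_on generalizing f with
  | empty =>
    refine ⟨1, GDiff.id, ⟨1, one_pos, fun _ _ => rfl⟩, ?_⟩
    rw [one_mul, inv_one, mul_one]
    exact hf.abs_dsp_le hε.1.le fun a b hab => h1 a b hab (notMem_empty _)
  | @insert t T ht _ ih =>
    obtain ⟨a, b⟩ := t
    by_cases hab : IsComp (dsp f) a b
    · obtain ⟨hl, hr⟩ := h2 a b hab (mem_insert _ _)
      obtain ⟨φ₁, hφ₁, ⟨σ₁, hσ₁, hid₁⟩, hs₁⟩ := hab.exists_conj hκ hU hε hf hV hl hr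
      have hid : ∀ x ∉ Ioo a b, φ₁ x = x := fun x hx =>
        hid₁ x fun h => hx ⟨by linarith [h.1], by linarith [h.2]⟩
      have hidi : ∀ x ∉ Ioo a b, φ₁⁻¹ x = x := fun x hx => by
        rw [Equiv.Perm.inv_eq_iff_eq, hid x hx]
      have hoff : ∀ x ∉ Ioo a b, (φ₁ * f * φ₁⁻¹) x = f x := fun x hx => by
        rw [Equiv.Perm.mul_apply, Equiv.Perm.mul_apply, hidi x hx, hid]
        rwa [hab.mem_Ioo_iff hf]
      have hzero : ∀ x ∈ Icc (0:ℝ) 1,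
          dsp f 0 x = 0 ↔ dsp (φ₁ * f * φ₁⁻¹ : Equiv.Perm ℝ) 0 x = 0 := fun x hx => by
        by_cases hxI : x ∈ Ioo a b
        · refine iff_of_false (hab.ne x hxI) fun h0 => ?_
          have hy : φ₁⁻¹ x ∈ Ioo a b := by
            by_contra hy
            have := hid _ hy
            rw [apply_inv_perm] at this
            rw [← this] at hy
            exact hy hxI
          refine hab.ne _ hy ?_
          rw [dsp_zero, sub_eq_zero, Equiv.Perm.mul_apply, Equiv.Perm.mul_apply,
            ← Equiv.Perm.eq_inv_iff_eq] at h0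
          rw [dsp_zero, h0, sub_self]
        · rw [dsp_zero, dsp_zero, hoff x hxI]
      have hother : ∀ a' b', IsComp (dsp f) a' b' → (a', b') ≠ (a, b) → ∀ j, ∀ x ∈ Ioo a' b',
          dsp f j x = dsp (φ₁ * f * φ₁⁻¹ : Equiv.Perm ℝ) j x := fun a' b' h' hne j x hx => by
        refine dsp_congr (lt_min (sub_pos.2 hx.1) (sub_pos.2 hx.2))
          (Ioo_subset_Icc_self (h'.Ioo_subset hx)) (fun y _ hy => (hoff y fun hyI => hne ?_).symm) j
        rw [abs_lt] at hy
        have e1 := min_le_left (x - a') (b' - x)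
        have e2 := min_le_right (x - a') (b' - x)
        obtain ⟨e3, e4⟩ := h'.unique hab (by linarith [hyI.2]) (by linarith [hyI.1])
        rw [e3, e4]
      obtain ⟨φ₂, hφ₂, ⟨σ₂, hσ₂, hid₂⟩, hs₂⟩ := ih (hf.conj hφ₁) (hV.conj hf hφ₁)
        (fun a' b' h' hT' j hj x hx => by
          have hc := h'.congr fun x hx => (hzero x hx).symm
          by_cases hne : (a', b') = (a, b)
          · rw [Prod.mk.injEq] at hne
            rw [hne.1, hne.2] at hx
            exact hs₁ j hj x hx
          · rw [← hother a' b' hc hne j x hx]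
            exact h1 a' b' hc (fun h => h.elim hne hT') j hj x hx)
        (fun a' b' h' hT' => by
          have hc := h'.congr fun x hx => (hzero x hx).symm
          have hne : (a', b') ≠ (a, b) := fun h => ht (h ▸ hT')
          obtain ⟨hl', hr'⟩ := h2 a' b' hc (mem_insert_of_mem _ hT')
          exact ⟨hl'.congr (hother a' b' hc hne), hr'.congr (hother a' b' hc hne)⟩)
      refine ⟨φ₂ * φ₁, hφ₂.mul hφ₁, ⟨min σ₁ σ₂, lt_min hσ₁ hσ₂, fun x hx => ?_⟩, ?_⟩
      · have e1 := min_le_left σ₁ σ₂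
        have e2 := min_le_right σ₁ σ₂
        rw [Equiv.Perm.mul_apply, hid₁ x fun h => hx
          ⟨by linarith [h.1, hab.nonneg], by linarith [h.2, hab.le_one]⟩, hid₂ x fun h => hx
          ⟨by linarith [h.1], by linarith [h.2]⟩]
      · have e : φ₂ * φ₁ * f * (φ₂ * φ₁)⁻¹ = φ₂ * (φ₁ * f * φ₁⁻¹) * φ₂⁻¹ := by group
        rwa [e]
    · exact ih hf hV (fun a' b' h' hT' => h1 a' b' h' fun h =>
        h.elim (fun e => hab (by rw [Prod.mk.injEq] at e; rwa [e.1, e.2] at h')) hT')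
        fun a' b' h' hT' => h2 a' b' h' (mem_insert_of_mem _ hT')

theorem monotone_ramp {a b : ℝ} (h : a < b) : Monotone (ramp a b) := fun _ _ hxy =>
  Real.smoothTransition.monotone (add_le_add_right
    (mul_le_mul_of_nonneg_left hxy (inv_nonneg.2 (sub_pos.2 h).le)) _)

/-- The function `y ↦ y` cut off outside `[-1, 1]`. -/
noncomputable def cutId (y : ℝ) : ℝ := y * (1 - ramp (1 / 4) 1 (y ^ 2))

theorem contDiff_cutId : ContDiff ℝ ∞ cutId :=
  contDiff_id.mul (contDiff_const.sub (contDiff_ramp.comp (contDiff_id.pow 2)))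

theorem cutId_of_le {y : ℝ} (hy : |y| ≤ 1 / 2) : cutId y = y := by
  rw [cutId, ramp_zero (by norm_num), sub_zero, mul_one]
  rw [← sq_abs]
  nlinarith [abs_nonneg y]

theorem cutId_of_ge {y : ℝ} (hy : 1 ≤ |y|) : cutId y = 0 := by
  rw [cutId, ramp_one (by norm_num), sub_self, mul_zero]
  rw [← sq_abs]
  nlinarith

theorem deriv_cutId_le (y : ℝ) : deriv cutId y ≤ 1 := by
  have hd : Differentiable ℝ (ramp (1 / 4) 1) := contDiff_ramp.differentiable (by simp)
  have h1 : HasDerivAt (fun y : ℝ => ramp (1 / 4) 1 (y ^ 2))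
      (deriv (ramp (1 / 4) 1) (y ^ 2) * (2 * y)) y := by
    have := HasDerivAt.comp y (hd (y ^ 2)).hasDerivAt (hasDerivAt_pow 2 y)
    exact this.congr_deriv (by simp)
  have h2 := (hasDerivAt_id y).mul (h1.const_sub 1)
  have h3 : deriv cutId y = _ := h2.deriv
  have h4 : 0 ≤ deriv (ramp (1 / 4) 1) (y ^ 2) := (monotone_ramp (by norm_num)).deriv_nonneg
  have h5 : 0 ≤ ramp (1 / 4) 1 (y ^ 2) := ramp_nonneg
  rw [h3]
  simp only [id]
  nlinarith [mul_nonneg h4 (sq_nonneg y)]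

theorem exists_zoom {B : Finset ℝ} (hB : ∀ p ∈ B, p ∈ Icc (0:ℝ) 1) {ρ lam : ℝ} (hρ : 0 < ρ)
    (hsep : ∀ p ∈ B, ∀ q ∈ B, q ≠ p → 4 * ρ ≤ |q - p|) (hlam : 1 ≤ lam)
    (h0 : (0:ℝ) ∈ B ∨ ∀ p ∈ B, ρ ≤ |0 - p|) (h1 : (1:ℝ) ∈ B ∨ ∀ p ∈ B, ρ ≤ |1 - p|) :
    ∃ ξ : Equiv.Perm ℝ, GDiff ξ ∧ (∀ x, (∀ p ∈ B, ρ ≤ |x - p|) → ξ x = x) ∧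
      ∀ p ∈ B, ∀ x, |x - p| ≤ ρ / 2 → ξ x = p + (x - p) / lam := by
  obtain ⟨μ, hμ⟩ : ∃ μ, μ = 1 - 1 / lam := ⟨_, rfl⟩
  have hlam0 : 0 < lam := by linarith
  have hμ0 : 0 ≤ μ := by
    rw [hμ, sub_nonneg, div_le_one hlam0]
    exact hlam
  have hμ1 : μ < 1 := by
    rw [hμ]
    linarith [one_div_pos.2 hlam0]
  obtain ⟨ζ, hζ⟩ : ∃ ζ : ℝ → ℝ, ζ = fun x => x - μ * ∑ p ∈ B, ρ * cutId ((x - p) / ρ) := ⟨_, rfl⟩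
  have hterm : ∀ x p : ℝ, ρ ≤ |x - p| → ρ * cutId ((x - p) / ρ) = 0 := fun x p h => by
    rw [cutId_of_ge, mul_zero]
    rwa [abs_div, abs_of_pos hρ, le_div_iff₀ hρ, one_mul]
  have hfar : ∀ x, (∀ p ∈ B, ρ ≤ |x - p|) → ζ x = x := fun x hx => by
    simp only [hζ]
    rw [Finset.sum_eq_zero fun p hp => hterm x p (hx p hp), mul_zero, sub_zero]
  have hclose : ∀ p ∈ B, ∀ x, |x - p| ≤ 3 * ρ → ζ x = x - μ * (ρ * cutId ((x - p) / ρ)) :=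
    fun p hp x hx => by
      simp only [hζ]
      rw [Finset.sum_eq_single_of_mem p hp fun q hq hqp => hterm x q ?_]
      have h3 := hsep p hp q hq hqp
      have h4 := abs_sub_abs_le_abs_sub (q - p) (x - p)
      rw [sub_sub_sub_cancel_right, abs_sub_comm q x] at h4
      linarith
  have hnear : ∀ p ∈ B, ∀ x, |x - p| ≤ ρ / 2 → ζ x = p + (x - p) / lam := fun p hp x hx => by
    rw [hclose p hp x (by linarith), cutId_of_le, hμ]
    · field_simp
      ring
    · rw [abs_div, abs_of_pos hρ, div_le_iff₀ hρ]
      linarith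
  have hsm : ContDiff ℝ ∞ ζ := by
    rw [hζ]
    refine contDiff_id.sub (contDiff_const.mul (ContDiff.sum fun p _ => contDiff_const.mul
      (contDiff_cutId.comp ?_)))
    exact (contDiff_id.sub contDiff_const).div_const ρ
  have hder : ∀ x, 0 < deriv ζ x := fun x => by
    by_cases hx : ∃ p ∈ B, |x - p| < 2 * ρ
    · obtain ⟨p, hp, hxp⟩ := hx
      have e : ζ =ᶠ[𝓝 x] fun x => x - μ * (ρ * cutId ((x - p) / ρ)) := by
        have hc : Continuous fun y : ℝ => |y - p| := by fun_prop
        filter_upwards [hc.continuousAt.eventually_lt_const hxp] with y hy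
        exact hclose p hp y (by linarith)
      have hd := (contDiff_cutId.differentiable (by simp) ((x - p) / ρ)).hasDerivAt
      have h2 := ((HasDerivAt.comp x hd (((hasDerivAt_id x).sub_const p).div_const ρ)).const_mul
        ρ).const_mul μ
      have h3 := (hasDerivAt_id x).sub h2
      have h4 : deriv (fun x => x - μ * (ρ * cutId ((x - p) / ρ))) x = _ := h3.deriv
      rw [e.deriv_eq, h4]
      have h5 := deriv_cutId_le ((x - p) / ρ)
      have h6 : ρ * (deriv cutId ((x - p) / ρ) * (1 / ρ)) = deriv cutId ((x - p) / ρ) := by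
        field_simp
      rw [h6]
      nlinarith
    · push Not at hx
      have e : ζ =ᶠ[𝓝 x] id := by
        filter_upwards [Metric.ball_mem_nhds x hρ] with y hy
        refine hfar y fun p hp => ?_
        rw [Metric.mem_ball, Real.dist_eq, abs_sub_comm] at hy
        have h3 := abs_sub_le x y p
        linarith [hx p hp]
      rw [e.deriv_eq]
      simp
  have hmono : StrictMono ζ := strictMono_of_deriv_pos hder
  have hp0 : ∀ p ∈ B, ζ p = p := fun p hp => by
    rw [hnear p hp p (by rw [sub_self, abs_zero]; positivity)]
    simp
  have htop : ζ =ᶠ[atTop] id := by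
    filter_upwards [eventually_ge_atTop (1 + ρ)] with x hx
    exact hfar x fun p hp => (by linarith [(hB p hp).2] : ρ ≤ x - p).trans (le_abs_self _)
  have hbot : ζ =ᶠ[atBot] id := by
    filter_upwards [eventually_le_atBot (-ρ)] with x hx
    exact hfar x fun p hp => (by linarith [(hB p hp).1] : ρ ≤ -(x - p)).trans (neg_le_abs _)
  have hsurj : Function.Surjective ζ := hsm.continuous.surjective
    (tendsto_id.congr' htop.symm) (tendsto_id.congr' hbot.symm)
  refine ⟨Equiv.ofBijective ζ ⟨hmono.injective, hsurj⟩, ⟨hsm, hder, ?_, ?_⟩, hfar, hnear⟩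
  · exact h0.elim (hp0 0) (hfar 0)
  · exact h1.elim (hp0 1) (hfar 1)

theorem Jet.tangent_bound {d : ℕ → ℝ → ℝ} (h : Jet d) {M p : ℝ} (hM0 : 0 ≤ M)
    (hM : ∀ x ∈ Icc (0:ℝ) 1, |d 2 x| ≤ M) (hp : p ∈ Icc (0:ℝ) 1) (h0 : d 0 p = 0) (h1 : d 1 p = 0)
    {y : ℝ} (hy : y ∈ Icc (0:ℝ) 1) : |d 1 y| ≤ M * |y - p| ∧ |d 0 y| ≤ M * |y - p| ^ 2 := by
  have e1 : ∀ x ∈ Icc (0:ℝ) 1, |d 1 x| ≤ M * |x - p| := fun x hx => by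
    simpa [h1] using h.abs_sub_le le_rfl le_rfl hM hx hp
  refine ⟨e1 y hy, ?_⟩
  have hu : 0 ≤ min p y := le_min hp.1 hy.1
  have hv : max p y ≤ 1 := max_le hp.2 hy.2
  have e2 := h.abs_sub_le hu hv (j := 0) (M := M * |y - p|) (fun x hx => (e1 x
    ⟨hu.trans hx.1, hx.2.trans hv⟩).trans (mul_le_mul_of_nonneg_left ?_ hM0))
    (x := y) (y := p) ⟨min_le_right _ _, le_max_right _ _⟩ ⟨min_le_left _ _, le_max_left _ _⟩
  · rw [h0, sub_zero] at e2
    linarith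
  · exact abs_sub_left_of_mem_uIcc hx

theorem Jet.exists_gap {d : ℕ → ℝ → ℝ} (h : Jet d) {B : Finset ℝ}
    (hB : ∀ p ∈ B, p ∈ Icc (0:ℝ) 1 ∧ ¬ FlatAt d p) :
    ∃ δ > 0, ∀ p ∈ B, ∀ q ∈ Icc (0:ℝ) 1, d 0 q = 0 → q ≠ p → δ ≤ |q - p| := by
  induction B using Finset.induction_on with
  | empty => exact ⟨1, one_pos, by simp⟩
  | insert p B _ ih =>
    obtain ⟨δ₁, hδ₁, h1⟩ := ih fun q hq => hB q (Finset.mem_insert_of_mem hq)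
    obtain ⟨hp, hn⟩ := hB p (Finset.mem_insert_self _ _)
    obtain ⟨δ₂, hδ₂, h2⟩ := h.isolated hp hn
    refine ⟨min δ₁ δ₂, lt_min hδ₁ hδ₂, fun q hq => ?_⟩
    rcases Finset.mem_insert.1 hq with rfl | hq
    · exact fun x hx hx0 hne => (min_le_right _ _).trans (h2 x hx hx0 hne)
    · exact fun x hx hx0 hne => (min_le_left _ _).trans (h1 q hq x hx hx0 hne)

/-- Blowing up a map near a finite set of isolated fixed points tangent to the identity. -/
theorem IccDiff.exists_zoom {f : Equiv.Perm ℝ} (hf : IccDiff f) (B : Finset ℝ)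
    (hB : ∀ p ∈ B, p ∈ Icc (0:ℝ) 1 ∧ dsp f 0 p = 0 ∧ dsp f 1 p = 0 ∧ ¬ FlatAt (dsp f) p)
    {r : ℕ} (hr : 2 ≤ r) {c : ℝ} (hc : 0 < c) :
    ∃ lam > 0, ∃ ρ > 0, ∃ φ : Equiv.Perm ℝ, GDiff φ ∧
      (∀ p ∈ B, ∀ q ∈ Icc (0:ℝ) 1, dsp f 0 q = 0 → q ≠ p → 60 * ρ ≤ |q - p|) ∧
      (∀ x ∈ Icc (0:ℝ) 1, (∀ p ∈ B, 6 * ρ ≤ |x - p|) → (φ * f * φ⁻¹) x = f x) ∧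
      (∀ x ∈ Icc (0:ℝ) 1, dsp f 0 x = 0 ↔ dsp (φ * f * φ⁻¹ : Equiv.Perm ℝ) 0 x = 0) ∧
      (∀ p ∈ B, ∀ j ≤ r, ∀ x ∈ Ioo (0:ℝ) 1, |x - p| < ρ →
        |dsp (φ * f * φ⁻¹ : Equiv.Perm ℝ) j x| ≤ c * ρ ^ (r + 1)) ∧
      (∀ p ∈ B, ∃ δ > 0, ∀ x, |x - p| ≤ δ → φ x = p + lam * (x - p)) ∧
      ∀ x, (∀ p ∈ B, 3 * ρ ≤ |x - p|) → φ x = x := by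
  obtain ⟨δ, hδ, hgap⟩ := hf.jet.exists_gap fun p hp => ⟨(hB p hp).1, (hB p hp).2.2.2⟩
  obtain ⟨M, hM1, hM⟩ := hf.jet.exists_bound r
  obtain ⟨ρ, hρ⟩ : ∃ ρ, ρ = min (δ / 60) (1 / (12 * M)) := ⟨_, rfl⟩
  have hM0 : 0 < M := by linarith
  have hρ0 : 0 < ρ := by rw [hρ]; positivity
  have hρδ : 60 * ρ ≤ δ := by
    have := min_le_left (δ / 60) (1 / (12 * M))
    rw [← hρ] at this
    linarith
  have hρM : M * (12 * ρ) ≤ 1 := by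
    have := min_le_right (δ / 60) (1 / (12 * M))
    rw [← hρ, le_div_iff₀ (by positivity)] at this
    linarith
  have hcS : 0 < c * ρ ^ (r + 1) := by positivity
  obtain ⟨lam, hlam⟩ : ∃ lam, lam = 1 + M / (c * ρ ^ (r + 1)) := ⟨_, rfl⟩
  have hlam1 : 1 ≤ lam := by
    rw [hlam]
    exact le_add_of_nonneg_right (by positivity)
  have hlam0 : 0 < lam := by linarith
  have hlamM : M / lam ≤ c * ρ ^ (r + 1) := by
    rw [div_le_iff₀ hlam0, hlam, mul_add, mul_one, mul_div_cancel₀ _ hcS.ne']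
    linarith
  have hend : ∀ e ∈ Icc (0:ℝ) 1, dsp f 0 e = 0 → e ∈ B ∨ ∀ p ∈ B, 3 * ρ ≤ |e - p| :=
    fun e he he0 => by
      by_cases heB : e ∈ B
      · exact Or.inl heB
      · refine Or.inr fun p hp => ?_
        linarith [hgap p hp e he he0 fun h => heB (h ▸ hp)]
  obtain ⟨ξ, hξ, hfar, hnear⟩ := _root_.exists_zoom (fun p hp => (hB p hp).1)
    (ρ := 3 * ρ) (by positivity) (fun p hp q hq hqp => by
      linarith [hgap p hp q (hB q hq).1 (hB q hq).2.1 hqp]) hlam1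
    (hend 0 (by simp) (by rw [dsp_zero, hf.zero, sub_zero]))
    (hend 1 (by simp) (by rw [dsp_zero, hf.one, sub_self]))
  have htan : ∀ p ∈ B, ∀ y ∈ Icc (0:ℝ) 1, |dsp f 1 y| ≤ M * |y - p| ∧
      |f y - y| ≤ M * |y - p| ^ 2 := fun p hp y hy => by
    rw [← dsp_zero]
    exact hf.jet.tangent_bound hM0.le (hM 2 hr) (hB p hp).1 (hB p hp).2.1 (hB p hp).2.2.1 hy
  have happ : ∀ x, (ξ⁻¹ * f * ξ⁻¹⁻¹) x = ξ⁻¹ (f (ξ x)) := fun x => by rw [inv_inv]; rfl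
  have hformula : ∀ p ∈ B, ∀ x ∈ Icc (0:ℝ) 1, |x - p| ≤ ρ → p + (x - p) / lam ∈ Icc (0:ℝ) 1 ∧
      (ξ⁻¹ * f * ξ⁻¹⁻¹) x = p + lam * (f (p + (x - p) / lam) - p) := fun p hp x hx hxp => by
    have hpI := (hB p hp).1
    have hi0 : 0 < 1 / lam := one_div_pos.2 hlam0
    have hi1 : 1 / lam ≤ 1 := (div_le_one hlam0).2 hlam1
    have hy : p + (x - p) / lam ∈ Icc (0:ℝ) 1 := by
      rw [show p + (x - p) / lam = (1 - 1 / lam) * p + 1 / lam * x by field_simp; ring]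
      constructor
      · nlinarith [mul_nonneg (sub_nonneg.2 hi1) hpI.1, mul_nonneg hi0.le hx.1]
      · nlinarith [mul_nonneg (sub_nonneg.2 hi1) (sub_nonneg.2 hpI.2),
          mul_nonneg hi0.le (sub_nonneg.2 hx.2)]
    refine ⟨hy, ?_⟩
    obtain ⟨y, hy'⟩ : ∃ y, y = p + (x - p) / lam := ⟨_, rfl⟩
    have hxy : |x - p| = lam * |y - p| := by
      rw [hy', add_sub_cancel_left, abs_div, abs_of_pos hlam0]
      field_simp
    have hyx : |y - p| ≤ |x - p| := by nlinarith [abs_nonneg (y - p)]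
    rw [happ, hnear p hp x (by linarith), ← hy', Equiv.Perm.inv_eq_iff_eq, hnear p hp,
      add_sub_cancel_left, mul_div_cancel_left₀ _ hlam0.ne', add_sub_cancel]
    rw [← hy'] at hy
    have h1 := (htan p hp y hy).2
    have h2 : M * |y - p| ^ 2 ≤ |y - p| / 2 := by
      have : M * |y - p| ≤ 1 / 2 := by nlinarith
      nlinarith [abs_nonneg (y - p)]
    have h3 := abs_sub_le (f y) y p
    rw [add_sub_cancel_left, abs_mul, abs_of_pos hlam0]
    nlinarith
  refine ⟨lam, hlam0, ρ, hρ0, ξ⁻¹, hξ.inv, fun p hp q hq hq0 hqp =>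
    hρδ.trans (hgap p hp q hq hq0 hqp), fun x hx hxp => ?_, fun x hx => ?_,
    fun p hp j hj x hx hxp => ?_, fun p hp => ⟨3 * ρ / 2 / lam, by positivity, fun x hx => ?_⟩,
    fun x hx => ?_⟩
  · have hx0 : ξ x = x := hfar x fun p hp => by linarith [hxp p hp]
    rw [happ, hx0, Equiv.Perm.inv_eq_iff_eq, hfar]
    intro p hp
    have key : ∀ z ∈ Icc (0:ℝ) 1, |z - p| = 6 * ρ → |f z - z| ≤ 3 * ρ := fun z hz hzp => by
      have := (htan p hp z hz).2
      rw [hzp] at this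
      nlinarith
    have hpI := (hB p hp).1
    rcases le_abs.1 (hxp p hp) with h | h
    · have hz : p + 6 * ρ ∈ Icc (0:ℝ) 1 := ⟨by linarith [hpI.1], by linarith [hx.2]⟩
      have h1 := abs_le.1 (key _ hz (by rw [add_sub_cancel_left, abs_of_pos (by positivity)]))
      have h2 := hf.strictMonoOn.monotoneOn hz hx (by linarith)
      exact le_trans (by linarith [h1.1]) (le_abs_self _)
    · have hz : p - 6 * ρ ∈ Icc (0:ℝ) 1 := ⟨by linarith [hx.1], by linarith [hpI.2]⟩
      have h1 := abs_le.1 (key _ hz (by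
        rw [sub_sub_cancel_left, abs_neg, abs_of_pos (by positivity)]))
      have h2 := hf.strictMonoOn.monotoneOn hx hz (by linarith)
      exact le_trans (by linarith [h1.2]) (neg_le_abs _)
  · have hfix : ∀ y ∈ Icc (0:ℝ) 1, dsp f 0 y = 0 → ξ y = y := fun y hy hy0 => by
      rcases hend y hy hy0 with h | h
      · rw [hnear y h y (by rw [sub_self, abs_zero]; positivity)]
        simp
      · exact hfar y h
    rw [dsp_zero, dsp_zero, happ, sub_eq_zero, sub_eq_zero, Equiv.Perm.inv_eq_iff_eq]
    constructor
    · intro h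
      have := hfix x hx (by rw [dsp_zero, h, sub_self])
      rw [this, h]
    · intro h
      have := hfix _ ((hξ.mem_Icc_iff x).2 hx) (by rw [dsp_zero, h, sub_self])
      have h2 := ξ.injective this
      rwa [h2] at h
  · have hconj := hf.conj hξ.inv
    have hpI := (hB p hp).1
    rw [hconj.dsp_eq j hx]
    have e : (fun x => (ξ⁻¹ * f * ξ⁻¹⁻¹) x - x) =ᶠ[𝓝 x]
        fun x => (f (p - p / lam + lam⁻¹ * x) - (p - p / lam)) / lam⁻¹ - x := by
      have hc : Continuous fun y : ℝ => |y - p| := by fun_prop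
      filter_upwards [hc.continuousAt.eventually_lt_const hxp, Ioo_mem_nhds hx.1 hx.2] with y hy hy'
      rw [(hformula p hp y (Ioo_subset_Icc_self hy') hy.le).2,
        show p + (y - p) / lam = p - p / lam + lam⁻¹ * y by field_simp; ring]
      field_simp
      ring
    have hy := (hformula p hp x (Ioo_subset_Icc_self hx) hxp.le).1
    obtain ⟨y, hy'⟩ : ∃ y, y = p + (x - p) / lam := ⟨_, rfl⟩
    have hxy : |x - p| = lam * |y - p| := by
      rw [hy', add_sub_cancel_left, abs_div, abs_of_pos hlam0]
      field_simp
    rw [e.iteratedDeriv_eq, iteratedDeriv_affine_conj_sub f (inv_ne_zero hlam0.ne'),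
      show p - p / lam + lam⁻¹ * x = y by rw [hy']; field_simp; ring, inv_inv]
    have hyI : y ∈ Ioo (0:ℝ) 1 := by
      have hi0 : 0 < 1 / lam := one_div_pos.2 hlam0
      have hi1 : 1 / lam ≤ 1 := (div_le_one hlam0).2 hlam1
      rw [hy', show p + (x - p) / lam = (1 - 1 / lam) * p + 1 / lam * x by field_simp; ring]
      constructor
      · nlinarith [mul_nonneg (sub_nonneg.2 hi1) hpI.1, mul_pos hi0 hx.1]
      · nlinarith [mul_nonneg (sub_nonneg.2 hi1) (sub_nonneg.2 hpI.2),
          mul_pos hi0 (sub_pos.2 hx.2)]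
    have hyI' := Ioo_subset_Icc_self hyI
    rw [← hf.dsp_eq j hyI, abs_mul, abs_mul, abs_pow, abs_inv, abs_of_pos hlam0]
    refine le_trans ?_ hlamM
    have hx1 : |x - p| ≤ 1 := abs_le.2 ⟨by linarith [hx.1, hpI.2], by linarith [hx.2, hpI.1]⟩
    have hyp : |y - p| ≤ lam⁻¹ := by
      rw [← one_div, le_div_iff₀ hlam0]
      linarith
    match j, hj with
    | 0, _ =>
      have h1 := (htan p hp y hyI').2
      rw [pow_zero, one_mul, dsp_zero]
      calc lam * |f y - y| ≤ lam * (M * lam⁻¹ ^ 2) := by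
            refine mul_le_mul_of_nonneg_left (h1.trans ?_) hlam0.le
            gcongr
        _ = M / lam := by field_simp
    | 1, _ =>
      have h1 := (htan p hp y hyI').1
      rw [pow_one, mul_inv_cancel_left₀ hlam0.ne', div_eq_mul_inv]
      exact h1.trans (mul_le_mul_of_nonneg_left hyp hM0.le)
    | j + 2, hj =>
      have h1 := hM _ hj y hyI'
      have h2 : lam⁻¹ ^ j ≤ 1 := pow_le_one₀ (inv_nonneg.2 hlam0.le) (inv_le_one_of_one_le₀ hlam1)
      calc lam * (lam⁻¹ ^ (j + 2) * |dsp f (j + 2) y|) ≤ lam * (1 * lam⁻¹ ^ 2 * M) := by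
            rw [pow_add]
            gcongr
        _ = M / lam := by field_simp
  · rw [Equiv.Perm.inv_eq_iff_eq, hnear p hp]
    · field_simp
      ring
    · rw [add_sub_cancel_left, abs_mul, abs_of_pos hlam0]
      rw [le_div_iff₀ hlam0] at hx
      linarith
  · rw [Equiv.Perm.inv_eq_iff_eq, hfar x hx]

theorem IsComp.far_left {d : ℕ → ℝ → ℝ} {B : Finset ℝ} {ρ a b x : ℝ} (h : IsComp d a b)
    (hB : ∀ p ∈ B, d 0 p = 0)
    (hgap : ∀ p ∈ B, ∀ q ∈ Icc (0:ℝ) 1, d 0 q = 0 → q ≠ p → 60 * ρ ≤ |q - p|)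
    (ha : a ∉ B) (hρ : 0 < ρ) (hx : a ≤ x) (hx' : x ≤ (a + b) / 2) : ∀ p ∈ B, 7 * ρ ≤ |x - p| := by
  intro p hp
  have hg := hgap p hp a ⟨h.nonneg, h.lt.le.trans h.le_one⟩ h.left fun e => ha (e ▸ hp)
  rcases lt_or_ge p b with hpb | hpb
  · have := h.le_left (hB p hp) hpb
    rw [abs_of_nonneg (by linarith)] at hg ⊢
    linarith
  · have := h.lt
    rw [abs_of_nonpos (by linarith)] at hg ⊢
    linarith

theorem IsComp.far_right {d : ℕ → ℝ → ℝ} {B : Finset ℝ} {ρ a b x : ℝ} (h : IsComp d a b)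
    (hB : ∀ p ∈ B, d 0 p = 0)
    (hgap : ∀ p ∈ B, ∀ q ∈ Icc (0:ℝ) 1, d 0 q = 0 → q ≠ p → 60 * ρ ≤ |q - p|)
    (hb : b ∉ B) (hρ : 0 < ρ) (hx : x ≤ b) (hx' : (a + b) / 2 ≤ x) : ∀ p ∈ B, 7 * ρ ≤ |x - p| := by
  intro p hp
  have hg := hgap p hp b ⟨h.nonneg.trans h.lt.le, h.le_one⟩ h.right fun e => hb (e ▸ hp)
  rcases lt_or_ge a p with hpa | hpa
  · have := h.right_le (hB p hp) hpa
    rw [abs_of_nonpos (by linarith)] at hg ⊢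
    linarith
  · have := h.lt
    rw [abs_of_nonneg (by linarith)] at hg ⊢
    linarith

theorem exists_conj_dsp_le {f : Equiv.Perm ℝ} (hf : IccDiff f) (hV : SublinVar f) {r : ℕ}
    (hr : 2 ≤ r) {ε : ℝ} (hε : ε ∈ Ioc (0:ℝ) 1) :
    ∃ lam > 0, ∃ φ : Equiv.Perm ℝ, GDiff φ ∧
      (∀ j ≤ r, ∀ x ∈ Icc (0:ℝ) 1, |dsp (φ * f * φ⁻¹ : Equiv.Perm ℝ) j x| ≤ ε) ∧
      (FlatAt (dsp f) 0 → FlatAt (dsp f) 1 →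
        ∃ δ > 0, ∀ x, |x| ≤ δ ∨ |x - 1| ≤ δ → φ x = x) ∧
      ((∀ p ∈ Icc (0:ℝ) 1, dsp f 0 p = 0 → ¬ FlatAt (dsp f) p) →
        ∃ δ > 0, (∀ x, |x| ≤ δ → φ x = lam * x) ∧
          ∀ x, |x - 1| ≤ δ → φ x = 1 + lam * (x - 1)) := by
  obtain ⟨κ, hκ, hU⟩ := exists_unitConst hr
  have hc : 0 < κ * ε := mul_pos hκ hε.1
  have hd0 : dsp f 0 0 = 0 := by rw [dsp_zero, hf.zero, sub_zero]
  have hd1 : dsp f 0 1 = 0 := by rw [dsp_zero, hf.one, sub_self]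
  obtain ⟨B, T, hT, hB, hBall, hcalm, hnice⟩ := hf.jet.exists_selection hd0 hd1 hc hε.1 r
  have hB0 : ∀ p ∈ B, dsp f 0 p = 0 := fun p hp => (hB p hp).2.1
  obtain ⟨lam, hlam, ρ, hρ, φ, hφ, hgap, hfar, hzero, hnear, hlin, hid⟩ := hf.exists_zoom B
    (fun p hp => ⟨(hB p hp).1, (hB p hp).2.1, hV.dsp_one_eq_zero hf (hB p hp).1
      (by have := hB0 p hp; rw [dsp_zero] at this; linarith), (hB p hp).2.2⟩) hr hc
  have heq : ∀ x ∈ Icc (0:ℝ) 1, (∀ p ∈ B, 7 * ρ ≤ |x - p|) →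
      ∀ j, dsp f j x = dsp (φ * f * φ⁻¹ : Equiv.Perm ℝ) j x := fun x hx hxp j =>
    dsp_congr hρ hx (fun y hy hyx => (hfar y hy fun p hp => by
      have := hxp p hp
      have := abs_sub_le x y p
      rw [abs_sub_comm x y] at this
      linarith).symm) j
  have hcomp : ∀ a b, IsComp (dsp (φ * f * φ⁻¹ : Equiv.Perm ℝ)) a b → IsComp (dsp f) a b :=
    fun a b h => h.congr fun x hx => (hzero x hx).symm
  have hwide : ∀ a b, IsComp (dsp f) a b → (a ∈ B ∨ b ∈ B) → ρ ≤ (b - a) / 10 := fun a b h hab => by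
    have := h.lt
    rcases hab with ha | hb
    · have := hgap a ha b ⟨h.nonneg.trans h.lt.le, h.le_one⟩ h.right h.lt.ne'
      rw [abs_of_pos (by linarith)] at this
      linarith
    · have := hgap b hb a ⟨h.nonneg, h.lt.le.trans h.le_one⟩ h.left h.lt.ne
      rw [abs_of_neg (by linarith)] at this
      linarith
  obtain ⟨ψ, hψ, ⟨σ, hσ, hψid⟩, hψs⟩ := exists_conj_of_nice hκ hU hε hT (hf.conj hφ)
    (hV.conj hf hφ)
    (fun a b h hab j hj x hx => by
      have h' := hcomp a b h
      obtain ⟨ha, hb, hs⟩ := hcalm a b h' hab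
      rw [← heq x (Ioo_subset_Icc_self (h'.Ioo_subset hx)) (by
        rcases le_total x ((a + b) / 2) with hm | hm
        · exact h'.far_left hB0 hgap ha hρ hx.1.le hm
        · exact h'.far_right hB0 hgap hb hρ hx.2.le hm) j]
      exact hs j hj x hx)
    (fun a b h hab => by
      have h' := hcomp a b h
      have hlt := h'.lt
      obtain ⟨hl, hr'⟩ := hnice a b h' hab
      constructor
      · by_cases ha : a ∈ B
        · have hw := hwide a b h' (Or.inl ha)
          refine ⟨ρ, hρ, hw, fun j hj x hx => hnear a ha j hj x
            (h'.Ioo_subset ⟨hx.1, by linarith [hx.2]⟩) ?_⟩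
          rw [abs_lt]
          constructor <;> linarith [hx.1, hx.2]
        · obtain ⟨S, hS, hS', hs⟩ := hl.resolve_left ha
          refine ⟨S, hS, hS', fun j hj x hx => ?_⟩
          rw [← heq x (Ioo_subset_Icc_self (h'.Ioo_subset ⟨hx.1, by linarith [hx.2]⟩))
            (h'.far_left hB0 hgap ha hρ hx.1.le (by linarith [hx.2])) j]
          exact hs j hj x hx
      · by_cases hb : b ∈ B
        · have hw := hwide a b h' (Or.inr hb)
          refine ⟨ρ, hρ, hw, fun j hj x hx => hnear b hb j hj x
            (h'.Ioo_subset ⟨by linarith [hx.1], hx.2⟩) ?_⟩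
          rw [abs_lt]
          constructor <;> linarith [hx.1, hx.2]
        · obtain ⟨S, hS, hS', hs⟩ := hr'.resolve_left hb
          refine ⟨S, hS, hS', fun j hj x hx => ?_⟩
          rw [← heq x (Ioo_subset_Icc_self (h'.Ioo_subset ⟨by linarith [hx.1], hx.2⟩))
            (h'.far_right hB0 hgap hb hρ hx.2.le (by linarith [hx.1])) j]
          exact hs j hj x hx)
  refine ⟨lam, hlam, ψ * φ, hψ.mul hφ, ?_, fun hf0 hf1 => ?_, fun hnf => ?_⟩
  · have e : ψ * φ * f * (ψ * φ)⁻¹ = ψ * (φ * f * φ⁻¹) * ψ⁻¹ := by group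
    rwa [e]
  · have hn : ∀ e ∈ Icc (0:ℝ) 1, dsp f 0 e = 0 → e ∉ B → ∀ x, |x - e| ≤ ρ → φ x = x :=
      fun e he he0 heB x hx => hid x fun p hp => by
        have h1 := hgap p hp e he he0 fun h => heB (h ▸ hp)
        have h2 := abs_sub_le e x p
        rw [abs_sub_comm e x] at h2
        linarith
    refine ⟨min ρ σ, lt_min hρ hσ, fun x hx => ?_⟩
    have m1 := min_le_left ρ σ
    have m2 := min_le_right ρ σ
    rw [Equiv.Perm.mul_apply]
    rcases hx with hx | hx
    · rw [hn 0 (by simp) hd0 (fun h => (hB 0 h).2.2 hf0) x (by rw [sub_zero]; linarith)]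
      exact hψid x fun h => by linarith [h.1, le_abs_self x]
    · rw [hn 1 (by simp) hd1 (fun h => (hB 1 h).2.2 hf1) x (by linarith)]
      exact hψid x fun h => by linarith [h.2, neg_le_abs (x - 1)]
  · obtain ⟨δ₀, hδ₀, hl0⟩ := hlin 0 (hBall hnf 0 (by simp) hd0)
    obtain ⟨δ₁, hδ₁, hl1⟩ := hlin 1 (hBall hnf 1 (by simp) hd1)
    have m1 := min_le_left (min δ₀ δ₁) (σ / lam)
    have m2 := min_le_right (min δ₀ δ₁) (σ / lam)
    have m3 := min_le_left δ₀ δ₁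
    have m4 := min_le_right δ₀ δ₁
    have key : ∀ y, |y| ≤ min (min δ₀ δ₁) (σ / lam) → |lam * y| ≤ σ := fun y hy => by
      rw [abs_mul, abs_of_pos hlam, mul_comm, ← le_div_iff₀ hlam]
      exact hy.trans m2
    refine ⟨min (min δ₀ δ₁) (σ / lam), by positivity, fun x hx => ?_, fun x hx => ?_⟩
    · rw [Equiv.Perm.mul_apply, hl0 x (by rw [sub_zero]; linarith), zero_add, sub_zero]
      exact hψid _ fun h => by linarith [h.1, le_abs_self (lam * x), key x hx]
    · rw [Equiv.Perm.mul_apply, hl1 x (by linarith)]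
      exact hψid _ fun h => by linarith [h.2, neg_le_abs (lam * (x - 1)), key _ hx]

theorem ITIat.congr {f g : ℝ → ℝ} (h : EqOn f g (Icc 0 1)) {p : ℝ} (hp : p ∈ Icc (0:ℝ) 1)
    (hf : ITIat f p) : ITIat g p :=
  ⟨by rw [← derivWithin_congr h (h hp)]; exact hf.1,
    fun k hk => by rw [← iteratedDerivWithin_congr h hp]; exact hf.2 k hk⟩

theorem IccDiff.dsp_eq_sub {f : Equiv.Perm ℝ} (hf : IccDiff f) (j : ℕ) {x : ℝ}
    (hx : x ∈ Icc (0:ℝ) 1) : dsp f j x =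
      iteratedDerivWithin j f (Icc 0 1) x - iteratedDerivWithin j id (Icc 0 1) x :=
  iteratedDerivWithin_sub hx uniqueDiffOn_unitIcc
    ((hf.smooth x hx).of_le (by exact_mod_cast le_top))
    (contDiff_id.contDiffWithinAt)

theorem iteratedDerivWithin_id_of_two_le {k : ℕ} (hk : 2 ≤ k) {x : ℝ} (hx : x ∈ Icc (0:ℝ) 1) :
    iteratedDerivWithin k id (Icc (0:ℝ) 1) x = 0 := by
  obtain ⟨m, rfl⟩ := Nat.exists_eq_add_of_le' hk
  have h : EqOn (derivWithin id (Icc (0:ℝ) 1)) (fun _ => (1:ℝ)) (Icc 0 1) := fun y hy =>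
    derivWithin_id y _ (uniqueDiffOn_unitIcc y hy)
  rw [iteratedDerivWithin_succ', iteratedDerivWithin_congr h hx, iteratedDerivWithin_const,
    if_neg (Nat.succ_ne_zero m)]

theorem IccDiff.flatAt_iff {f : Equiv.Perm ℝ} (hf : IccDiff f) {p : ℝ} (hp : p ∈ Icc (0:ℝ) 1)
    (hfp : f p = p) : FlatAt (dsp f) p ↔ ITIat f p := by
  refine ⟨fun h => ⟨?_, fun k hk => ?_⟩, fun h j => ?_⟩
  · have := h 1
    rw [hf.dsp_one hp] at this
    linarith
  · have := h k
    rwa [hf.dsp_eq_sub k hp, iteratedDerivWithin_id_of_two_le hk hp, sub_zero] at this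
  · rcases lt_or_ge j 2 with hj | hj
    · interval_cases j
      · rw [dsp_zero, hfp, sub_self]
      · rw [hf.dsp_one hp, h.1, sub_self]
    · rw [hf.dsp_eq_sub j hp, iteratedDerivWithin_id_of_two_le hj hp, h.2 j hj, sub_zero]

namespace DiffIcc

variable {n : ℕ∞}

open Classical in
/-- Extension by the identity to the line. -/
def perm (f : DiffIcc n) : Equiv.Perm ℝ where
  toFun x := if x ∈ Icc (0:ℝ) 1 then f.toFun x else x
  invFun x := if x ∈ Icc (0:ℝ) 1 then f.invFun x else x
  left_inv x := by
    by_cases hx : x ∈ Icc (0:ℝ) 1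
    · simp only [if_pos hx, if_pos (f.maps hx), f.left_inv x hx]
    · simp only [if_neg hx]
  right_inv x := by
    by_cases hx : x ∈ Icc (0:ℝ) 1
    · simp only [if_pos hx, if_pos (f.maps_inv hx), f.right_inv x hx]
    · simp only [if_neg hx]

theorem perm_eqOn (f : DiffIcc n) : EqOn f.perm f.toFun (Icc 0 1) := fun _ hx => if_pos hx

theorem perm_iccDiff (f : DiffIcc ⊤) : IccDiff f.perm where
  smooth := f.smooth.congr f.perm_eqOn
  mem_iff x := by
    by_cases hx : x ∈ Icc (0:ℝ) 1
    · rw [f.perm_eqOn hx]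
      exact iff_of_true (f.maps hx) hx
    · rw [show f.perm x = x from if_neg hx]
  deriv_pos x hx := by
    rw [derivWithin_congr f.perm_eqOn (f.perm_eqOn hx)]
    exact f.deriv_pos x hx
  zero := (f.perm_eqOn (by simp)).trans f.fix0
  one := (f.perm_eqOn (by simp)).trans f.fix1

theorem sublinVar_perm (f : DiffIcc ⊤) (h : IAsympVarVanishes f.toFun) : SublinVar f.perm := by
  refine SublinVar.of_tendsto f.perm_iccDiff (h.congr fun n => ?_)
  have hit : EqOn f.toFun^[n] f.perm^[n] (Icc 0 1) := by
    induction n with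
    | zero => exact fun _ _ => rfl
    | succ n ih =>
      intro x hx
      rw [Function.iterate_succ_apply, Function.iterate_succ_apply, f.perm_eqOn hx]
      exact ih (f.maps hx)
  congr 2
  refine eVariationOn.congr fun x hx => ?_
  simp only [derivWithin_congr hit (hit hx)]

end DiffIcc

/-- The restriction to `[0, 1]` of a diffeomorphism of the line. -/
def GDiff.toDiffIcc {φ : Equiv.Perm ℝ} (h : GDiff φ) : DiffIcc ⊤ where
  toFun := φ
  invFun := (φ⁻¹ : Equiv.Perm ℝ)
  smooth := h.smooth.contDiffOn
  smooth_inv := h.inv.smooth.contDiffOn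
  maps x hx := (h.mem_Icc_iff x).2 hx
  maps_inv x hx := (h.inv.mem_Icc_iff x).2 hx
  left_inv x _ := inv_perm_apply φ x
  right_inv x _ := apply_inv_perm φ x
  fix0 := h.zero
  fix1 := h.one
  deriv_pos := h.iccDiff.deriv_pos

theorem GDiff.iDistLt_conj {φ : Equiv.Perm ℝ} (h : GDiff φ) (f : DiffIcc ⊤) {r : ℕ} {ε : ℝ}
    (hd : ∀ j ≤ r, ∀ x ∈ Icc (0:ℝ) 1, |dsp (φ * f.perm * φ⁻¹ : Equiv.Perm ℝ) j x| < ε) :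
    IDistLt r ε (φ ∘ f.toFun ∘ (φ⁻¹ : Equiv.Perm ℝ)) _root_.id := fun k hk x hx => by
  have he : EqOn (φ ∘ f.toFun ∘ (φ⁻¹ : Equiv.Perm ℝ)) (φ * f.perm * φ⁻¹ : Equiv.Perm ℝ) (Icc 0 1) :=
    fun y hy => congrArg φ (f.perm_eqOn ((h.inv.mem_Icc_iff y).2 hy)).symm
  rw [iteratedDerivWithin_congr he hx, ← (f.perm_iccDiff.conj h).dsp_eq_sub k hx]
  exact hd k hk x hx

theorem GDiff.iTIat_of_eq {φ : Equiv.Perm ℝ} (h : GDiff φ) {p δ : ℝ} (hp : p ∈ Icc (0:ℝ) 1)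
    (hδ : 0 < δ) (hid : ∀ x, |x - p| ≤ δ → φ x = x) : ITIat φ p := by
  refine (h.iccDiff.flatAt_iff hp (hid p (by simpa using hδ.le))).1 fun j => ?_
  rw [dsp_congr hδ hp (fun y _ hy => (hid y hy.le).trans (id_eq y).symm) j, dsp_id]

/-- Theorem C: any `f ∈ Diff^∞_+([0,1])` with vanishing asymptotic variation can be
conjugated arbitrarily close to the identity; if `f` is ITI at both endpoints the
conjugacies can be taken ITI there, and if `f` is nowhere ITI they can be taken to
coincide with homotheties of the same ratio near the endpoints. -/
theorem conj_close_to_id_of_asympVar_vanishes (f : DiffIcc ⊤)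
    (hvar : IAsympVarVanishes f.toFun) :
    (∀ r : ℕ, ∀ ε > (0 : ℝ), ∃ φ : DiffIcc ⊤,
        IDistLt r ε (φ.toFun ∘ f.toFun ∘ φ.invFun) id) ∧
    ((ITIat f.toFun 0 ∧ ITIat f.toFun 1) →
      ∀ r : ℕ, ∀ ε > (0 : ℝ), ∃ φ : DiffIcc ⊤,
        IDistLt r ε (φ.toFun ∘ f.toFun ∘ φ.invFun) id ∧
        ITIat φ.toFun 0 ∧ ITIat φ.toFun 1) ∧
    ((∀ x ∈ Set.Icc (0:ℝ) 1, f.toFun x = x → ¬ ITIat f.toFun x) →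
      ∀ r : ℕ, ∀ ε > (0 : ℝ), ∃ φ : DiffIcc ⊤, ∃ lam > (0 : ℝ),
        IDistLt r ε (φ.toFun ∘ f.toFun ∘ φ.invFun) id ∧
        (∃ δ > (0 : ℝ), ∀ x ∈ Set.Icc 0 δ, φ.toFun x = lam * x) ∧
        (∃ δ > (0 : ℝ), ∀ x ∈ Set.Icc (1 - δ) 1, φ.toFun x = 1 - lam * (1 - x))) := by
  have key : ∀ r : ℕ, ∀ ε > (0 : ℝ), ∃ lam > 0, ∃ φ : Equiv.Perm ℝ, ∃ h : GDiff φ,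
      IDistLt r ε (h.toDiffIcc.toFun ∘ f.toFun ∘ h.toDiffIcc.invFun) id ∧
      (ITIat f.toFun 0 → ITIat f.toFun 1 → ITIat φ 0 ∧ ITIat φ 1) ∧
      ((∀ x ∈ Icc (0:ℝ) 1, f.toFun x = x → ¬ ITIat f.toFun x) →
        ∃ δ > 0, (∀ x, |x| ≤ δ → φ x = lam * x) ∧
          ∀ x, |x - 1| ≤ δ → φ x = 1 + lam * (x - 1)) := fun r ε hε => by
    have hF := f.perm_iccDiff
    have hiti : ∀ p ∈ Icc (0:ℝ) 1, f.toFun p = p → (FlatAt (dsp f.perm) p ↔ ITIat f.toFun p) :=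
      fun p hp hfp => by
        rw [hF.flatAt_iff hp ((f.perm_eqOn hp).trans hfp)]
        exact ⟨ITIat.congr f.perm_eqOn hp, ITIat.congr f.perm_eqOn.symm hp⟩
    have hε' : min (ε / 2) 1 ∈ Ioc (0:ℝ) 1 := ⟨by positivity, min_le_right _ _⟩
    obtain ⟨lam, hlam, φ, hφ, h1, h2, h3⟩ :=
      exists_conj_dsp_le hF (f.sublinVar_perm hvar) (le_max_right r 2) hε'
    refine ⟨lam, hlam, φ, hφ, hφ.iDistLt_conj f fun j hj x hx => ?_, fun i0 i1 => ?_,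
      fun hn => h3 fun p hp hp0 => ?_⟩
    · have := h1 j (hj.trans (le_max_left _ _)) x hx
      linarith [min_le_left (ε / 2) 1]
    · obtain ⟨δ, hδ, hid⟩ := h2 ((hiti 0 (by simp) f.fix0).2 i0) ((hiti 1 (by simp) f.fix1).2 i1)
      exact ⟨hφ.iTIat_of_eq (by simp) hδ fun x hx => hid x (Or.inl (by rwa [sub_zero] at hx)),
        hφ.iTIat_of_eq (by simp) hδ fun x hx => hid x (Or.inr hx)⟩
    · rw [dsp_zero, f.perm_eqOn hp, sub_eq_zero] at hp0
      rw [hiti p hp hp0]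
      exact hn p hp hp0
  refine ⟨fun r ε hε => ?_, fun hi r ε hε => ?_, fun hn r ε hε => ?_⟩
  · obtain ⟨_, _, _, h, hd, _⟩ := key r ε hε
    exact ⟨h.toDiffIcc, hd⟩
  · obtain ⟨_, _, _, h, hd, h2, _⟩ := key r ε hε
    exact ⟨h.toDiffIcc, hd, h2 hi.1 hi.2⟩
  · obtain ⟨lam, hlam, φ, h, hd, _, h3⟩ := key r ε hε
    obtain ⟨δ, hδ, hl0, hl1⟩ := h3 hn
    refine ⟨h.toDiffIcc, lam, hlam, hd, ⟨δ, hδ, fun x hx => ?_⟩, ⟨δ, hδ, fun x hx => ?_⟩⟩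
    · exact hl0 x (by rw [abs_of_nonneg hx.1]; exact hx.2)
    · refine (hl1 x (by rw [abs_of_nonpos (by linarith [hx.2])]; linarith [hx.1])).trans ?_
      ring
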